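/- arXiv:1505.07935 — 7 statements merged into one kernel-verified Lean document; each statement's English description precedes it below -/
import Mathlib

section
/- Let d ≥ 1, let φ : 𝔻^d → 𝔻^d be a holomorphic map which is truly d-dimensional (i.e. there exists a point a ∈ 𝔻^d at which the complex derivative φ'(a) : ℂ^d → ℂ^d is an invertible linear map), and suppose there exists a bounded linear operator T on ℓ²(ℕ^d) which is the composition operator C_φ and which is compact. Then there exist constants 0 < c ≤ C < ∞, independent of n, such that a_n(T) ≥ c · exp(−C · n^{1/d}) for all n ≥ 1. -/
open scoped ENNReal

noncomputable section

/-- The open unit polydisk in `ℂ^d`. -/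
def polydisk (d : ℕ) : Set (Fin d → ℂ) := {z | ∀ j, ‖z j‖ < 1}

/-- The Hardy space of the polydisk, identified with `ℓ²(ℕ^d)` via Taylor coefficients. -/
abbrev H2 (d : ℕ) := lp (fun _ : Fin d → ℕ => ℂ) 2

/-- Approximation numbers of a bounded operator: `a_n(T) = inf {‖T - R‖ : rank R < n}`. -/
def approxNumber {H : Type} [NormedAddCommGroup H] [NormedSpace ℂ H]
    (T : H →L[ℂ] H) (n : ℕ) : ℝ :=
  sInf {c : ℝ | ∃ R : H →L[ℂ] H, LinearMap.rank (R : H →ₗ[ℂ] H) < (n : Cardinal) ∧ c = ‖T - R‖}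

/-- `T` is the composition operator `C_φ` on `H²(𝔻^d) ≃ ℓ²(ℕ^d)`:
for every `c ∈ ℓ²(ℕ^d)` and `z ∈ 𝔻^d`, the series `∑_α c_α φ(z)^α` converges absolutely
and equals `∑_α (T c)_α z^α` (also absolutely convergent). -/
def IsCompositionOperator {d : ℕ} (φ : (Fin d → ℂ) → (Fin d → ℂ))
    (T : H2 d →L[ℂ] H2 d) : Prop :=
  ∀ c : H2 d, ∀ z ∈ polydisk d,
    Summable (fun α : Fin d → ℕ => ‖c α * ∏ j, (φ z j) ^ (α j)‖) ∧
    Summable (fun α : Fin d → ℕ => ‖(T c) α * ∏ j, (z j) ^ (α j)‖) ∧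
    (∑' α : Fin d → ℕ, c α * ∏ j, (φ z j) ^ (α j))
      = ∑' α : Fin d → ℕ, (T c) α * ∏ j, (z j) ^ (α j)

section Aux
open Polynomial

lemma aux_iter (p : ℂ[X]) (k : ℕ) :
    iteratedDeriv k (fun z => p.eval z) = fun z => (derivative^[k] p).eval z := by
  induction k with
  | zero => simp
  | succ k ih =>
    rw [iteratedDeriv_succ, ih, Function.iterate_succ_apply']
    funext z
    simp

lemma aux_cauchy (p : ℂ[X]) (b : ℂ) (r M : ℝ) (hr : 0 < r)
    (hp : ∀ z, ‖z - b‖ ≤ r → ‖p.eval z‖ ≤ M) (k : ℕ) :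
    ‖(taylor b p).coeff k‖ ≤ M / r ^ k := by
  have h := Complex.norm_iteratedDeriv_le_of_forall_mem_sphere_norm_le (c := b) (R := r) (C := M)
    (f := fun z => p.eval z) k hr (p.differentiable.diffContOnCl) (fun z hz => hp z (by
      rw [mem_sphere_iff_norm] at hz; exact hz.le))
  rw [aux_iter, ← factorial_smul_hasseDeriv] at h
  rw [taylor_coeff]
  have hk : (0 : ℝ) < (k.factorial : ℝ) := by positivity
  beta_reduce at h
  rw [LinearMap.smul_apply, eval_smul, nsmul_eq_mul, norm_mul, Complex.norm_natCast,
    mul_div_assoc] at h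
  exact le_of_mul_le_mul_left h hk

lemma aux_one (N : ℕ) (b : ℂ) (hb : ‖b‖ ≤ 1) (r M : ℝ) (hr : 0 < r) (hr1 : r ≤ 1)
    (c : Fin N → ℂ)
    (hp : ∀ z, ‖z - b‖ ≤ r → ‖∑ i, c i * z ^ (i : ℕ)‖ ≤ M) (k : Fin N) :
    ‖c k‖ ≤ (N * (2 / r) ^ N) * M := by
  have hM : 0 ≤ M := (norm_nonneg _).trans (hp b (by simpa using hr.le))
  set p : ℂ[X] := ∑ i, C (c i) * X ^ (i : ℕ) with hpdef
  have hev : ∀ z, p.eval z = ∑ i, c i * z ^ (i : ℕ) := by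
    intro z; simp [hpdef, eval_finsetSum]
  have hck : p.coeff k = c k := by
    simp only [hpdef, finsetSum_coeff, coeff_C_mul, coeff_X_pow]
    rw [Finset.sum_eq_single k]
    · simp
    · intro j _ hj
      have : (k : ℕ) ≠ j := fun h => hj (Fin.ext h.symm)
      simp [this]
    · simp
  have hdeg : p.natDegree < N := by
    have : p.natDegree ≤ N - 1 := by
      apply natDegree_sum_le_of_forall_le
      intro i _
      refine (natDegree_C_mul_X_pow_le _ _).trans ?_
      have := i.2
      omega
    have := k.2
    omega
  have hq := aux_cauchy p b r M hr (fun z hz => by rw [hev]; exact hp z hz)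
  set q := taylor b p with hqdef
  have hpq : p = taylor (-b) q := by rw [hqdef, taylor_taylor]; simp
  have hqdeg : q.natDegree < N := by rw [hqdef, natDegree_taylor]; exact hdeg
  rw [← hck, hpq, taylor_coeff, hasseDeriv_apply, sum_over_range' _ (by simp) N hqdeg,
    eval_finsetSum]
  refine (norm_sum_le _ _).trans ?_
  have : ∀ i ∈ Finset.range N, ‖eval (-b) (monomial (i - (k:ℕ)) (((i.choose k : ℕ) : ℂ) * q.coeff i))‖
      ≤ (2 / r) ^ N * M := by
    intro i hi
    rw [Finset.mem_range] at hi
    rw [eval_monomial, norm_mul, norm_mul, norm_pow, norm_neg, Complex.norm_natCast]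
    have h1 : ‖b‖ ^ (i - (k:ℕ)) ≤ 1 := pow_le_one₀ (norm_nonneg _) hb
    have h2 : (i.choose k : ℝ) ≤ 2 ^ i := by exact_mod_cast Nat.choose_le_two_pow i k
    have h3 := hq i
    calc (i.choose k : ℝ) * ‖q.coeff i‖ * ‖b‖ ^ (i - (k:ℕ))
        ≤ 2 ^ i * (M / r ^ i) * 1 := by gcongr
      _ = (2 / r) ^ i * M := by rw [div_pow]; field_simp
      _ ≤ (2 / r) ^ N * M := by
        gcongr
        rw [le_div_iff₀ hr]; linarith
  refine (Finset.sum_le_sum this).trans ?_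
  rw [Finset.sum_const, Finset.card_range, nsmul_eq_mul, mul_assoc]

end Aux

lemma aux_multi (N : ℕ) (r : ℝ) (hr : 0 < r) (hr1 : r ≤ 1) (d : ℕ) :
    ∀ (b : Fin d → ℂ), (∀ j, ‖b j‖ ≤ 1) → ∀ (M : ℝ) (c : (Fin d → Fin N) → ℂ),
    (∀ z : Fin d → ℂ, (∀ j, ‖z j - b j‖ ≤ r) →
      ‖∑ α, c α * ∏ j, z j ^ (α j : ℕ)‖ ≤ M) →
    ∀ α, ‖c α‖ ≤ (N * (2 / r) ^ N) ^ d * M := by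
  induction d with
  | zero =>
    intro b hb M c h α
    have := h b (fun j => j.elim0)
    simpa [Subsingleton.elim default α] using this
  | succ d ih =>
    intro b hb M c h α
    have key : ∀ (k : Fin N) (z : Fin d → ℂ), (∀ j, ‖z j - b j.succ‖ ≤ r) →
        ‖∑ β : Fin d → Fin N, c (Fin.cons k β) * ∏ j, z j ^ (β j : ℕ)‖ ≤ (N * (2 / r) ^ N) * M := by
      intro k z hz
      refine aux_one N (b 0) (hb 0) r M hr hr1
        (fun k => ∑ β : Fin d → Fin N, c (Fin.cons k β) * ∏ j, z j ^ (β j : ℕ)) ?_ k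
      intro w hw
      have := h (Fin.cons w z) (fun j => by
        refine Fin.cases ?_ (fun i => ?_) j
        · simpa using hw
        · simpa using hz i)
      convert this using 2
      rw [← (Fin.consEquiv (fun _ : Fin (d+1) => Fin N)).sum_comp, Fintype.sum_prod_type]
      refine Finset.sum_congr rfl fun i _ => ?_
      rw [Finset.sum_mul]
      refine Finset.sum_congr rfl fun β _ => ?_
      simp [Fin.consEquiv, Fin.prod_univ_succ]
      ring
    have := ih (fun j => b j.succ) (fun j => hb _) _ (fun β => c (Fin.cons (α 0) β)) (key (α 0))
      (Fin.tail α)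
    simp only [Fin.cons_self_tail] at this
    rw [pow_succ, mul_assoc]
    exact this

lemma aux_summable (s : ℝ) (hs : 0 ≤ s) (hs1 : s < 1) (d : ℕ) :
    Summable (fun α : Fin d → ℕ => ∏ j, s ^ (α j)) := by
  induction d with
  | zero => exact (hasSum_fintype _).summable
  | succ d ih =>
    rw [← (Fin.consEquiv (fun _ : Fin (d+1) => ℕ)).summable_iff]
    have := (summable_geometric_of_lt_one hs hs1).mul_of_nonneg ih (fun _ => by positivity)
      (fun _ => by dsimp; positivity)
    convert this using 2 with x
    simp [Fin.consEquiv, Fin.prod_univ_succ]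

lemma aux_cont {E F : Type*} [NormedAddCommGroup E] [NormedSpace ℂ E] [NormedAddCommGroup F]
    [NormedSpace ℂ F] (φ : E → F) (a : E)
    (h : ∀ᶠ y in nhds a, DifferentiableAt ℂ φ y) : ContinuousAt (fderiv ℂ φ) a := by
  rw [Metric.continuousAt_iff]
  intro ε hε
  have ha : HasFDerivAt φ (fderiv ℂ φ a) a := h.self_of_nhds.hasFDerivAt
  set f' := fderiv ℂ φ a
  have h1 := (hasFDerivAt_iff_isLittleO.1 ha).def (show 0 < ε / 4 by positivity)
  obtain ⟨δ, hδ, hball⟩ := Metric.eventually_nhds_iff.1 (h.and h1)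
  refine ⟨δ / 4, by positivity, fun y hy => ?_⟩
  rw [dist_eq_norm] at hy ⊢
  have hmem : ∀ (v : E), ‖v‖ ≤ δ / 2 → dist (y + v) a < δ := by
    intro v hv
    rw [dist_eq_norm, show y + v - a = (y - a) + v by abel]
    exact (norm_add_le _ _).trans_lt (by linarith)
  have hle : ‖fderiv ℂ φ y - f'‖ ≤ ε * (3 / 4) := by
    refine ContinuousLinearMap.opNorm_le_of_shell (ε := δ / 2) (c := (2 : ℂ)) (by positivity) (by positivity) (by simp) ?_
    intro v hv1 hv2
    have h2 : ‖(2 : ℂ)‖ = 2 := by simp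
    rw [h2] at hv1
    have hmem2 : ∀ t : ℂ, ‖t‖ ≤ 1 → dist (y + t • v) a < δ := by
      intro t ht
      apply hmem
      rw [norm_smul]
      nlinarith [norm_nonneg v, norm_nonneg t]
    have hg : ∀ t : ℂ, ‖t‖ ≤ 1 → HasDerivAt (fun t : ℂ => φ (y + t • v) - φ a - f' (y + t • v - a))
        (fderiv ℂ φ (y + t • v) v - f' v) t := by
      intro t ht
      have hline : HasDerivAt (fun t : ℂ => y + t • v) v t := by
        simpa using ((hasDerivAt_id t).smul_const v).const_add y
      have hd1 := (hball (hmem2 t ht)).1.hasFDerivAt.comp_hasDerivAt t hline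
      have hd2 := f'.hasFDerivAt.comp_hasDerivAt t (hline.sub_const a)
      exact (hd1.sub_const (φ a)).sub hd2
    have hC := Complex.norm_deriv_le_of_forall_mem_sphere_norm_le (c := 0) (R := 1)
      (C := ε / 4 * (3 * δ / 4))
      (f := fun t : ℂ => φ (y + t • v) - φ a - f' (y + t • v - a)) one_pos
      (DifferentiableOn.diffContOnCl (fun t ht =>
        (hg t (by
          rw [closure_ball _ one_ne_zero] at ht
          simpa using ht)).differentiableAt.differentiableWithinAt))
      (fun t ht => by
        have ht1 : ‖t‖ = 1 := by simpa using ht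
        refine (hball (hmem2 t ht1.le)).2.trans ?_
        gcongr
        rw [show y + t • v - a = (y - a) + t • v by abel]
        refine (norm_add_le _ _).trans ?_
        rw [norm_smul, ht1]
        linarith)
    rw [(hg 0 (by simp)).deriv] at hC
    simp only [zero_smul, add_zero, div_one] at hC
    rw [_root_.sub_apply]
    refine hC.trans ?_
    nlinarith
  linarith

lemma aux_eval (s : ℝ) (hs : 0 ≤ s) (hs1 : s < 1) (d : ℕ) (g : H2 d) (z : Fin d → ℂ)
    (hz : ∀ j, ‖z j‖ ≤ s) :
    ‖∑' α : Fin d → ℕ, g α * ∏ j, (z j) ^ (α j)‖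
      ≤ (∑' α : Fin d → ℕ, ∏ j, s ^ (α j)) * ‖g‖ := by
  refine tsum_of_norm_bounded ((aux_summable s hs hs1 d).hasSum.mul_right ‖g‖) ?_
  intro α
  rw [norm_mul, norm_prod, mul_comm]
  have h1 : ‖g α‖ ≤ ‖g‖ := lp.norm_apply_le_norm (by simp) g α
  have h2 : ∏ j, ‖z j ^ α j‖ ≤ ∏ j, s ^ (α j) := by
    refine Finset.prod_le_prod (fun _ _ => norm_nonneg _) (fun j _ => ?_)
    rw [norm_pow]
    exact pow_le_pow_left₀ (norm_nonneg _) (hz j) _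
  exact mul_le_mul h2 h1 (norm_nonneg _) (Finset.prod_nonneg fun _ _ => by positivity)

/-- polynomials of degree less than `N` in each variable, as elements of `H2 d` -/
def polyMap (d N : ℕ) : ((Fin d → Fin N) → ℂ) →ₗ[ℂ] H2 d :=
  Fintype.linearCombination ℂ
    (fun α : Fin d → Fin N => (lp.single 2 (fun j => (α j : ℕ)) (1 : ℂ) : H2 d))

lemma polyMap_norm (d N : ℕ) (c : (Fin d → Fin N) → ℂ) (m : ℝ) (hm : ∀ α, ‖c α‖ ≤ m) :
    ‖polyMap d N c‖ ≤ (N : ℝ) ^ d * m := by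
  rw [polyMap, Fintype.linearCombination_apply]
  refine (norm_sum_le _ _).trans ?_
  refine (Finset.sum_le_sum (g := fun _ => m) fun α _ => ?_).trans ?_
  · rw [norm_smul, lp.norm_single (by simp)]
    simpa using hm α
  · simp

lemma polyMap_eval (d N : ℕ) (c : (Fin d → Fin N) → ℂ) (w : Fin d → ℂ) :
    ∑' β : Fin d → ℕ, (polyMap d N c) β * ∏ j, (w j) ^ (β j)
      = ∑ α, c α * ∏ j, w j ^ (α j : ℕ) := by
  have : ∀ β : Fin d → ℕ, (polyMap d N c) β * ∏ j, (w j) ^ (β j)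
      = ∑ α : Fin d → Fin N, c α * (lp.single 2 (fun j => (α j : ℕ)) (1 : ℂ) : H2 d) β
          * ∏ j, (w j) ^ (β j) := by
    intro β
    rw [polyMap, Fintype.linearCombination_apply, ← Finset.sum_mul]
    congr 1
    rw [lp.coeFn_sum, Finset.sum_apply]
    rfl
  simp_rw [this]
  refine (hasSum_sum fun α _ => ?_).tsum_eq
  convert hasSum_single (fun j => (α j : ℕ)) ?_ using 1
  · simp
  · intro β hβ
    rw [lp.single_apply_ne _ _ _ hβ]
    simp

lemma aux_num (d n N : ℕ) (hd : 1 ≤ d) (hn : 1 ≤ n) (r : ℝ) (hr : 0 < r) (hr1 : r ≤ 1)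
    (hN : N = ⌈(n : ℝ) ^ ((1 : ℝ) / d)⌉₊) :
    n ≤ N ^ d ∧ (N : ℝ) ^ d * (N * (2 / r) ^ N) ^ d
      ≤ Real.exp (2 * d * (2 + Real.log (2 / r)) * (n : ℝ) ^ ((1 : ℝ) / d)) := by
  set x := (n : ℝ) ^ ((1 : ℝ) / d) with hx
  have hx1 : 1 ≤ x := Real.one_le_rpow (by exact_mod_cast hn) (by positivity)
  have hxd : x ^ d = n := by
    rw [hx, one_div, Real.rpow_inv_natCast_pow (by positivity) (by omega)]
  have hNx : x ≤ N := by rw [hN]; exact Nat.le_ceil x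
  have hN2 : (N : ℝ) ≤ 2 * x := by
    have := Nat.ceil_lt_add_one (show 0 ≤ x by linarith)
    rw [← hN] at this
    linarith
  constructor
  · have : (n : ℝ) ≤ (N : ℝ) ^ d := by
      rw [← hxd]
      gcongr
    exact_mod_cast this
  · have h2r : 1 ≤ 2 / r := by rw [le_div_iff₀ hr]; linarith
    have hl : 0 ≤ Real.log (2 / r) := Real.log_nonneg h2r
    have hNe : (N : ℝ) ≤ Real.exp N := by linarith [Real.add_one_le_exp (N : ℝ)]
    have hpow : (2 / r) ^ N = Real.exp (N * Real.log (2 / r)) := by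
      rw [Real.exp_nat_mul, Real.exp_log (by positivity)]
    calc (N : ℝ) ^ d * (N * (2 / r) ^ N) ^ d
        = (N * (N * (2 / r) ^ N)) ^ d := (mul_pow _ _ _).symm
      _ ≤ (Real.exp N * (Real.exp N * Real.exp (N * Real.log (2 / r)))) ^ d := by
        rw [hpow]
        gcongr
      _ = Real.exp (d * ((2 + Real.log (2 / r)) * N)) := by
        rw [← Real.exp_add, ← Real.exp_add, ← Real.exp_nat_mul]
        congr 1
        ring
      _ ≤ _ := by
        apply Real.exp_le_exp.2
        have : (2 + Real.log (2 / r)) * N ≤ (2 + Real.log (2 / r)) * (2 * x) := by gcongr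
        calc (d : ℝ) * ((2 + Real.log (2 / r)) * N) ≤ d * ((2 + Real.log (2 / r)) * (2 * x)) := by
              gcongr
          _ = _ := by ring

/-- Lower bound for approximation numbers of compact composition operators induced by a
truly `d`-dimensional holomorphic self-map of the polydisk:
`a_n(C_φ) ≥ c · exp(−C n^{1/d})`. -/
theorem lower_bound_approx_numbers_polydisk
    (d : ℕ) (hd : 1 ≤ d) (φ : (Fin d → ℂ) → (Fin d → ℂ))
    (hmaps : Set.MapsTo φ (polydisk d) (polydisk d))
    (hdiff : DifferentiableOn ℂ φ (polydisk d))
    (htruly : ∃ a ∈ polydisk d, ∃ f' : (Fin d → ℂ) →L[ℂ] (Fin d → ℂ),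
        HasFDerivAt φ f' a ∧ Function.Bijective f')
    (T : H2 d →L[ℂ] H2 d) (hT : IsCompositionOperator φ T)
    (hcompact : IsCompactOperator (⇑T)) :
    ∃ c C : ℝ, 0 < c ∧ c ≤ C ∧ ∀ n : ℕ, 1 ≤ n →
      c * Real.exp (-C * (n : ℝ) ^ ((1 : ℝ) / d)) ≤ approxNumber T n := by
  classical
  obtain ⟨a, ha, f', hf', hbij⟩ := htruly
  have hball : ∀ z : Fin d → ℂ, z ∈ polydisk d ↔ ‖z‖ < 1 := by
    intro z
    rw [pi_norm_lt_iff one_pos]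
    rfl
  have hopen : IsOpen (polydisk d) := by
    have : polydisk d = Metric.ball 0 1 := by ext z; simp [hball]
    rw [this]
    exact Metric.isOpen_ball
  have ha1 : ‖a‖ < 1 := (hball a).1 ha
  -- local surjectivity
  have hevd : ∀ᶠ y in nhds a, DifferentiableAt ℂ φ y := by
    filter_upwards [hopen.mem_nhds ha] with y hy
    exact hdiff.differentiableAt (hopen.mem_nhds hy)
  have hstrict : HasStrictFDerivAt φ f' a := by
    have := hasStrictFDerivAt_of_hasFDerivAt_of_continuousAt
      (hevd.mono fun y hy => hy.hasFDerivAt) (aux_cont φ a hevd)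
    rwa [hf'.fderiv] at this
  have hmap : Filter.map φ (nhds a) = nhds (φ a) :=
    hstrict.map_nhds_eq_of_surj (LinearMap.range_eq_top.2 hbij.2)
  set s : ℝ := (1 + ‖a‖) / 2 with hs
  have hs0 : 0 ≤ s := by positivity
  have hs1 : s < 1 := by linarith
  have himg : φ '' (Metric.ball a ((1 - ‖a‖) / 2)) ∈ nhds (φ a) := by
    rw [← hmap]
    exact Filter.image_mem_map (Metric.ball_mem_nhds a (by linarith))
  obtain ⟨r0, hr0, hr0sub⟩ := Metric.nhds_basis_closedBall.mem_iff.1 himg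
  set r := min r0 1 with hrdef
  have hr : 0 < r := lt_min hr0 one_pos
  have hr1 : r ≤ 1 := min_le_right _ _
  set K : ℝ := ∑' α : Fin d → ℕ, ∏ j, s ^ (α j) with hK
  have hK1 : 1 ≤ K := by
    have := (aux_summable s hs0 hs1 d).le_tsum 0 (fun α _ => Finset.prod_nonneg fun _ _ => by positivity)
    simpa using this
  have hK0 : 0 < K := by linarith
  have hsup : ∀ (N : ℕ) (c : (Fin d → Fin N) → ℂ) (α),
      ‖c α‖ ≤ (N * (2 / r) ^ N) ^ d * (K * ‖T (polyMap d N c)‖) := by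
    intro N c
    refine aux_multi N r hr hr1 d (φ a) (fun j => (hmaps ha j).le) _ c ?_
    intro w hw
    have hw' : w ∈ Metric.closedBall (φ a) r0 := by
      rw [mem_closedBall_iff_norm]
      refine le_trans ?_ (min_le_left r0 1)
      rw [pi_norm_le_iff_of_nonneg hr.le]
      exact hw
    obtain ⟨z, hz, rfl⟩ := hr0sub hw'
    have hzs : ‖z‖ ≤ s := by
      rw [mem_ball_iff_norm] at hz
      have := norm_le_norm_add_norm_sub' z a
      linarith
    have hzp : z ∈ polydisk d := (hball z).2 (hzs.trans_lt hs1)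
    rw [← polyMap_eval, (hT (polyMap d N c) z hzp).2.2]
    exact aux_eval s hs0 hs1 d _ z (fun j => (norm_le_pi_norm z j).trans hzs)
  set C1 : ℝ := 2 * d * (2 + Real.log (2 / r)) with hC1
  refine ⟨1 / K, max C1 (1 / K), by positivity, le_max_right _ _, fun n hn => ?_⟩
  refine le_csInf ⟨‖T - 0‖, 0, ?_, rfl⟩ ?_
  · have : LinearMap.rank ((0 : H2 d →L[ℂ] H2 d) : H2 d →ₗ[ℂ] H2 d) = 0 := by
      simp
    rw [this]
    exact_mod_cast hn
  rintro _ ⟨R, hR, rfl⟩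
  obtain ⟨N, hN⟩ : ∃ N, N = ⌈(n : ℝ) ^ ((1 : ℝ) / d)⌉₊ := ⟨_, rfl⟩
  obtain ⟨hnN, hQ⟩ := aux_num d n N hd hn r hr hr1 hN
  set x := (n : ℝ) ^ ((1 : ℝ) / d) with hx
  have hx0 : 0 ≤ x := by positivity
  -- a nonzero element of the kernel
  obtain ⟨c, hc0, hRc⟩ : ∃ c : (Fin d → Fin N) → ℂ, c ≠ 0 ∧ R (polyMap d N c) = 0 := by
    by_contra hcon
    push Not at hcon
    have hinj : Function.Injective ((R : H2 d →ₗ[ℂ] H2 d).comp (polyMap d N)) := by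
      rw [injective_iff_map_eq_zero]
      intro c hc
      by_contra h0
      exact hcon c h0 hc
    have h1 := LinearMap.rank_comp_le_left (polyMap d N) (R : H2 d →ₗ[ℂ] H2 d)
    have h2 : LinearMap.rank ((R : H2 d →ₗ[ℂ] H2 d).comp (polyMap d N)) = ((N ^ d : ℕ) : Cardinal) := by
      rw [LinearMap.rank, rank_range_of_injective _ hinj]
      simp
    rw [h2] at h1
    have h3 := h1.trans_lt hR
    have h4 : N ^ d < n := by exact_mod_cast h3
    omega
  have hcn : 0 < ‖c‖ := norm_pos_iff.2 hc0
  set B : ℝ := (N * (2 / r) ^ N) ^ d with hB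
  have hB0 : 0 ≤ B := by positivity
  have h1 : ‖T (polyMap d N c)‖ ≤ ‖T - R‖ * ((N : ℝ) ^ d * ‖c‖) := by
    have : T (polyMap d N c) = (T - R) (polyMap d N c) := by
      rw [_root_.sub_apply, hRc, sub_zero]
    rw [this]
    refine (ContinuousLinearMap.le_opNorm _ _).trans ?_
    gcongr
    exact polyMap_norm d N c _ (fun α => norm_le_pi_norm c α)
  have h2 : ‖c‖ ≤ B * (K * ‖T (polyMap d N c)‖) :=
    (pi_norm_le_iff_of_nonneg (by positivity)).2 (hsup N c)
  have h3 : 1 * ‖c‖ ≤ ((N : ℝ) ^ d * B) * (K * ‖T - R‖) * ‖c‖ := by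
    calc 1 * ‖c‖ ≤ B * (K * (‖T - R‖ * ((N : ℝ) ^ d * ‖c‖))) := by
          rw [one_mul]; refine h2.trans ?_; gcongr
      _ = _ := by ring
  have h4 := le_of_mul_le_mul_right h3 hcn
  have h5 : 1 ≤ Real.exp (C1 * x) * (K * ‖T - R‖) := h4.trans (by gcongr)
  have h6 : Real.exp (-(max C1 (1 / K)) * x) ≤ Real.exp (-(C1 * x)) := by
    apply Real.exp_le_exp.2
    nlinarith [le_max_left C1 (1 / K)]
  calc 1 / K * Real.exp (-(max C1 (1 / K)) * x) ≤ 1 / K * Real.exp (-(C1 * x)) := by gcongr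
    _ ≤ 1 / K * (K * ‖T - R‖) := by
      gcongr
      rw [Real.exp_neg, inv_le_iff_one_le_mul₀' (Real.exp_pos _)]
      exact h5
    _ = ‖T - R‖ := by field_simp
end
end

section
/- Let d ≥ 1, let 0 < θ < 1, let φ_θ : 𝔻^d → 𝔻^d be the multi-lens map of parameter θ, and suppose T is a bounded linear operator on ℓ²(ℕ^d) which is the composition operator C_{φ_θ}. Then there exist constants a, b > 0, depending only on θ and d, such that a_n(T) ≤ a · exp(−b · n^{1/(2d+1)}) for all n ≥ 1. -/
open scoped ENNReal

noncomputable section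

/-- The lens map of parameter `θ`, with principal-branch complex powers. -/
def lensMap (θ : ℝ) (z : ℂ) : ℂ :=
  ((1 + z) ^ (θ : ℂ) - (1 - z) ^ (θ : ℂ)) / ((1 + z) ^ (θ : ℂ) + (1 - z) ^ (θ : ℂ))

/-- The multi-lens map of parameter `θ` on the polydisk `𝔻^d`. -/
def multiLens (d : ℕ) (θ : ℝ) : (Fin d → ℂ) → (Fin d → ℂ) :=
  fun z j => lensMap θ (z j)


open Complex in
/-- Taylor coefficients at `0`. -/
def cf (f : ℂ → ℂ) (m : ℕ) : ℂ := ((m.factorial : ℕ) : ℂ)⁻¹ * iteratedDeriv m f 0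

lemma cf_hasSum {f : ℂ → ℂ} (hf : DifferentiableOn ℂ f (Metric.ball 0 1)) {z : ℂ}
    (hz : ‖z‖ < 1) : HasSum (fun m => cf f m * z ^ m) (f z) := by
  have := Complex.hasSum_taylorSeries_on_ball (c := 0) (r := 1) (f := f) (by simpa using hf)
    (z := z) (by simpa using hz)
  convert! this using 2 with m
  simp only [cf, sub_zero, smul_eq_mul]
  ring

lemma uniq1 {c : ℕ → ℂ} (h : ∀ z : ℂ, ‖z‖ < 1 → HasSum (fun m => c m * z ^ m) 0) : c = 0 := by
  have h2 : HasFPowerSeriesOnBall (fun _ : ℂ => (0:ℂ)) (FormalMultilinearSeries.ofScalars ℂ c) 0 1 := by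
    refine ⟨?_, by simp, ?_⟩
    · refine le_of_forall_lt_imp_le_of_dense fun r hr => ?_
      lift r to NNReal using ne_top_of_lt hr
      have hr1 : (r:ℝ) < 1 := by exact_mod_cast hr
      have := (h (r:ℂ) (by simpa using hr1)).summable.norm
      apply FormalMultilinearSeries.le_radius_of_summable_norm
      convert this using 2 with m
      simp
    · intro y hy
      have hy' : ‖y‖ < 1 := by
        rw [Metric.mem_eball, edist_zero_right] at hy
        have : ENNReal.ofReal ‖y‖ < ENNReal.ofReal 1 := by simpa using hy
        exact (ENNReal.ofReal_lt_ofReal_iff one_pos).mp this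
      convert! h y hy' using 2 with m
      simp [FormalMultilinearSeries.ofScalars]
  have h3 := h2.hasFPowerSeriesAt.eq_zero
  funext m
  have h4 : FormalMultilinearSeries.coeff (FormalMultilinearSeries.ofScalars ℂ c) m = 0 := by
    rw [h3]; rfl
  simpa using h4

lemma uniq1' {c c' : ℕ → ℂ} {f : ℂ → ℂ} (h : ∀ z : ℂ, ‖z‖ < 1 → HasSum (fun m => c m * z ^ m) (f z))
    (h' : ∀ z : ℂ, ‖z‖ < 1 → HasSum (fun m => c' m * z ^ m) (f z)) : c = c' := by
  have := uniq1 (c := fun m => c m - c' m) (fun z hz => by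
    have := (h z hz).sub (h' z hz)
    simpa [sub_mul] using this)
  funext m
  exact sub_eq_zero.mp (congrFun this m)

lemma cf_fourier {f : ℂ → ℂ} (hf : DifferentiableOn ℂ f (Metric.ball 0 1)) {r : ℝ} (hr0 : 0 < r)
    (hr1 : r < 1) (m : ℕ) :
    fourierCoeffOn (Real.two_pi_pos) (fun t : ℝ => f (circleMap 0 r t)) m = cf f m * (r:ℂ) ^ m := by
  have hc : DifferentiableOn ℂ f (Metric.closedBall 0 r) :=
    hf.mono (Metric.closedBall_subset_ball hr1)
  have h1 := DifferentiableOn.circleIntegral_one_div_sub_center_pow_smul hr0 m hc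
  rw [fourierCoeffOn_eq_integral]
  have hr0' : (r:ℂ) ≠ 0 := by exact_mod_cast hr0.ne'
  have h2 : ∀ t : ℝ, deriv (circleMap 0 r) t • ((1 / (circleMap 0 r t - 0) ^ (m+1)) • f (circleMap 0 r t))
     = (Complex.I / (r:ℂ)^m) * (fourier (-(m:ℤ)) (t : AddCircle (2*Real.pi - 0)) • f (circleMap 0 r t)) := by
    intro t
    rw [fourier_coe_apply, deriv_circleMap]
    have e : Complex.exp (2 * Real.pi * Complex.I * ((-(m:ℤ) : ℤ):ℂ) * t / ((2 * Real.pi - 0 : ℝ):ℂ))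
       = (Complex.exp (t * Complex.I) ^ m)⁻¹ := by
      rw [← Complex.exp_nat_mul, ← Complex.exp_neg]
      congr 1
      have : (Real.pi:ℂ) ≠ 0 := by exact_mod_cast Real.pi_ne_zero
      push_cast
      field_simp
      ring
    rw [e]
    simp only [circleMap, zero_add, sub_zero, smul_eq_mul]
    have := Complex.exp_ne_zero (t * Complex.I)
    field_simp
    ring
  rw [circleIntegral] at h1
  simp_rw [h2] at h1
  rw [intervalIntegral.integral_const_mul] at h1
  have hI := Complex.I_ne_zero
  have hpi : (Real.pi:ℂ) ≠ 0 := by exact_mod_cast Real.pi_ne_zero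
  have h3 : (∫ t in (0:ℝ)..(2*Real.pi), fourier (-(m:ℤ)) (t : AddCircle (2*Real.pi - 0)) • f (circleMap 0 r t))
     = 2 * Real.pi * (r:ℂ)^m * cf f m := by
    have : (∫ t in (0:ℝ)..(2*Real.pi), fourier (-(m:ℤ)) (t : AddCircle (2*Real.pi - 0)) • f (circleMap 0 r t))
      = ((r:ℂ)^m / Complex.I) * ((Complex.I / (r:ℂ)^m) * (∫ t in (0:ℝ)..(2*Real.pi), fourier (-(m:ℤ)) (t : AddCircle (2*Real.pi - 0)) • f (circleMap 0 r t))) := by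
      field_simp
    rw [this, h1, cf]
    simp only [smul_eq_mul]
    field_simp
  rw [h3]
  simp only [sub_zero, Complex.real_smul]
  push_cast
  field_simp

lemma circ_mem {r : ℝ} (hr0 : 0 < r) (hr1 : r < 1) (t : ℝ) : ‖circleMap 0 r t‖ < 1 := by
  simp [abs_of_pos hr0, hr1]

lemma circ_cont {f : ℂ → ℂ} (hf : DifferentiableOn ℂ f (Metric.ball 0 1)) {r : ℝ} (hr0 : 0 < r)
    (hr1 : r < 1) : Continuous (fun t : ℝ => f (circleMap 0 r t)) :=
  hf.continuousOn.comp_continuous (continuous_circleMap 0 r)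
    (fun t => by simpa using circ_mem hr0 hr1 t)

lemma bessel {f : ℂ → ℂ} (hf : DifferentiableOn ℂ f (Metric.ball 0 1)) {r : ℝ} (hr0 : 0 < r)
    (hr1 : r < 1) (M : ℕ) :
    ∑ m ∈ Finset.range M, ‖cf f m‖ ^ 2 * r ^ (2 * m) ≤
      (2 * Real.pi)⁻¹ * ∫ t in (0:ℝ)..(2 * Real.pi), ‖f (circleMap 0 r t)‖ ^ 2 := by
  have hc := circ_cont hf hr0 hr1
  have hL : MeasureTheory.MemLp (fun t : ℝ => f (circleMap 0 r t)) 2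
      (MeasureTheory.volume.restrict (Set.Ioc 0 (2 * Real.pi))) := by
    obtain ⟨C, hC⟩ := (isCompact_Icc (a := (0:ℝ)) (b := 2 * Real.pi)).exists_bound_of_continuousOn
      hc.continuousOn
    refine MeasureTheory.MemLp.of_bound hc.aestronglyMeasurable C ?_
    filter_upwards [MeasureTheory.ae_restrict_mem measurableSet_Ioc] with t ht
    exact hC t ⟨ht.1.le, ht.2⟩
  have h := hasSum_sq_fourierCoeffOn Real.two_pi_pos hL
  have h2 := sum_le_hasSum ((Finset.range M).map ⟨fun n : ℕ => (n:ℤ), Nat.cast_injective⟩)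
    (fun i _ => by positivity) h
  rw [Finset.sum_map] at h2
  simp only [Function.Embedding.coeFn_mk, sub_zero, smul_eq_mul] at h2
  refine le_trans (le_of_eq ?_) h2
  refine Finset.sum_congr rfl fun m _ => ?_
  rw [cf_fourier hf hr0 hr1]
  rw [norm_mul, norm_pow, mul_pow, ← pow_mul, mul_comm m 2]
  simp [abs_of_pos hr0]

/-- Multiplication by the Blaschke factor `(u - a)/(1 - a u)` on coefficient sequences. -/
def gB (a : ℝ) (x : ℕ → ℂ) : ℕ → ℂ
  | 0 => -a * x 0
  | k + 1 => a * gB a x k + x k - a * x (k + 1)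

lemma gB_smul_sub (a : ℝ) (c c' : ℂ) (x y : ℕ → ℂ) (k : ℕ) :
    gB a (fun k => c * x k - c' * y k) k = c * gB a x k - c' * gB a y k := by
  induction k with
  | zero => simp only [gB]; ring
  | succ k ih => simp only [gB, ih]; ring

lemma gB_energy (a : ℝ) (x : ℕ → ℂ) (n : ℕ) :
    (1 - a ^ 2) * ∑ k ∈ Finset.range (n + 1), (‖x k‖ ^ 2 - ‖gB a x k‖ ^ 2) = ‖x n + a * gB a x n‖ ^ 2 := by
  have key : ∀ p q : ℂ, (1 - a ^ 2) * (‖p‖ ^ 2 - ‖q‖ ^ 2) = ‖p + a * q‖ ^ 2 - ‖q + a * p‖ ^ 2 := by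
    intro p q
    simp only [← Complex.normSq_eq_norm_sq, Complex.normSq_apply]
    simp
    ring
  induction n with
  | zero =>
    rw [zero_add, Finset.sum_range_one, key]
    simp [gB]
  | succ n ih =>
    rw [Finset.sum_range_succ, mul_add, ih, key]
    have : gB a x (n+1) + a * x (n+1) = x n + a * gB a x n := by simp only [gB]; ring
    rw [this]; ring

lemma gB_contr {a : ℝ} (ha : |a| < 1) (x : ℕ → ℂ) (n : ℕ) :
    ∑ k ∈ Finset.range n, ‖gB a x k‖ ^ 2 ≤ ∑ k ∈ Finset.range n, ‖x k‖ ^ 2 := by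
  cases n with
  | zero => simp
  | succ n =>
    have h := gB_energy a x n
    have h1 : 0 < 1 - a ^ 2 := by
      have := (sq_lt_one_iff_abs_lt_one a).2 ha
      linarith
    have h2 : 0 ≤ ∑ k ∈ Finset.range (n + 1), (‖x k‖ ^ 2 - ‖gB a x k‖ ^ 2) := by
      refine nonneg_of_mul_nonneg_right ?_ h1
      rw [h]; positivity
    rw [Finset.sum_sub_distrib] at h2
    linarith

/-- Blaschke factor. -/
def bl (a : ℝ) (w : ℂ) : ℂ := (w - a) / (1 - a * w)

lemma den_ne {a : ℝ} (ha : |a| < 1) {w : ℂ} (hw : ‖w‖ < 1) : (1 : ℂ) - a * w ≠ 0 := by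
  intro h
  have h1 : (a:ℂ) * w = 1 := (sub_eq_zero.mp h).symm
  have h2 : ‖(a:ℂ) * w‖ = 1 := by rw [h1]; simp
  rw [norm_mul, Complex.norm_real, Real.norm_eq_abs] at h2
  nlinarith [abs_nonneg a, norm_nonneg w]

lemma gB_geom {a : ℝ} (ha : |a| < 1) {w : ℂ} (hw : ‖w‖ < 1) (k : ℕ) :
    1 * w ^ k - bl a w * gB a (fun k => w ^ k) k = ((1 - a ^ 2) / (1 - a * w)) * (a:ℂ) ^ k := by
  have hd := den_ne ha hw
  have hd' : 1 - w * a ≠ 0 := by rwa [mul_comm]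
  induction k with
  | zero => 
    simp only [gB, bl]
    field_simp
    ring
  | succ k ih =>
    have : bl a w * gB a (fun k => w ^ k) (k + 1) = a * (bl a w * gB a (fun k => w ^ k) k) + bl a w * (w ^ k - a * w ^ (k+1)) := by
      simp only [gB]; ring
    rw [this]
    have h2 : bl a w * gB a (fun k => w ^ k) k = w ^ k - ((1 - a ^ 2) / (1 - a * w)) * (a:ℂ) ^ k := by
      rw [← ih]; ring
    rw [h2, bl]
    field_simp
    ring

/-- Iterated Blaschke multiplications. -/
def gL : List ℝ → (ℕ → ℂ) → ℕ → ℂ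
  | [], x => x
  | a :: L, x => gL L (gB a x)

/-- Blaschke product. -/
def bL : List ℝ → ℂ → ℂ
  | [], _ => 1
  | a :: L, w => bl a w * bL L w

lemma gL_smul_sub (L : List ℝ) (c c' : ℂ) (x y : ℕ → ℂ) (k : ℕ) :
    gL L (fun k => c * x k - c' * y k) k = c * gL L x k - c' * gL L y k := by
  induction L generalizing x y with
  | nil => rfl
  | cons a L ih =>
    simp only [gL]
    rw [← ih]
    congr 1
    funext k
    exact gB_smul_sub ..

lemma gL_contr {L : List ℝ} (hL : ∀ a ∈ L, |a| < 1) (x : ℕ → ℂ) (n : ℕ) :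
    ∑ k ∈ Finset.range n, ‖gL L x k‖ ^ 2 ≤ ∑ k ∈ Finset.range n, ‖x k‖ ^ 2 := by
  induction L generalizing x with
  | nil => exact le_rfl
  | cons a L ih =>
    exact (ih (fun b hb => hL b (by simp [hb])) _).trans (gB_contr (hL a (by simp)) x n)

/-- error kernel coefficient -/
def eK (L : List ℝ) (p : ℕ) (w : ℂ) : ℂ := bL L w * gL L (fun k => w ^ k) p

lemma eK_sum {L : List ℝ} (hL : ∀ a ∈ L, |a| < 1) {w : ℂ} (hw : ‖w‖ < 1) (n : ℕ) :
    ∑ p ∈ Finset.range n, ‖eK L p w‖ ^ 2 ≤ ‖bL L w‖ ^ 2 * (1 - ‖w‖ ^ 2)⁻¹ := by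
  simp only [eK, norm_mul, mul_pow, ← Finset.mul_sum]
  gcongr
  refine (gL_contr hL _ n).trans ?_
  simp only [norm_pow, ← pow_mul, mul_comm _ 2]
  simp only [pow_mul]
  have h1 : ‖w‖ ^ 2 < 1 := by
    have := norm_nonneg w
    nlinarith
  exact sum_le_hasSum _ (fun _ _ => by positivity) (hasSum_geometric_of_lt_one (by positivity) h1)

lemma bl_diff {a : ℝ} (ha : |a| < 1) : DifferentiableOn ℂ (bl a) (Metric.ball 0 1) := by
  unfold bl
  refine DifferentiableOn.div (by fun_prop) (by fun_prop) fun w hw => den_ne ha (by simpa using hw)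

lemma bL_diff {L : List ℝ} (hL : ∀ a ∈ L, |a| < 1) :
    DifferentiableOn ℂ (bL L) (Metric.ball 0 1) := by
  induction L with
  | nil => exact differentiableOn_const _
  | cons a L ih =>
    exact (bl_diff (hL a (by simp))).mul (ih fun b hb => hL b (by simp [hb]))

lemma bl_le {a : ℝ} (ha : |a| < 1) {w : ℂ} (hw : ‖w‖ < 1) : ‖bl a w‖ ≤ 1 := by
  have hd := den_ne ha hw
  rw [bl, norm_div, div_le_one (norm_pos_iff.2 hd)]
  have h1 : 0 ≤ 1 - a ^ 2 := by
    have := (sq_lt_one_iff_abs_lt_one a).2 ha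
    linarith
  have h2 : 0 ≤ 1 - ‖w‖ ^ 2 := by nlinarith [norm_nonneg w]
  have h3 : ‖w - a‖ ^ 2 = ‖1 - a * w‖ ^ 2 - (1 - a ^ 2) * (1 - ‖w‖ ^ 2) := by
    simp only [← Complex.normSq_eq_norm_sq, Complex.normSq_apply]
    simp
    ring
  have h4 := mul_nonneg h1 h2
  exact (sq_le_sq₀ (norm_nonneg _) (norm_nonneg _)).1 (by linarith)

lemma bL_le {L : List ℝ} (hL : ∀ a ∈ L, |a| < 1) {w : ℂ} (hw : ‖w‖ < 1) : ‖bL L w‖ ≤ 1 := by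
  induction L with
  | nil => simp [bL]
  | cons a L ih =>
    rw [bL, norm_mul]
    exact mul_le_one₀ (bl_le (hL a (by simp)) hw) (norm_nonneg _) (ih fun b hb => hL b (by simp [hb]))

/-- finite rank structure of `w^p - eK L p w`. -/
lemma finite_rank {L : List ℝ} (hL : ∀ a ∈ L, |a| < 1) :
    ∃ g : Fin L.length → ℂ → ℂ, ∃ h : Fin L.length → ℕ → ℂ,
      (∀ i, DifferentiableOn ℂ (g i) (Metric.ball 0 1)) ∧
      (∀ i, ∃ C : ℝ, ∀ w, ‖w‖ < 1 → ‖g i w‖ ≤ C) ∧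
      (∀ i, ∃ C : ℝ, ∀ n, ∑ p ∈ Finset.range n, ‖h i p‖ ^ 2 ≤ C) ∧
      ∀ w, ‖w‖ < 1 → ∀ p, w ^ p - eK L p w = ∑ i, g i w * h i p := by
  induction L with
  | nil => 
    refine ⟨fun _ _ => 0, fun _ _ => 0, by simp, fun i => ⟨0, by simp⟩, fun i => ⟨0, by simp⟩, ?_⟩
    intro w hw p
    simp [eK, bL, gL]
  | cons a L ih =>
    have ha := hL a (by simp)
    have hL' : ∀ b ∈ L, |b| < 1 := fun b hb => hL b (by simp [hb])
    obtain ⟨g, h, hg, hgb, hh, e⟩ := ih hL'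
    refine ⟨Fin.cons (fun w => bL L w * ((1 - a ^ 2) / (1 - a * w))) g,
      Fin.cons (gL L (fun k => (a:ℂ)^k)) h, ?_, ?_, ?_, ?_⟩
    · intro i
      refine Fin.cases ?_ (fun i => ?_) i
      · refine (bL_diff hL').mul ?_
        refine DifferentiableOn.div (by fun_prop) (by fun_prop) 
          fun w hw => den_ne ha (by simpa using hw)
      · simpa using hg i
    · intro i
      refine Fin.cases ?_ (fun i => ?_) i
      · refine ⟨‖(1 - a ^ 2 : ℂ)‖ / (1 - |a|), fun w hw => ?_⟩
        have hb' := bL_le hL' hw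
        have hd : 1 - |a| ≤ ‖(1:ℂ) - a * w‖ := by
          have := norm_sub_norm_le (1:ℂ) (a * w)
          rw [norm_mul, Complex.norm_real, Real.norm_eq_abs, norm_one] at this
          nlinarith [abs_nonneg a]
        simp only [Fin.cons_zero, norm_mul, norm_div]
        calc _ ≤ 1 * (‖(1 - a ^ 2 : ℂ)‖ / (1 - |a|)) := by
              have : 0 < 1 - |a| := by linarith
              gcongr
          _ = _ := one_mul _
      · simpa using hgb i
    · intro i
      refine Fin.cases ?_ (fun i => ?_) i
      · refine ⟨(1 - |a| ^ 2)⁻¹, fun n => ?_⟩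
        refine (gL_contr hL' _ n).trans ?_
        simp only [norm_pow, ← pow_mul, mul_comm _ 2, Complex.norm_real, Real.norm_eq_abs]
        simp only [pow_mul]
        have h1 : |a| ^ 2 < 1 := by
          have := abs_nonneg a
          nlinarith
        exact sum_le_hasSum _ (fun _ _ => by positivity) (hasSum_geometric_of_lt_one (by positivity) h1)
      · simpa using hh i
    · intro w hw p
      refine Eq.trans ?_ (Fin.sum_univ_succ (n := L.length) _).symm
      simp only [Fin.cons_zero, Fin.cons_succ]
      rw [← e w hw p]
      have h1 := gL_smul_sub L 1 (bl a w) (fun k => w ^ k) (gB a fun k => w ^ k) p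
      have h2 : (fun k => 1 * w ^ k - bl a w * gB a (fun k => w ^ k) k) = 
         fun k => ((1 - a ^ 2) / (1 - a * w)) * (a:ℂ) ^ k - 0 * 0 := by
        funext k; rw [gB_geom ha hw]; ring
      rw [h2, gL_smul_sub L _ 0 _ (fun _ => 0)] at h1
      simp only [eK, bL, gL]
      linear_combination (-bL L w) * h1

lemma re_mul_conj_cpow (θ : ℝ) {x y : ℂ} (hx : x ≠ 0) (hy : y ≠ 0) :
    (x ^ (θ:ℂ) * (starRingEnd ℂ) (y ^ (θ:ℂ))).re =
      ‖x ^ (θ:ℂ)‖ * ‖y ^ (θ:ℂ)‖ * Real.cos (θ * (x.arg - y.arg)) := by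
  rw [Complex.cpow_def_of_ne_zero hx, Complex.cpow_def_of_ne_zero hy, ← Complex.exp_conj,
    ← Complex.exp_add, Complex.exp_re, Complex.norm_exp, Complex.norm_exp, ← Real.exp_add]
  simp [Complex.log_im]
  congr 1
  ring

lemma arg_diff {z : ℂ} (hz : ‖z‖ < 1) : |(1 + z).arg - (1 - z).arg| ≤ Real.pi / 2 := by
  have hz2 : z.re * z.re + z.im * z.im < 1 := by
    have : ‖z‖ ^ 2 < 1 := by nlinarith [norm_nonneg z]
    rwa [← Complex.normSq_eq_norm_sq, Complex.normSq_apply] at this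
  have hre : |z.re| < 1 := (Complex.abs_re_le_norm z).trans_lt hz
  rw [abs_lt] at hre
  have h1 : 0 < (1 + z).re := by simp; linarith
  have h2 : 0 < (1 - z).re := by simp; linarith
  have hx : 1 + z ≠ 0 := fun h => by rw [h] at h1; simp at h1
  have hy : 1 - z ≠ 0 := fun h => by rw [h] at h2; simp at h2
  have a1 := Complex.abs_arg_lt_pi_div_two_iff.2 (Or.inl h1)
  have a2 := Complex.abs_arg_lt_pi_div_two_iff.2 (Or.inl h2)
  have h := re_mul_conj_cpow 1 hx hy
  have h' : (((1:ℂ) + z) * (starRingEnd ℂ) (1 - z)).re = 1 - (z.re * z.re + z.im * z.im) := by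
    simp; ring
  simp only [Complex.ofReal_one, Complex.cpow_one, one_mul] at h
  have hc : 0 < Real.cos ((1 + z).arg - (1 - z).arg) := by
    have h3 : 0 < ‖1 + z‖ * ‖1 - z‖ := by positivity
    rw [h'] at h
    by_contra hcon
    push Not at hcon
    nlinarith
  by_contra hcon
  push Not at hcon
  rw [← Real.cos_abs] at hc
  rw [abs_lt] at a1 a2
  have h4 : |(1 + z).arg - (1 - z).arg| ≤ Real.pi + Real.pi / 2 := by
    rw [abs_le]; constructor <;> linarith [Real.pi_pos]
  have := Real.cos_nonpos_of_pi_div_two_le_of_le hcon.le h4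
  linarith

/-- All the facts about `p = (1+z)^θ`, `q = (1-z)^θ`. -/
lemma pq_facts {θ : ℝ} (hθ0 : 0 < θ) (hθ1 : θ < 1) {z : ℂ} (hz : ‖z‖ < 1) :
    0 < ‖(1 + z) ^ (θ:ℂ)‖ ∧ 0 < ‖(1 - z) ^ (θ:ℂ)‖ ∧ ‖(1 + z) ^ (θ:ℂ)‖ ≤ 2 ∧ ‖(1 - z) ^ (θ:ℂ)‖ ≤ 2 ∧
    ‖(1 + z) ^ (θ:ℂ)‖ * ‖(1 - z) ^ (θ:ℂ)‖ = (‖1 + z‖ * ‖1 - z‖) ^ θ ∧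
    Real.cos (θ * (Real.pi / 2)) * (‖(1 + z) ^ (θ:ℂ)‖ * ‖(1 - z) ^ (θ:ℂ)‖) ≤
      ((1 + z) ^ (θ:ℂ) * (starRingEnd ℂ) ((1 - z) ^ (θ:ℂ))).re := by
  have hre : |z.re| < 1 := (Complex.abs_re_le_norm z).trans_lt hz
  rw [abs_lt] at hre
  have h1 : 0 < (1 + z).re := by simp; linarith
  have h2 : 0 < (1 - z).re := by simp; linarith
  have hx : 1 + z ≠ 0 := fun h => by rw [h] at h1; simp at h1
  have hy : 1 - z ≠ 0 := fun h => by rw [h] at h2; simp at h2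
  have nx : ‖(1 + z) ^ (θ:ℂ)‖ = ‖1 + z‖ ^ θ := Complex.norm_cpow_real _ _ 
  have ny : ‖(1 - z) ^ (θ:ℂ)‖ = ‖1 - z‖ ^ θ := Complex.norm_cpow_real _ _ 
  have hx0 : 0 < ‖1 + z‖ := norm_pos_iff.2 hx
  have hy0 : 0 < ‖1 - z‖ := norm_pos_iff.2 hy
  have bx : ‖1 + z‖ ≤ 2 := by
    have := norm_add_le (1:ℂ) z
    rw [norm_one] at this; linarith
  have byy : ‖1 - z‖ ≤ 2 := by
    have := norm_sub_le (1:ℂ) z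
    rw [norm_one] at this; linarith
  have two : (2:ℝ) ^ θ ≤ 2 := by
    calc (2:ℝ) ^ θ ≤ 2 ^ (1:ℝ) := Real.rpow_le_rpow_of_exponent_le (by norm_num) hθ1.le
      _ = 2 := Real.rpow_one 2
  refine ⟨?_, ?_, ?_, ?_, ?_, ?_⟩
  · rw [nx]; positivity
  · rw [ny]; positivity
  · rw [nx]; exact (Real.rpow_le_rpow hx0.le bx hθ0.le).trans two
  · rw [ny]; exact (Real.rpow_le_rpow hy0.le byy hθ0.le).trans two
  · rw [nx, ny, Real.mul_rpow hx0.le hy0.le]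
  · rw [re_mul_conj_cpow θ hx hy, mul_comm]
    gcongr
    rw [← Real.cos_abs (θ * (_ - _))]
    have := arg_diff hz
    refine Real.cos_le_cos_of_nonneg_of_le_pi (abs_nonneg _) ?_ ?_
    · nlinarith [Real.pi_pos]
    · rw [abs_mul, abs_of_pos hθ0]; gcongr

lemma cos_pos' {θ : ℝ} (hθ0 : 0 < θ) (hθ1 : θ < 1) : 0 < Real.cos (θ * (Real.pi / 2)) := by
  apply Real.cos_pos_of_mem_Ioo
  constructor <;> nlinarith [Real.pi_pos]

lemma nsq (p q : ℂ) : ‖p + q‖ ^ 2 = ‖p‖ ^ 2 + ‖q‖ ^ 2 + 2 * (p * (starRingEnd ℂ) q).re ∧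
    ‖p - q‖ ^ 2 = ‖p‖ ^ 2 + ‖q‖ ^ 2 - 2 * (p * (starRingEnd ℂ) q).re := by
  simp only [← Complex.normSq_eq_norm_sq, Complex.normSq_apply]
  constructor <;> simp <;> ring

lemma pq_ne {p q : ℂ} (_hp : 0 < ‖p‖) (h : 0 < (p * (starRingEnd ℂ) q).re) : p + q ≠ 0 := by
  intro h0
  have := (nsq p q).1
  rw [h0, norm_zero] at this
  nlinarith [sq_nonneg ‖q‖, sq_nonneg ‖p‖]

lemma lens_re_pos {θ : ℝ} (hθ0 : 0 < θ) (hθ1 : θ < 1) {z : ℂ} (hz : ‖z‖ < 1) :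
    0 < ((1 + z) ^ (θ:ℂ) * (starRingEnd ℂ) ((1 - z) ^ (θ:ℂ))).re := by
  obtain ⟨h1, h2, -, -, -, h⟩ := pq_facts hθ0 hθ1 hz
  have := cos_pos' hθ0 hθ1
  exact lt_of_lt_of_le (by positivity) h

lemma lens_one_sub {θ : ℝ} (hθ0 : 0 < θ) (hθ1 : θ < 1) {z : ℂ} (hz : ‖z‖ < 1) :
    1 - ‖lensMap θ z‖ ^ 2 = 4 * ((1 + z) ^ (θ:ℂ) * (starRingEnd ℂ) ((1 - z) ^ (θ:ℂ))).re /
      ‖(1 + z) ^ (θ:ℂ) + (1 - z) ^ (θ:ℂ)‖ ^ 2 := by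
  obtain ⟨h1, h2, -, -, -, -⟩ := pq_facts hθ0 hθ1 hz
  have hne := pq_ne h1 (lens_re_pos hθ0 hθ1 hz)
  have := norm_pos_iff.2 hne
  rw [lensMap, norm_div, div_pow, eq_div_iff (by positivity), sub_mul, div_mul_cancel₀ _ (by positivity),
    (nsq _ _).1, (nsq _ _).2]
  ring

lemma lens_lt {θ : ℝ} (hθ0 : 0 < θ) (hθ1 : θ < 1) {z : ℂ} (hz : ‖z‖ < 1) : ‖lensMap θ z‖ < 1 := by
  have h := lens_one_sub hθ0 hθ1 hz
  obtain ⟨h1, h2, -, -, -, -⟩ := pq_facts hθ0 hθ1 hz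
  have hre := lens_re_pos hθ0 hθ1 hz
  have := norm_pos_iff.2 (pq_ne h1 hre)
  have h3 : 0 < 1 - ‖lensMap θ z‖ ^ 2 := by rw [h]; positivity
  nlinarith [norm_nonneg (lensMap θ z)]

lemma lens_inv {θ : ℝ} (hθ0 : 0 < θ) (hθ1 : θ < 1) {z : ℂ} (hz : ‖z‖ < 1) :
    (1 - ‖lensMap θ z‖ ^ 2)⁻¹ ≤
      (Real.cos (θ * (Real.pi / 2)))⁻¹ * (4 / (‖(1 + z) ^ (θ:ℂ)‖ * ‖(1 - z) ^ (θ:ℂ)‖)) := by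
  rw [lens_one_sub hθ0 hθ1 hz]
  obtain ⟨h1, h2, h3, h4, -, h5⟩ := pq_facts hθ0 hθ1 hz
  have hre := lens_re_pos hθ0 hθ1 hz
  have hc := cos_pos' hθ0 hθ1
  set P := ‖(1 + z) ^ (θ:ℂ)‖
  set Q := ‖(1 - z) ^ (θ:ℂ)‖
  set X := ((1 + z) ^ (θ:ℂ) * (starRingEnd ℂ) ((1 - z) ^ (θ:ℂ))).re
  have h6 : ‖(1 + z) ^ (θ:ℂ) + (1 - z) ^ (θ:ℂ)‖ ≤ 4 := (norm_add_le _ _).trans (by linarith)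
  have h7 : ‖(1 + z) ^ (θ:ℂ) + (1 - z) ^ (θ:ℂ)‖ ^ 2 ≤ 16 := by
    nlinarith [norm_nonneg ((1 + z) ^ (θ:ℂ) + (1 - z) ^ (θ:ℂ))]
  rw [inv_div]
  calc _ ≤ 16 / (4 * (Real.cos (θ * (Real.pi / 2)) * (P * Q))) := by gcongr
    _ = _ := by field_simp; ring

lemma lens_diff {θ : ℝ} (hθ0 : 0 < θ) (hθ1 : θ < 1) :
    DifferentiableOn ℂ (lensMap θ) (Metric.ball 0 1) := by
  intro z hz
  have hz' : ‖z‖ < 1 := by simpa using hz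
  have hre : |z.re| < 1 := (Complex.abs_re_le_norm z).trans_lt hz'
  rw [abs_lt] at hre
  have h1 : 0 < (1 + z).re := by simp; linarith
  have h2 : 0 < (1 - z).re := by simp; linarith
  have d1 : DifferentiableAt ℂ (fun z : ℂ => (1 + z) ^ (θ:ℂ)) z :=
    DifferentiableAt.cpow_const (by fun_prop) (Or.inl h1)
  have d2 : DifferentiableAt ℂ (fun z : ℂ => (1 - z) ^ (θ:ℂ)) z :=
    DifferentiableAt.cpow_const (by fun_prop) (Or.inl h2)
  obtain ⟨h1, h2, -, -, -, -⟩ := pq_facts hθ0 hθ1 hz'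
  exact (DifferentiableAt.div (d1.sub d2) (d1.add d2)
    (pq_ne h1 (lens_re_pos hθ0 hθ1 hz'))).differentiableWithinAt

/-- the real zero associated to a parameter `t > 0`. -/
def za (t : ℝ) : ℝ := (1 - t) / (1 + t)

lemma za_lt {t : ℝ} (ht : 0 < t) : |za t| < 1 := by
  rw [za, abs_lt, lt_div_iff₀ (by linarith), div_lt_iff₀ (by linarith)]
  constructor <;> linarith

lemma bl_lens {θ : ℝ} (hθ0 : 0 < θ) (hθ1 : θ < 1) {z : ℂ} (hz : ‖z‖ < 1) {t : ℝ} (ht : 0 < t)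
    (hA : t * ‖(1 + z) ^ (θ:ℂ)‖ ≤ 2 * ‖(1 - z) ^ (θ:ℂ)‖)
    (hB : ‖(1 - z) ^ (θ:ℂ)‖ ≤ 2 * (t * ‖(1 + z) ^ (θ:ℂ)‖)) :
    ‖bl (za t) (lensMap θ z)‖ ^ 2 ≤ 1 - 4/5 * Real.cos (θ * (Real.pi / 2)) := by
  obtain ⟨h1, h2, h3, h4, -, h5⟩ := pq_facts hθ0 hθ1 hz
  have hre := lens_re_pos hθ0 hθ1 hz
  have hc := cos_pos' hθ0 hθ1
  have hc1 := Real.cos_le_one (θ * (Real.pi / 2))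
  have hl : lensMap θ z = ((1 + z) ^ (θ:ℂ) - (1 - z) ^ (θ:ℂ)) / ((1 + z) ^ (θ:ℂ) + (1 - z) ^ (θ:ℂ)) := rfl
  rw [hl]
  set p := (1 + z) ^ (θ:ℂ)
  set q := (1 - z) ^ (θ:ℂ)
  set δ := Real.cos (θ * (Real.pi / 2))
  have e1 : ((t:ℂ) * p * (starRingEnd ℂ) q).re = t * (p * (starRingEnd ℂ) q).re := by
    rw [mul_assoc, Complex.re_ofReal_mul]
  have hpq : p + q ≠ 0 := pq_ne h1 hre
  have htp : (t:ℂ) * p + q ≠ 0 := by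
    refine pq_ne (by rw [norm_mul, Complex.norm_real, Real.norm_eq_abs, abs_of_pos ht]; positivity) ?_
    rw [e1]; positivity
  have ht1 : (1:ℂ) + t ≠ 0 := by
    have : (1:ℝ) + t ≠ 0 := by positivity
    exact_mod_cast this
  have hb : bl (za t) ((p - q) / (p + q)) = (t * p - q) / (t * p + q) := by
    have e2 : (p - q) / (p + q) - ((za t : ℝ):ℂ) = 2 * (t * p - q) / ((p + q) * (1 + t)) := by
      rw [za]; push_cast; field_simp; ring
    have e3 : 1 - ((za t : ℝ):ℂ) * ((p - q) / (p + q)) = 2 * (t * p + q) / ((p + q) * (1 + t)) := by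
      rw [za]; push_cast; field_simp; ring
    rw [bl, e2, e3]
    field_simp
  rw [hb, norm_div, div_pow, div_le_iff₀ (pow_pos (norm_pos_iff.2 htp) 2), (nsq _ _).1, (nsq _ _).2, e1]
  have e4 : ‖(t:ℂ) * p‖ = t * ‖p‖ := by rw [norm_mul, Complex.norm_real, Real.norm_eq_abs, abs_of_pos ht]
  rw [e4]
  set X := (p * (starRingEnd ℂ) q).re
  set P := ‖p‖
  set Q := ‖q‖
  have f1 : 2 * ((t * P) ^ 2 + Q ^ 2) ≤ 5 * (t * P * Q) := by
    nlinarith [mul_nonneg (sub_nonneg.2 hA) (sub_nonneg.2 hB)]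
  have f2 : δ * (t * P * Q) ≤ t * X := by
    calc δ * (t * P * Q) = t * (δ * (P * Q)) := by ring
      _ ≤ t * X := by gcongr
  have f3 : δ * (2 * ((t * P) ^ 2 + Q ^ 2)) ≤ 5 * (t * X) := by
    calc _ ≤ δ * (5 * (t * P * Q)) := by gcongr
      _ ≤ _ := by linarith
  have f4 : δ * (t * X) ≤ t * X := by
    have : 0 ≤ t * X := by positivity
    nlinarith
  nlinarith [mul_pos ht hre]

lemma bL_append (L L' : List ℝ) (w : ℂ) : bL (L ++ L') w = bL L w * bL L' w := by
  induction L with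
  | nil => simp [bL]
  | cons a L ih => simp only [List.cons_append, bL, ih]; ring

lemma bL_rep (L : List ℝ) (m : ℕ) (w : ℂ) : bL (List.replicate m L).flatten w = bL L w ^ m := by
  induction m with
  | zero => simp [bL]
  | succ m ih => rw [List.replicate_succ, List.flatten_cons, bL_append, ih]; ring

lemma bL_le_mem {L : List ℝ} (hL : ∀ a ∈ L, |a| < 1) {w : ℂ} (hw : ‖w‖ < 1) {a : ℝ} (ha : a ∈ L) :
    ‖bL L w‖ ≤ ‖bl a w‖ := by
  induction L with
  | nil => simp at ha
  | cons b L ih =>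
    have hL' : ∀ a ∈ L, |a| < 1 := fun c hc => hL c (by simp [hc])
    rw [bL, norm_mul]
    rcases List.mem_cons.1 ha with rfl | h
    · exact mul_le_of_le_one_right (norm_nonneg _) (bL_le hL' hw)
    · refine (mul_le_of_le_one_left (norm_nonneg _) (bl_le (hL b (by simp)) hw)).trans (ih hL' h)

/-- base list of zeros -/
def zB (m : ℕ) : List ℝ := (List.range (2 * m + 1)).map (fun k => za (2 ^ k / 2 ^ m))

/-- full list of zeros -/
def zL (m : ℕ) : List ℝ := (List.replicate m (zB m)).flatten

lemma zB_lt (m : ℕ) : ∀ a ∈ zB m, |a| < 1 := by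
  intro a ha
  simp only [zB, List.mem_map] at ha
  obtain ⟨k, -, rfl⟩ := ha
  exact za_lt (by positivity)

lemma zL_lt (m : ℕ) : ∀ a ∈ zL m, |a| < 1 := by
  intro a ha
  simp only [zL, List.mem_flatten, List.mem_replicate] at ha
  obtain ⟨l, ⟨-, rfl⟩, h⟩ := ha
  exact zB_lt m a h

lemma zL_length (m : ℕ) : (zL m).length = m * (2 * m + 1) := by
  simp [zL, zB]

lemma bL_zL {θ : ℝ} (hθ0 : 0 < θ) (hθ1 : θ < 1) (m : ℕ) {κ : ℝ}
    (hκ1 : 1 - 4/5 * Real.cos (θ * (Real.pi / 2)) ≤ κ)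
    (hκ2 : (2:ℝ)⁻¹ ^ (1 - θ) ≤ κ) {z : ℂ} (hz : ‖z‖ < 1) :
    ‖bL (zL m) (lensMap θ z)‖ ^ 2 ≤
      κ ^ m * (4 / (‖(1 + z) ^ (θ:ℂ)‖ * ‖(1 - z) ^ (θ:ℂ)‖)) ^ (1 - θ) := by
  obtain ⟨h1, h2, h3, h4, -, h5⟩ := pq_facts hθ0 hθ1 hz
  have hw := lens_lt hθ0 hθ1 hz
  have hc := cos_pos' hθ0 hθ1
  have hc1 := Real.cos_le_one (θ * (Real.pi / 2))
  have hκ0 : 0 < κ := lt_of_lt_of_le (by positivity) hκ2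
  set P := ‖(1 + z) ^ (θ:ℂ)‖ with hP
  set Q := ‖(1 - z) ^ (θ:ℂ)‖ with hQ
  have hPQ : P * Q ≤ 4 := by nlinarith
  have hη : 0 < 1 - θ := by linarith
  by_cases hgood : P ≤ 2 ^ m * Q ∧ Q ≤ 2 ^ m * P
  · obtain ⟨n, hn1, hn2⟩ := exists_nat_pow_near (x := 2 ^ m * Q / P) (y := (2:ℝ))
      (by rw [le_div_iff₀ h1]; linarith [hgood.1]) one_lt_two
    rw [le_div_iff₀ h1] at hn1
    rw [div_lt_iff₀ h1] at hn2
    have hn : n < 2 * m + 1 := by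
      have : (2:ℝ) ^ n ≤ 2 ^ (2 * m) := by
        have : (2:ℝ) ^ n * P ≤ 2 ^ (2 * m) * P := by
          rw [two_mul, pow_add]
          have := mul_le_mul_of_nonneg_left hgood.2 (show (0:ℝ) ≤ 2 ^ m by positivity)
          linarith
        exact le_of_mul_le_mul_right this h1
      have := (pow_le_pow_iff_right₀ (one_lt_two (α := ℝ))).1 this
      omega
    have hmem : za (2 ^ n / 2 ^ m) ∈ zB m := List.mem_map.2 ⟨n, List.mem_range.2 hn, rfl⟩
    have e1 : (2:ℝ) ^ n / 2 ^ m * P ≤ Q := by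
      rw [div_mul_eq_mul_div, div_le_iff₀ (by positivity)]; linarith
    have e2 : Q ≤ 2 * ((2:ℝ) ^ n / 2 ^ m * P) := by
      rw [div_mul_eq_mul_div, ← mul_div_assoc, le_div_iff₀ (by positivity)]
      rw [pow_succ] at hn2; linarith
    have hb := bl_lens hθ0 hθ1 hz (t := 2 ^ n / 2 ^ m) (by positivity) (by linarith) (by linarith)
    have hbB : ‖bL (zB m) (lensMap θ z)‖ ^ 2 ≤ κ := by
      refine le_trans ?_ (hb.trans hκ1)
      gcongr
      exact bL_le_mem (zB_lt m) hw hmem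
    rw [zL, bL_rep, norm_pow, ← pow_mul, mul_comm m 2, pow_mul]
    have : 1 ≤ (4 / (P * Q)) ^ (1 - θ) := by
      apply Real.one_le_rpow _ hη.le
      rw [le_div_iff₀ (by positivity)]; linarith
    calc _ ≤ κ ^ m * 1 := by rw [mul_one]; gcongr
      _ ≤ _ := by gcongr
  · have hb : ‖bL (zL m) (lensMap θ z)‖ ≤ 1 := bL_le (zL_lt m) hw
    have hPQ2 : 2 ^ m * (P * Q) ≤ 4 := by
      rw [not_and_or] at hgood
      rcases hgood with h | h <;> push Not at h
      · nlinarith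
      · nlinarith
    have e : 1 ≤ ((2:ℝ)⁻¹ ^ m * (4 / (P * Q))) ^ (1 - θ) := by
      apply Real.one_le_rpow _ hη.le
      rw [inv_pow, inv_mul_eq_div, le_div_iff₀ (by positivity), le_div_iff₀ (by positivity)]
      linarith
    rw [Real.mul_rpow (by positivity) (by positivity)] at e
    have e3 : ((2:ℝ)⁻¹ ^ m) ^ (1 - θ) ≤ κ ^ m := by
      rw [← Real.rpow_natCast, ← Real.rpow_mul (by positivity), mul_comm, Real.rpow_mul (by positivity),
        Real.rpow_natCast]
      gcongr
    calc _ ≤ (1:ℝ) := by nlinarith [norm_nonneg (bL (zL m) (lensMap θ z))]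
      _ ≤ _ := e
      _ ≤ _ := by gcongr

/-- exponent -/
def sθ (θ : ℝ) : ℝ := θ * (2 - θ)

lemma pointwise_bound {θ : ℝ} (hθ0 : 0 < θ) (hθ1 : θ < 1) (m : ℕ) {κ : ℝ}
    (hκ1 : 1 - 4/5 * Real.cos (θ * (Real.pi / 2)) ≤ κ)
    (hκ2 : (2:ℝ)⁻¹ ^ (1 - θ) ≤ κ) {z : ℂ} (hz : ‖z‖ < 1) (n : ℕ) :
    ∑ p ∈ Finset.range n, ‖eK (zL m) p (lensMap θ z)‖ ^ 2 ≤
      (Real.cos (θ * (Real.pi / 2)))⁻¹ * 4 ^ (2 - θ) * κ ^ m *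
        (‖1 + z‖ ^ (-(sθ θ)) + ‖1 - z‖ ^ (-(sθ θ))) := by
  have hw := lens_lt hθ0 hθ1 hz
  have hc := cos_pos' hθ0 hθ1
  have hκ0 : 0 < κ := lt_of_lt_of_le (by positivity) hκ2
  have b1 := bL_zL hθ0 hθ1 m hκ1 hκ2 hz
  have b2 := lens_inv hθ0 hθ1 hz
  obtain ⟨h1, h2, h3, h4, h6, h5⟩ := pq_facts hθ0 hθ1 hz
  refine (eK_sum (zL_lt m) hw n).trans ?_
  rw [h6] at b1 b2
  have hx0 : 0 ≤ ‖1 + z‖ := norm_nonneg _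
  have hy0 : 0 ≤ ‖1 - z‖ := norm_nonneg _
  have hD : 0 < (‖1 + z‖ * ‖1 - z‖) ^ θ := by rw [← h6]; positivity
  have hx : 0 < ‖1 + z‖ := by
    rcases hx0.lt_or_eq with h | h
    · exact h
    · rw [← h, zero_mul, Real.zero_rpow hθ0.ne'] at hD; exact absurd hD (lt_irrefl _)
  have hy : 0 < ‖1 - z‖ := by
    rcases hy0.lt_or_eq with h | h
    · exact h
    · rw [← h, mul_zero, Real.zero_rpow hθ0.ne'] at hD; exact absurd hD (lt_irrefl _)
  have hs : 0 ≤ sθ θ := by rw [sθ]; nlinarith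
  have hinv : 0 ≤ (1 - ‖lensMap θ z‖ ^ 2)⁻¹ := by
    have : 0 ≤ 1 - ‖lensMap θ z‖ ^ 2 := by nlinarith [norm_nonneg (lensMap θ z)]
    positivity
  set D := (‖1 + z‖ * ‖1 - z‖) ^ θ with hDdef
  have hmain : (4 / D) ^ (1 - θ) * (4 / D) = 4 ^ (2 - θ) * (‖1 + z‖ ^ (-(sθ θ)) * ‖1 - z‖ ^ (-(sθ θ))) := by
    have e1 : (4 / D) ^ (1 - θ) * (4 / D) = (4 / D) ^ (2 - θ) := by
      rw [show (2 - θ) = (1 - θ) + 1 by ring, Real.rpow_add (by positivity), Real.rpow_one]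
    rw [e1, Real.div_rpow (by norm_num) hD.le, hDdef, ← Real.rpow_mul (by positivity), ← sθ,
      ← Real.mul_rpow hx0 hy0, Real.rpow_neg (by positivity), div_eq_mul_inv]
  have hsum : ‖1 + z‖ ^ (-(sθ θ)) * ‖1 - z‖ ^ (-(sθ θ)) ≤ ‖1 + z‖ ^ (-(sθ θ)) + ‖1 - z‖ ^ (-(sθ θ)) := by
    have p1 : 0 < ‖1 + z‖ ^ (-(sθ θ)) := by positivity
    have p2 : 0 < ‖1 - z‖ ^ (-(sθ θ)) := by positivity
    have h2 : 2 ≤ ‖1 + z‖ + ‖1 - z‖ := by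
      have := norm_add_le (1 + z) (1 - z)
      rw [show (1 + z) + (1 - z) = 2 by ring] at this
      simpa using this
    rcases le_total 1 ‖1 + z‖ with h | h
    · have := Real.rpow_le_one_of_one_le_of_nonpos h (neg_nonpos.2 hs)
      nlinarith
    · have := Real.rpow_le_one_of_one_le_of_nonpos (show 1 ≤ ‖1 - z‖ by linarith) (neg_nonpos.2 hs)
      nlinarith
  calc _ ≤ (κ ^ m * (4 / D) ^ (1 - θ)) * ((Real.cos (θ * (Real.pi / 2)))⁻¹ * (4 / D)) := by gcongr
    _ = (Real.cos (θ * (Real.pi / 2)))⁻¹ * κ ^ m * ((4 / D) ^ (1 - θ) * (4 / D)) := by ring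
    _ = (Real.cos (θ * (Real.pi / 2)))⁻¹ * 4 ^ (2 - θ) * κ ^ m * (‖1 + z‖ ^ (-(sθ θ)) * ‖1 - z‖ ^ (-(sθ θ))) := by
      rw [hmain]; ring
    _ ≤ _ := by gcongr

lemma circ_low {r : ℝ} (hr0 : 0 < r) (hr1 : r < 1) {t : ℝ} (ht : |t| ≤ Real.pi) :
    |t| / Real.pi ≤ ‖1 - circleMap 0 r t‖ := by
  have e : ‖1 - circleMap 0 r t‖ ^ 2 = (1 - r * Real.cos t) ^ 2 + (r * Real.sin t) ^ 2 := by
    rw [← Complex.normSq_eq_norm_sq, Complex.normSq_apply]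
    simp [circleMap, Complex.exp_ofReal_mul_I_re, Complex.exp_ofReal_mul_I_im]
    ring
  have hpi := Real.pi_pos
  have hsc := Real.sin_sq_add_cos_sq t
  refine (sq_le_sq₀ (by positivity) (norm_nonneg _)).1 ?_
  rw [e]
  rcases le_total |t| (Real.pi / 2) with h | h
  · have hs := Real.mul_abs_le_abs_sin h
    have hs2 : |t| / Real.pi ≤ |Real.sin t| := by
      refine le_trans ?_ hs
      rw [div_mul_eq_mul_div]
      gcongr
      linarith [abs_nonneg t]
    have : (|t| / Real.pi) ^ 2 ≤ Real.sin t ^ 2 := by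
      rw [← sq_abs (Real.sin t)]; gcongr
    nlinarith [sq_nonneg (r - Real.cos t)]
  · have hcos : Real.cos t ≤ 0 := by
      rw [← Real.cos_abs]; exact Real.cos_nonpos_of_pi_div_two_le_of_le h (by linarith)
    have : |t| / Real.pi ≤ 1 := by rw [div_le_one hpi]; exact ht
    have : (|t| / Real.pi) ^ 2 ≤ 1 := by
      have : 0 ≤ |t| / Real.pi := by positivity
      nlinarith
    nlinarith [mul_nonneg hr0.le (neg_nonneg.2 hcos), sq_nonneg (r * Real.sin t), sq_nonneg (r * Real.cos t)]

/-- dominating function -/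
def domF (s t : ℝ) : ℝ := Real.pi ^ s * (|t| ^ (-s) + |t - Real.pi| ^ (-s) + |t - 2 * Real.pi| ^ (-s))

lemma domF_int {s : ℝ} (hs : s < 1) : IntervalIntegrable (domF s) MeasureTheory.volume 0 (2 * Real.pi) := by
  have h0 : ∀ a b : ℝ, IntervalIntegrable (fun t : ℝ => |t| ^ (-s)) MeasureTheory.volume a b := by
    intro a b
    have hpos : ∀ c : ℝ, 0 ≤ c → IntervalIntegrable (fun t : ℝ => |t| ^ (-s)) MeasureTheory.volume 0 c := by
      intro c hc
      have := intervalIntegral.intervalIntegrable_rpow' (r := -s) (by linarith) (a := 0) (b := c)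
      refine this.congr ?_
      intro t ht
      rw [Set.uIoc_of_le hc] at ht
      simp only [abs_of_pos ht.1]
    have hall : ∀ c : ℝ, IntervalIntegrable (fun t : ℝ => |t| ^ (-s)) MeasureTheory.volume 0 c := by
      intro c
      rcases le_total 0 c with h | h
      · exact hpos c h
      · have := (hpos (-c) (by linarith)).comp_sub_left 0
        simpa using this
    exact (hall a).symm.trans (hall b)
  have h1 : ∀ c : ℝ, IntervalIntegrable (fun t : ℝ => |t - c| ^ (-s)) MeasureTheory.volume 0 (2 * Real.pi) := by
    intro c
    have := (h0 (0 - c) (2 * Real.pi - c)).comp_sub_right c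
    simpa using this
  unfold domF
  refine (((h0 _ _).add (h1 _)).add (h1 _)).const_mul _

lemma domF_bound {s : ℝ} (hs : 0 ≤ s) {r : ℝ} (hr0 : 0 < r) (hr1 : r < 1) {t : ℝ}
    (h0 : 0 < t) (h1 : t < 2 * Real.pi) (hpi : t ≠ Real.pi) :
    ‖1 + circleMap 0 r t‖ ^ (-s) + ‖1 - circleMap 0 r t‖ ^ (-s) ≤ domF s t := by
  have pp := Real.pi_pos
  have key : ∀ x y : ℝ, 0 < x → x / Real.pi ≤ y → y ^ (-s) ≤ Real.pi ^ s * x ^ (-s) := by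
    intro x y hx hxy
    calc y ^ (-s) ≤ (x / Real.pi) ^ (-s) := Real.rpow_le_rpow_of_nonpos (by positivity) hxy (by linarith)
      _ = _ := by
        rw [Real.div_rpow hx.le pp.le, Real.rpow_neg pp.le, div_inv_eq_mul, mul_comm]
  have c1 : 1 + circleMap 0 r t = 1 - circleMap 0 r (t - Real.pi) := by
    simp only [circleMap]
    push_cast
    rw [sub_mul, Complex.exp_sub, Complex.exp_pi_mul_I]
    ring
  have c2 : circleMap 0 r (t - 2 * Real.pi) = circleMap 0 r t := by
    simp only [circleMap]
    push_cast
    rw [sub_mul, Complex.exp_sub, Complex.exp_two_pi_mul_I]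
    ring
  have k1 : ‖1 + circleMap 0 r t‖ ^ (-s) ≤ Real.pi ^ s * |t - Real.pi| ^ (-s) := by
    rw [c1]
    refine key _ _ (abs_pos.2 (sub_ne_zero.2 hpi)) (circ_low hr0 hr1 ?_)
    rw [abs_le]; constructor <;> linarith
  have k2 : ‖1 - circleMap 0 r t‖ ^ (-s) ≤ Real.pi ^ s * |t| ^ (-s) + Real.pi ^ s * |t - 2 * Real.pi| ^ (-s) := by
    rcases le_total t Real.pi with h | h
    · have := key _ _ (abs_pos.2 h0.ne') (circ_low hr0 hr1 (t := t) (by rw [abs_le]; constructor <;> linarith))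
      have : 0 ≤ Real.pi ^ s * |t - 2 * Real.pi| ^ (-s) := by positivity
      linarith
    · have := key _ _ (abs_pos.2 (sub_ne_zero.2 h1.ne)) (circ_low hr0 hr1 (t := t - 2 * Real.pi) (by rw [abs_le]; constructor <;> linarith))
      rw [c2] at this
      have : 0 ≤ Real.pi ^ s * |t| ^ (-s) := by positivity
      linarith
  rw [domF]
  linarith

lemma lim_r {a : ℕ → ℝ} {B : ℝ} {M : ℕ}
    (h : ∀ r : ℝ, 0 < r → r < 1 → ∑ i ∈ Finset.range M, a i * r ^ (2 * i) ≤ B) :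
    ∑ i ∈ Finset.range M, a i ≤ B := by
  have hc : Filter.Tendsto (fun r : ℝ => ∑ i ∈ Finset.range M, a i * r ^ (2 * i))
      (nhdsWithin 1 (Set.Iio 1)) (nhds (∑ i ∈ Finset.range M, a i * (1:ℝ) ^ (2 * i))) := by
    have : Continuous (fun r : ℝ => ∑ i ∈ Finset.range M, a i * r ^ (2 * i)) := by fun_prop
    exact (this.tendsto 1).mono_left nhdsWithin_le_nhds
  simp only [one_pow, mul_one] at hc
  refine le_of_tendsto hc ?_
  filter_upwards [Ioo_mem_nhdsLT (show (0:ℝ) < 1 by norm_num)] with r hr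
  exact h r hr.1 hr.2

lemma eK_diff {L : List ℝ} (hL : ∀ a ∈ L, |a| < 1) (p : ℕ) :
    DifferentiableOn ℂ (eK L p) (Metric.ball 0 1) := by
  obtain ⟨g, h, hg, -, -, e⟩ := finite_rank hL
  have : DifferentiableOn ℂ (fun w => w ^ p - ∑ i, g i w * h i p) (Metric.ball 0 1) := by
    refine DifferentiableOn.sub (by fun_prop) ?_
    refine DifferentiableOn.fun_sum fun i _ => (hg i).mul_const _
  refine this.congr fun w hw => ?_
  rw [← e w (by simpa using hw) p]; ring

lemma comp_lens_diff {θ : ℝ} (hθ0 : 0 < θ) (hθ1 : θ < 1) {f : ℂ → ℂ}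
    (hf : DifferentiableOn ℂ f (Metric.ball 0 1)) :
    DifferentiableOn ℂ (fun z => f (lensMap θ z)) (Metric.ball 0 1) :=
  hf.comp (lens_diff hθ0 hθ1) fun z hz => by simpa using lens_lt hθ0 hθ1 (by simpa using hz)

lemma cf_bdd {f : ℂ → ℂ} (hf : DifferentiableOn ℂ f (Metric.ball 0 1)) {C : ℝ}
    (hC : ∀ z, ‖z‖ < 1 → ‖f z‖ ≤ C) (M : ℕ) : ∑ i ∈ Finset.range M, ‖cf f i‖ ^ 2 ≤ C ^ 2 := by
  refine lim_r fun r hr0 hr1 => (bessel hf hr0 hr1 M).trans ?_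
  have hpi := Real.two_pi_pos
  have : ∫ t in (0:ℝ)..(2 * Real.pi), ‖f (circleMap 0 r t)‖ ^ 2 ≤ ∫ t in (0:ℝ)..(2 * Real.pi), C ^ 2 := by
    refine intervalIntegral.integral_mono_on hpi.le ?_ (by simp) fun t _ => ?_
    · exact ((circ_cont hf hr0 hr1).norm.pow 2).intervalIntegrable _ _
    · have := hC _ (circ_mem hr0 hr1 t)
      gcongr
  rw [intervalIntegral.integral_const, sub_zero, smul_eq_mul] at this
  calc _ ≤ (2 * Real.pi)⁻¹ * (2 * Real.pi * C ^ 2) := by gcongr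
    _ = C ^ 2 := by field_simp

lemma hs1 {θ : ℝ} (hθ0 : 0 < θ) (hθ1 : θ < 1) : ∃ C κ : ℝ, 0 < C ∧ 0 < κ ∧ κ < 1 ∧ ∀ m M n : ℕ,
    ∑ i ∈ Finset.range M, ∑ p ∈ Finset.range n, ‖cf (fun z => eK (zL m) p (lensMap θ z)) i‖ ^ 2 ≤
      C * κ ^ m := by
  have hc := cos_pos' hθ0 hθ1
  have hpi := Real.two_pi_pos
  set δ := Real.cos (θ * (Real.pi / 2)) with hδ
  set κ := max (1 - 4/5 * δ) ((2:ℝ)⁻¹ ^ (1 - θ)) with hκ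
  have hκ1 : 1 - 4/5 * δ ≤ κ := le_max_left _ _
  have hκ2 : (2:ℝ)⁻¹ ^ (1 - θ) ≤ κ := le_max_right _ _
  have hκ0 : 0 < κ := lt_of_lt_of_le (by positivity) hκ2
  have hκ3 : κ < 1 := by
    refine max_lt (by linarith) ?_
    exact Real.rpow_lt_one (by norm_num) (by norm_num) (by linarith)
  have hs0 : 0 ≤ sθ θ := by rw [sθ]; nlinarith
  have hs1 : sθ θ < 1 := by rw [sθ]; nlinarith
  set I := ∫ t in (0:ℝ)..(2 * Real.pi), domF (sθ θ) t with hI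
  have hI0 : 0 ≤ I := by
    refine intervalIntegral.integral_nonneg hpi.le fun t _ => ?_
    have := Real.pi_pos
    rw [domF]; positivity
  set K := δ⁻¹ * 4 ^ (2 - θ) with hK
  have hK0 : 0 < K := by positivity
  refine ⟨(2 * Real.pi)⁻¹ * (K * I) + 1, κ, by positivity, hκ0, hκ3, fun m M n => ?_⟩
  have hd : ∀ p, DifferentiableOn ℂ (fun z => eK (zL m) p (lensMap θ z)) (Metric.ball 0 1) :=
    fun p => comp_lens_diff hθ0 hθ1 (eK_diff (zL_lt m) p)
  suffices hmain : ∑ i ∈ Finset.range M, ∑ p ∈ Finset.range n, ‖cf (fun z => eK (zL m) p (lensMap θ z)) i‖ ^ 2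
      ≤ (2 * Real.pi)⁻¹ * (K * κ ^ m * I) by
    have : 0 < κ ^ m := by positivity
    nlinarith
  refine lim_r fun r hr0 hr1 => ?_
  have hIntb : ∀ p, IntervalIntegrable (fun t : ℝ => ‖eK (zL m) p (lensMap θ (circleMap 0 r t))‖ ^ 2)
      MeasureTheory.volume 0 (2 * Real.pi) := fun p =>
    ((circ_cont (hd p) hr0 hr1).norm.pow 2).intervalIntegrable _ _
  have h1 : ∑ i ∈ Finset.range M, (∑ p ∈ Finset.range n, ‖cf (fun z => eK (zL m) p (lensMap θ z)) i‖ ^ 2) * r ^ (2 * i)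
     = ∑ p ∈ Finset.range n, ∑ i ∈ Finset.range M, ‖cf (fun z => eK (zL m) p (lensMap θ z)) i‖ ^ 2 * r ^ (2 * i) := by
    rw [Finset.sum_comm]
    simp only [Finset.sum_mul]
  rw [h1]
  refine (Finset.sum_le_sum fun p _ => bessel (hd p) hr0 hr1 M).trans ?_
  rw [← Finset.mul_sum, ← intervalIntegral.integral_finsetSum fun p _ => hIntb p]
  gcongr
  rw [hI, ← intervalIntegral.integral_const_mul]
  refine intervalIntegral.integral_mono_ae_restrict hpi.le ?_ ?_ ?_
  · have : Continuous (fun t : ℝ => ∑ p ∈ Finset.range n, ‖eK (zL m) p (lensMap θ (circleMap 0 r t))‖ ^ 2) :=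
      continuous_finsetSum _ fun p _ => (circ_cont (hd p) hr0 hr1).norm.pow 2
    exact this.intervalIntegrable _ _
  · exact (domF_int hs1).const_mul _
  · filter_upwards [MeasureTheory.ae_restrict_mem measurableSet_Icc,
      MeasureTheory.ae_restrict_of_ae (MeasureTheory.Measure.ae_ne MeasureTheory.volume (0:ℝ)),
      MeasureTheory.ae_restrict_of_ae (MeasureTheory.Measure.ae_ne MeasureTheory.volume (Real.pi)),
      MeasureTheory.ae_restrict_of_ae (MeasureTheory.Measure.ae_ne MeasureTheory.volume (2 * Real.pi))] with t ht h0 hp h2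
    refine (pointwise_bound hθ0 hθ1 m hκ1 hκ2 (circ_mem hr0 hr1 t) n).trans ?_
    have := domF_bound hs0 hr0 hr1 (lt_of_le_of_ne ht.1 (Ne.symm h0)) (lt_of_le_of_ne ht.2 h2) hp
    gcongr

lemma oneD {θ : ℝ} (hθ0 : 0 < θ) (hθ1 : θ < 1) : ∃ C κ : ℝ, 0 < C ∧ 0 < κ ∧ κ < 1 ∧
    ∃ A : ℕ → ℕ → ℂ,
      (∀ z : ℂ, ‖z‖ < 1 → ∀ p, HasSum (fun i => A i p * z ^ i) (lensMap θ z ^ p)) ∧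
      ∀ m : ℕ, ∃ g h : Fin (m * (2 * m + 1)) → ℕ → ℂ,
        (∀ k, ∃ B : ℝ, ∀ n, ∑ i ∈ Finset.range n, ‖g k i‖ ^ 2 ≤ B) ∧
        (∀ k, ∃ B : ℝ, ∀ n, ∑ i ∈ Finset.range n, ‖h k i‖ ^ 2 ≤ B) ∧
        ∀ M n : ℕ, ∑ i ∈ Finset.range M, ∑ p ∈ Finset.range n, ‖A i p - ∑ k, g k i * h k p‖ ^ 2 ≤
          C * κ ^ m := by
  obtain ⟨C, κ, hC, hκ0, hκ1, H⟩ := hs1 hθ0 hθ1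
  have hA : ∀ p, DifferentiableOn ℂ (fun z => lensMap θ z ^ p) (Metric.ball 0 1) := fun p =>
    comp_lens_diff hθ0 hθ1 (f := fun w => w ^ p) (by fun_prop)
  refine ⟨C, κ, hC, hκ0, hκ1, fun i p => cf (fun z => lensMap θ z ^ p) i, ?_, ?_⟩
  · intro z hz p
    exact cf_hasSum (hA p) hz
  · intro m
    rw [← zL_length m]
    obtain ⟨g, h, hg, hgb, hh, e⟩ := finite_rank (zL_lt m)
    have hgd := fun k => comp_lens_diff hθ0 hθ1 (hg k)
    refine ⟨fun k i => cf (fun z => g k (lensMap θ z)) i, h, ?_, hh, ?_⟩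
    · intro k
      obtain ⟨B, hB⟩ := hgb k
      exact ⟨B ^ 2, cf_bdd (hgd k) fun z hz => hB _ (lens_lt hθ0 hθ1 hz)⟩
    · intro M n
      convert H m M n using 5 with i _ p _
      have := uniq1' (f := fun z => eK (zL m) p (lensMap θ z))
        (c := fun i => cf (fun z => lensMap θ z ^ p) i - ∑ k, cf (fun z => g k (lensMap θ z)) i * h k p)
        (c' := cf (fun z => eK (zL m) p (lensMap θ z))) (fun z hz => ?_)
        (fun z hz => cf_hasSum (comp_lens_diff hθ0 hθ1 (eK_diff (zL_lt m) p)) hz)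
      · exact congrFun this i
      · have e2 : eK (zL m) p (lensMap θ z) = lensMap θ z ^ p - ∑ k, g k (lensMap θ z) * h k p := by
          rw [← e _ (lens_lt hθ0 hθ1 hz) p]; ring
        have h1 := cf_hasSum (hA p) hz
        have h2 := hasSum_sum (s := Finset.univ) fun k _ => (cf_hasSum (hgd k) hz).mul_right (h k p)
        have h3 := h1.sub h2
        simp only [e2]
        refine h3.congr_fun fun x => ?_
        rw [sub_mul, Finset.sum_mul]
        congr 1
        exact Finset.sum_congr rfl fun k _ => by ring

/-- boxes -/
def bx (d n : ℕ) : Finset (Fin d → ℕ) := Fintype.piFinset fun _ => Finset.range n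

lemma subset_bx {d : ℕ} (s : Finset (Fin d → ℕ)) : ∃ n, s ⊆ bx d n := by
  refine ⟨s.sup (fun β => ∑ j, β j) + 1, fun β hβ => ?_⟩
  simp only [bx, Fintype.mem_piFinset, Finset.mem_range]
  intro j
  have h1 : β j ≤ ∑ j, β j := Finset.single_le_sum (f := fun j => β j) (fun _ _ => Nat.zero_le _) (Finset.mem_univ j)
  have h2 : ∑ j, β j ≤ s.sup (fun β => ∑ j, β j) := Finset.le_sup (f := fun β : Fin d → ℕ => ∑ j, β j) hβ
  omega

lemma sum_bx_prod (d n : ℕ) (f : Fin d → ℕ → ℝ) :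
    ∑ β ∈ bx d n, ∏ j, f j (β j) = ∏ j, ∑ i ∈ Finset.range n, f j i := by
  rw [Finset.prod_univ_sum]; rfl

lemma sum_bx_prod2 (d M n : ℕ) (f : Fin d → ℕ → ℕ → ℝ) :
    ∑ β ∈ bx d M, ∑ α ∈ bx d n, ∏ j, f j (β j) (α j) =
      ∏ j, ∑ i ∈ Finset.range M, ∑ p ∈ Finset.range n, f j i p := by
  rw [← sum_bx_prod]
  refine Finset.sum_congr rfl fun β _ => ?_
  exact sum_bx_prod d n (fun j => f j (β j))

lemma tensor_hs (d : ℕ) (X Y : ℕ → ℕ → ℂ) {ε D : ℝ} (hε : 0 ≤ ε) (hεD : ε ≤ D)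
    (hE : ∀ M n : ℕ, ∑ i ∈ Finset.range M, ∑ p ∈ Finset.range n, ‖X i p - Y i p‖ ^ 2 ≤ ε)
    (hY : ∀ M n : ℕ, ∑ i ∈ Finset.range M, ∑ p ∈ Finset.range n, ‖Y i p‖ ^ 2 ≤ D) (M n : ℕ) :
    ∑ β ∈ bx d M, ∑ α ∈ bx d n, ‖∏ j, X (β j) (α j) - ∏ j, Y (β j) (α j)‖ ^ 2 ≤
      4 ^ d * (ε * D ^ (d - 1)) := by
  classical
  set S : Finset (Finset (Fin d)) := (Finset.univ : Finset (Fin d)).powerset.erase ∅ with hS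
  have hcard : (S.card : ℝ) ≤ 2 ^ d := by
    have : S.card ≤ 2 ^ d := by
      refine (Finset.card_erase_le).trans ?_
      simp
    exact_mod_cast this
  let v : Finset (Fin d) → Fin d → ℕ → ℕ → ℝ := fun J j i p =>
    if j ∈ J then ‖X i p - Y i p‖ ^ 2 else ‖Y i p‖ ^ 2
  have hpt : ∀ β α : Fin d → ℕ, ‖∏ j, X (β j) (α j) - ∏ j, Y (β j) (α j)‖ ^ 2 ≤
      2 ^ d * ∑ J ∈ S, ∏ j, v J j (β j) (α j) := by
    intro β α
    have e1 : ∏ j, X (β j) (α j) - ∏ j, Y (β j) (α j) = ∑ J ∈ S,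
        (∏ j ∈ J, (X (β j) (α j) - Y (β j) (α j))) * ∏ j ∈ Finset.univ \ J, Y (β j) (α j) := by
      have := Finset.prod_add (fun j => X (β j) (α j) - Y (β j) (α j)) (fun j => Y (β j) (α j)) Finset.univ
      simp only [sub_add_cancel] at this
      rw [this, ← Finset.add_sum_erase _ _ (Finset.empty_mem_powerset _)]
      simp [hS]
    rw [e1]
    calc _ ≤ (∑ J ∈ S, ‖(∏ j ∈ J, (X (β j) (α j) - Y (β j) (α j))) * ∏ j ∈ Finset.univ \ J, Y (β j) (α j)‖) ^ 2 := by
          gcongr; exact norm_sum_le _ _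
      _ ≤ S.card * ∑ J ∈ S, ‖(∏ j ∈ J, (X (β j) (α j) - Y (β j) (α j))) * ∏ j ∈ Finset.univ \ J, Y (β j) (α j)‖ ^ 2 :=
          sq_sum_le_card_mul_sum_sq
      _ ≤ 2 ^ d * ∑ J ∈ S, ‖(∏ j ∈ J, (X (β j) (α j) - Y (β j) (α j))) * ∏ j ∈ Finset.univ \ J, Y (β j) (α j)‖ ^ 2 := by
          gcongr
      _ = _ := by
          congr 1
          refine Finset.sum_congr rfl fun J _ => ?_
          rw [norm_mul, norm_prod, norm_prod, mul_pow, ← Finset.prod_pow, ← Finset.prod_pow]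
          simp only [v]
          rw [Finset.prod_ite]
          congr 2
          · ext j; simp
          · ext j; simp
  have hterm : ∀ J ∈ S, ∑ β ∈ bx d M, ∑ α ∈ bx d n, ∏ j, v J j (β j) (α j) ≤ ε * D ^ (d - 1) := by
    intro J hJ
    rw [sum_bx_prod2]
    obtain ⟨j0, hj0⟩ := Finset.nonempty_iff_ne_empty.2 (Finset.ne_of_mem_erase hJ)
    rw [← Finset.mul_prod_erase _ _ (Finset.mem_univ j0)]
    have hv0 : ∀ j i p, 0 ≤ v J j i p := by
      intro j i p; simp only [v]; split_ifs <;> positivity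
    have b1 : ∑ i ∈ Finset.range M, ∑ p ∈ Finset.range n, v J j0 i p ≤ ε := by
      simp only [v, if_pos hj0]; exact hE M n
    have b2 : ∀ j, ∑ i ∈ Finset.range M, ∑ p ∈ Finset.range n, v J j i p ≤ D := by
      intro j
      simp only [v]
      split_ifs
      · exact (hE M n).trans hεD
      · exact hY M n
    have b3 : ∏ j ∈ Finset.univ.erase j0, ∑ i ∈ Finset.range M, ∑ p ∈ Finset.range n, v J j i p ≤ D ^ (d - 1) := by
      calc _ ≤ ∏ j ∈ Finset.univ.erase j0, D := Finset.prod_le_prod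
            (fun j _ => Finset.sum_nonneg fun i _ => Finset.sum_nonneg fun p _ => hv0 j i p) (fun j _ => b2 j)
        _ = _ := by rw [Finset.prod_const, Finset.card_erase_of_mem (Finset.mem_univ _)]; simp
    exact mul_le_mul b1 b3 (Finset.prod_nonneg fun j _ => Finset.sum_nonneg fun i _ => Finset.sum_nonneg fun p _ => hv0 j i p) hε
  have hD : 0 ≤ D := hε.trans hεD
  calc _ ≤ ∑ β ∈ bx d M, ∑ α ∈ bx d n, 2 ^ d * ∑ J ∈ S, ∏ j, v J j (β j) (α j) :=
        Finset.sum_le_sum fun β _ => Finset.sum_le_sum fun α _ => hpt β α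
    _ = 2 ^ d * ∑ J ∈ S, ∑ β ∈ bx d M, ∑ α ∈ bx d n, ∏ j, v J j (β j) (α j) := by
        simp only [← Finset.mul_sum]
        congr 1
        rw [Finset.sum_comm (s := S)]
        refine Finset.sum_congr rfl fun β _ => ?_
        rw [Finset.sum_comm]
    _ ≤ 2 ^ d * ∑ J ∈ S, ε * D ^ (d - 1) := by
        gcongr with J hJ; exact hterm J hJ
    _ = 2 ^ d * (S.card * (ε * D ^ (d - 1))) := by rw [Finset.sum_const, nsmul_eq_mul]
    _ ≤ 2 ^ d * (2 ^ d * (ε * D ^ (d - 1))) := by gcongr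
    _ = _ := by rw [← mul_assoc, ← mul_pow]; norm_num

lemma hasSum_pi {d : ℕ} (f : Fin d → ℕ → ℂ) (a : Fin d → ℂ) (h : ∀ j, HasSum (f j) (a j)) :
    HasSum (fun β : Fin d → ℕ => ∏ j, f j (β j)) (∏ j, a j) := by
  induction d with
  | zero =>
    convert hasSum_unique (fun β : Fin 0 → ℕ => ∏ j, f j (β j)) using 1
    simp
  | succ d ih =>
    have h1 := ih (fun j => f j.succ) (fun j => a j.succ) (fun j => h j.succ)
    have hs : Summable (fun x : ℕ × (Fin d → ℕ) => f 0 x.1 * ∏ j, f (Fin.succ j) (x.2 j)) :=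
      summable_mul_of_summable_norm (f := f 0) (g := fun β : Fin d → ℕ => ∏ j, f (Fin.succ j) (β j))
        (h 0).summable.norm h1.summable.norm
    have h2 : HasSum (fun x : ℕ × (Fin d → ℕ) => f 0 x.1 * ∏ j, f (Fin.succ j) (x.2 j))
        (a 0 * ∏ j, a (Fin.succ j)) := by
      have h3 := HasSum.prod_fiberwise hs.hasSum (fun i => h1.mul_left (f 0 i))
      have h4 := (h 0).mul_right (∏ j, a (Fin.succ j))
      rw [← h3.unique h4]
      exact hs.hasSum
    rw [Fin.prod_univ_succ]
    rw [← (Fin.consEquiv (fun _ : Fin (d+1) => ℕ)).hasSum_iff]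
    refine h2.congr_fun fun x => ?_
    simp [Fin.prod_univ_succ, Fin.consEquiv]

lemma uniqM {d : ℕ} (h : (Fin d → ℕ) → ℂ)
    (H : ∀ z ∈ polydisk d, HasSum (fun β => h β * ∏ j, (z j) ^ (β j)) 0) : h = 0 := by
  induction d with
  | zero =>
    have h1 := (H (fun _ => 0) (fun j => j.elim0))
    have h2 := hasSum_unique (fun β : Fin 0 → ℕ => h β * ∏ j, ((fun _ => 0 : Fin 0 → ℂ) j) ^ (β j))
    have := h1.unique h2
    funext β
    rw [Subsingleton.elim β default]
    rw [Fin.prod_univ_zero, mul_one] at this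
    exact (congrArg h (Subsingleton.elim _ _)).trans this.symm
  | succ d ih =>
    have key : ∀ z0 : ℂ, ‖z0‖ < 1 → ∀ z ∈ polydisk d,
        HasSum (fun x : ℕ × (Fin d → ℕ) => h (Fin.cons x.1 x.2) * (∏ j, z j ^ x.2 j) * z0 ^ x.1) 0 := by
      intro z0 hz0 z hz
      have := H (Fin.cons z0 z) (by
        intro j
        refine Fin.cases ?_ (fun j => ?_) j
        · simpa using hz0
        · simpa using hz j)
      rw [← (Fin.consEquiv (fun _ : Fin (d+1) => ℕ)).hasSum_iff] at this
      refine this.congr_fun fun x => ?_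
      simp [Fin.prod_univ_succ, Fin.consEquiv]
      ring
    have step : ∀ m, (fun γ => h (Fin.cons m γ)) = 0 := by
      intro m
      apply ih
      intro z hz
      have hk : (fun m => ∑' γ, h (Fin.cons m γ) * ∏ j, z j ^ γ j) = 0 := by
        apply uniq1
        intro z0 hz0
        have h1 := key z0 hz0 z hz
        have h2 := h1.prod_fiberwise (fun m => (h1.summable.prod_factor m).hasSum)
        simpa only [tsum_mul_right] using h2
      have hs := (key (1/2) (by norm_num) z hz).summable.prod_factor m
      have hs2 : Summable (fun γ : Fin d → ℕ => h (Fin.cons m γ) * ∏ j, z j ^ γ j) := by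
        have := hs.mul_right (((1/2 : ℂ) ^ m)⁻¹)
        refine this.congr fun γ => ?_
        field_simp
      have := hs2.hasSum
      have hk' := congrFun hk m
      simp only [Pi.zero_apply] at hk'
      rwa [hk'] at this
    funext β
    have := congrFun (step (β 0)) (Fin.tail β)
    simpa using this

lemma memlp_of {d : ℕ} {f : (Fin d → ℕ) → ℂ} {B : ℝ} (h : ∀ n, ∑ β ∈ bx d n, ‖f β‖ ^ 2 ≤ B) :
    Memℓp f 2 := by
  apply memℓp_gen' (C := B)
  intro s
  obtain ⟨n, hn⟩ := subset_bx s
  simp only [ENNReal.toReal_ofNat, Real.rpow_two]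
  exact (Finset.sum_le_sum_of_subset_of_nonneg hn fun _ _ _ => by positivity).trans (h n)

lemma memlp_tensor {d : ℕ} {f : Fin d → ℕ → ℂ}
    (h : ∀ j, ∃ B : ℝ, ∀ n, ∑ i ∈ Finset.range n, ‖f j i‖ ^ 2 ≤ B) :
    Memℓp (fun β : Fin d → ℕ => ∏ j, f j (β j)) 2 := by
  choose B hB using h
  apply memlp_of (B := ∏ j, B j)
  intro n
  simp only [norm_prod, ← Finset.prod_pow]
  rw [sum_bx_prod d n (fun j i => ‖f j i‖ ^ 2)]
  exact Finset.prod_le_prod (fun j _ => Finset.sum_nonneg fun _ _ => by positivity) fun j _ => hB j n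

/-- basis vectors -/
def dl {d : ℕ} (α : Fin d → ℕ) : H2 d := lp.single 2 α 1

lemma hasSum_apply {d : ℕ} (W : H2 d →L[ℂ] H2 d) (c : H2 d) (β : Fin d → ℕ) :
    HasSum (fun α => c α * W (dl α) β) (W c β) := by
  have h := lp.hasSum_single (p := 2) (by norm_num) c
  have h2 := h.mapL W
  have h3 : HasSum (fun α => (W (lp.single 2 α (c α)) : H2 d) β) (W c β) := by
    have := h2.mapL (lp.evalCLM ℂ (fun _ : Fin d → ℕ => ℂ) 2 β)
    exact this
  refine h3.congr_fun fun α => ?_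
  have : lp.single (E := fun _ : Fin d → ℕ => ℂ) 2 α (c α) = c α • dl α := by
    rw [dl, ← lp.single_smul]; simp
  rw [this, map_smul]
  rfl

lemma hs_norm {d : ℕ} (W : H2 d →L[ℂ] H2 d) {ε : ℝ} (hε : 0 ≤ ε)
    (h : ∀ M n, ∑ β ∈ bx d M, ∑ α ∈ bx d n, ‖W (dl α) β‖ ^ 2 ≤ ε) : ‖W‖ ≤ Real.sqrt ε := by
  refine ContinuousLinearMap.opNorm_le_bound _ (Real.sqrt_nonneg _) fun c => ?_
  refine lp.norm_le_of_forall_sum_le (by simp) (by positivity) fun t => ?_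
  simp only [ENNReal.toReal_ofNat, Real.rpow_two]
  obtain ⟨M, hM⟩ := subset_bx t
  refine (Finset.sum_le_sum_of_subset_of_nonneg hM fun _ _ _ => by positivity).trans ?_
  rw [mul_pow, Real.sq_sqrt hε]
  have ht : Filter.Tendsto (fun s : Finset (Fin d → ℕ) => ∑ β ∈ bx d M, ‖∑ α ∈ s, c α * W (dl α) β‖ ^ 2)
      Filter.atTop (nhds (∑ β ∈ bx d M, ‖W c β‖ ^ 2)) := by
    refine tendsto_finsetSum _ fun β _ => ?_
    exact (Filter.Tendsto.norm (hasSum_apply W c β)).pow 2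
  refine le_of_tendsto' ht fun s => ?_
  obtain ⟨n, hn⟩ := subset_bx s
  have hc : ∑ α ∈ s, ‖c α‖ ^ 2 ≤ ‖c‖ ^ 2 := by
    have := lp.sum_rpow_le_norm_rpow (p := 2) (by simp) c s
    simpa using this
  calc _ ≤ ∑ β ∈ bx d M, ‖c‖ ^ 2 * ∑ α ∈ bx d n, ‖W (dl α) β‖ ^ 2 := by
        refine Finset.sum_le_sum fun β _ => ?_
        calc _ ≤ (∑ α ∈ s, ‖c α‖ * ‖W (dl α) β‖) ^ 2 := by
              gcongr
              refine (norm_sum_le _ _).trans (le_of_eq ?_)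
              exact Finset.sum_congr rfl fun _ _ => norm_mul _ _
          _ ≤ (∑ α ∈ s, ‖c α‖ ^ 2) * ∑ α ∈ s, ‖W (dl α) β‖ ^ 2 := Finset.sum_mul_sq_le_sq_mul_sq _ _ _
          _ ≤ _ := by gcongr
    _ = ‖c‖ ^ 2 * ∑ β ∈ bx d M, ∑ α ∈ bx d n, ‖W (dl α) β‖ ^ 2 := by rw [Finset.mul_sum]
    _ ≤ ‖c‖ ^ 2 * ε := by gcongr; exact h M n
    _ = _ := mul_comm _ _

lemma T_matrix {d : ℕ} {θ : ℝ}
    (T : H2 d →L[ℂ] H2 d) (hT : IsCompositionOperator (multiLens d θ) T)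
    (A : ℕ → ℕ → ℂ) (hA : ∀ z : ℂ, ‖z‖ < 1 → ∀ p, HasSum (fun i => A i p * z ^ i) (lensMap θ z ^ p))
    (α β : Fin d → ℕ) : T (dl α) β = ∏ j, A (β j) (α j) := by
  have := uniqM (fun β => T (dl α) β - ∏ j, A (β j) (α j)) (by
    intro z hz
    obtain ⟨_, h2, h3⟩ := hT (dl α) z hz
    have e1 : HasSum (fun γ : Fin d → ℕ => (dl α : H2 d) γ * ∏ j, (multiLens d θ z j) ^ (γ j))
        (∏ j, lensMap θ (z j) ^ (α j)) := by
      have := hasSum_single (f := fun γ : Fin d → ℕ => (dl α : H2 d) γ * ∏ j, (multiLens d θ z j) ^ (γ j)) α (by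
        intro γ hγ
        simp only [dl]
        rw [lp.single_apply_ne _ _ _ hγ, zero_mul])
      have e : (dl α : H2 d) α * ∏ j, (multiLens d θ z j) ^ (α j) = ∏ j, lensMap θ (z j) ^ (α j) := by
        simp only [dl]
        rw [lp.single_apply_self, one_mul]
        rfl
      rwa [e] at this
    have e2 := h2.of_norm.hasSum
    rw [← h3, e1.tsum_eq] at e2
    have e3 := hasSum_pi (fun j i => A i (α j) * z j ^ i) (fun j => lensMap θ (z j) ^ (α j))
      (fun j => hA (z j) (hz j) (α j))
    have e4 := e2.sub e3
    rw [sub_self] at e4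
    refine e4.congr_fun fun γ => ?_
    rw [Finset.prod_mul_distrib, sub_mul])
  have h := congrFun this β
  exact sub_eq_zero.1 h

/-- the finite rank operator -/
lemma exists_R {d N : ℕ} (g h : Fin N → ℕ → ℂ)
    (hg : ∀ k, ∃ B : ℝ, ∀ n, ∑ i ∈ Finset.range n, ‖g k i‖ ^ 2 ≤ B)
    (hh : ∀ k, ∃ B : ℝ, ∀ n, ∑ i ∈ Finset.range n, ‖h k i‖ ^ 2 ≤ B) :
    ∃ R : H2 d →L[ℂ] H2 d, LinearMap.rank (R : H2 d →ₗ[ℂ] H2 d) ≤ ((N ^ d : ℕ) : Cardinal) ∧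
      ∀ α β, R (dl α) β = ∏ j, ∑ k, g k (β j) * h k (α j) := by
  let G : (Fin d → Fin N) → H2 d := fun k =>
    ⟨fun β => ∏ j, g (k j) (β j), memlp_tensor (f := fun j => g (k j)) fun j => hg (k j)⟩
  let Hc : (Fin d → Fin N) → H2 d := fun k =>
    ⟨fun β => ∏ j, (starRingEnd ℂ) (h (k j) (β j)),
      memlp_tensor (f := fun j i => (starRingEnd ℂ) (h (k j) i)) fun j => by
        obtain ⟨B, hB⟩ := hh (k j)
        exact ⟨B, fun n => by simpa using hB n⟩⟩
  let R : H2 d →L[ℂ] H2 d := ∑ k, (innerSL ℂ (Hc k)).smulRight (G k)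
  have hR : ∀ c, R c = ∑ k, (inner ℂ (Hc k) c) • G k := by
    intro c
    simp [R]
  refine ⟨R, ?_, ?_⟩
  · have h1 : LinearMap.range (R : H2 d →ₗ[ℂ] H2 d) ≤ Submodule.span ℂ (Set.range G) := by
      rintro _ ⟨c, rfl⟩
      change R c ∈ _
      rw [hR]
      exact Submodule.sum_mem _ fun k _ => Submodule.smul_mem _ _ (Submodule.subset_span ⟨k, rfl⟩)
    have h2 := Submodule.rank_mono h1
    refine h2.trans ((rank_span_le _).trans (Cardinal.mk_range_le.trans ?_))
    simp
  · intro α β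
    rw [hR]
    have hin : ∀ k, inner ℂ (Hc k) (dl α) = ∏ j, h (k j) (α j) := by
      intro k
      have : inner ℂ (Hc k) (dl α) = inner ℂ ((Hc k) α) (1 : ℂ) := by
        simp only [dl]
        exact lp.inner_single_right (𝕜 := ℂ) (G := fun _ : Fin d → ℕ => ℂ) α (1 : ℂ) (Hc k)
      rw [this]
      simp [Hc, map_prod]
    have : (∑ k, (inner ℂ (Hc k) (dl α)) • G k : H2 d) β = ∑ k, (inner ℂ (Hc k) (dl α)) * ∏ j, g (k j) (β j) := by
      rw [lp.coeFn_sum, Finset.sum_apply]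
      rfl
    rw [this, Finset.prod_univ_sum]
    simp only [hin, Fintype.piFinset_univ]
    refine Finset.sum_congr rfl fun k _ => ?_
    rw [Finset.prod_mul_distrib, mul_comm]

lemma approx_le {d : ℕ} (T R : H2 d →L[ℂ] H2 d) {N n : ℕ}
    (hR : LinearMap.rank (R : H2 d →ₗ[ℂ] H2 d) ≤ (N : Cardinal)) (h : N < n) :
    approxNumber T n ≤ ‖T - R‖ := by
  refine csInf_le ⟨0, ?_⟩ ⟨R, lt_of_le_of_lt hR (by exact_mod_cast h), rfl⟩
  rintro c ⟨R, _, rfl⟩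
  exact norm_nonneg _

lemma approx_bound {d : ℕ} (hd : 1 ≤ d) {θ : ℝ} (hθ0 : 0 < θ) (hθ1 : θ < 1)
    (T : H2 d →L[ℂ] H2 d) (hT : IsCompositionOperator (multiLens d θ) T) :
    ∃ K q : ℝ, 0 < K ∧ 0 < q ∧ q < 1 ∧ ∀ m n : ℕ, (m * (2 * m + 1)) ^ d < n →
      approxNumber T n ≤ K * q ^ m := by
  obtain ⟨C, κ, hC, hκ, hκ1, A, hA, hm⟩ := oneD hθ0 hθ1
  have hA2 : ∀ M n : ℕ, ∑ i ∈ Finset.range M, ∑ p ∈ Finset.range n, ‖A i p‖ ^ 2 ≤ C := by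
    obtain ⟨g, h, _, _, h3⟩ := hm 0
    intro M n
    have hE := h3 M n
    have : IsEmpty (Fin (0 * (2 * 0 + 1))) := by rw [Nat.zero_mul]; infer_instance
    simpa using hE
  refine ⟨Real.sqrt (4 ^ d * (C * (4 * C) ^ (d - 1))), Real.sqrt κ, by positivity, by positivity,
    by rw [Real.sqrt_lt' one_pos]; simpa using hκ1, ?_⟩
  intro m n hmn
  obtain ⟨g, h, hg, hh, hE⟩ := hm m
  obtain ⟨R, hR1, hR2⟩ := exists_R (d := d) g h hg hh
  refine (approx_le T R hR1 hmn).trans ?_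
  have hκm : κ ^ m ≤ 1 := pow_le_one₀ hκ.le hκ1.le
  have hY : ∀ M n : ℕ, ∑ i ∈ Finset.range M, ∑ p ∈ Finset.range n, ‖∑ k, g k i * h k p‖ ^ 2 ≤ 4 * C := by
    intro M n
    calc _ ≤ ∑ i ∈ Finset.range M, ∑ p ∈ Finset.range n,
          (2 * ‖A i p‖ ^ 2 + 2 * ‖A i p - ∑ k, g k i * h k p‖ ^ 2) := by
          refine Finset.sum_le_sum fun i _ => Finset.sum_le_sum fun p _ => ?_
          have : ‖∑ k, g k i * h k p‖ ≤ ‖A i p‖ + ‖A i p - ∑ k, g k i * h k p‖ := by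
            have := norm_sub_le (A i p) (A i p - ∑ k, g k i * h k p)
            rwa [sub_sub_cancel] at this
          nlinarith [norm_nonneg (∑ k, g k i * h k p), sq_nonneg (‖A i p‖ - ‖A i p - ∑ k, g k i * h k p‖)]
      _ = 2 * (∑ i ∈ Finset.range M, ∑ p ∈ Finset.range n, ‖A i p‖ ^ 2) +
          2 * ∑ i ∈ Finset.range M, ∑ p ∈ Finset.range n, ‖A i p - ∑ k, g k i * h k p‖ ^ 2 := by
          simp only [Finset.sum_add_distrib, Finset.mul_sum]
      _ ≤ _ := by nlinarith [hA2 M n, hE M n]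
  have hts := tensor_hs d A (fun i p => ∑ k, g k i * h k p) (ε := C * κ ^ m) (D := 4 * C)
    (by positivity) (by nlinarith) hE hY
  have hfin := hs_norm (T - R) (ε := 4 ^ d * (C * κ ^ m * (4 * C) ^ (d - 1))) (by positivity) (by
    intro M n
    refine le_trans (le_of_eq ?_) (hts M n)
    refine Finset.sum_congr rfl fun β _ => Finset.sum_congr rfl fun α _ => ?_
    rw [← T_matrix T hT A hA, ← hR2]
    rfl)
  refine hfin.trans (le_of_eq ?_)
  have : (4:ℝ) ^ d * (C * κ ^ m * (4 * C) ^ (d - 1)) = 4 ^ d * (C * (4 * C) ^ (d - 1)) * (Real.sqrt κ ^ m) ^ 2 := by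
    rw [← pow_mul, mul_comm m 2, pow_mul, Real.sq_sqrt hκ.le]; ring
  rw [this, Real.sqrt_mul (by positivity), Real.sqrt_sq (by positivity)]

/-- Upper bound for the approximation numbers of the composition operator of a multi-lens
map: `a_n(C_{φ_θ}) ≤ a · exp(−b n^{1/(2d+1)})`. -/
theorem upper_bound_approx_numbers_multilens
    (d : ℕ) (hd : 1 ≤ d) (θ : ℝ) (hθ0 : 0 < θ) (hθ1 : θ < 1)
    (T : H2 d →L[ℂ] H2 d) (hT : IsCompositionOperator (multiLens d θ) T) :
    ∃ a b : ℝ, 0 < a ∧ 0 < b ∧ ∀ n : ℕ, 1 ≤ n →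
      approxNumber T n ≤ a * Real.exp (-b * (n : ℝ) ^ ((1 : ℝ) / (2 * d + 1))) := by
  obtain ⟨K, q, hK, hq, hq1, hb⟩ := approx_bound hd hθ0 hθ1 T hT
  have hlog : Real.log q < 0 := Real.log_neg hq hq1
  refine ⟨K / q, -Real.log q / 4, by positivity, by linarith, fun n hn => ?_⟩
  set x : ℝ := (n : ℝ) ^ ((1 : ℝ) / (2 * d + 1)) with hx
  have hn1 : (1 : ℝ) ≤ n := by exact_mod_cast hn
  have hx1 : 1 ≤ x := Real.one_le_rpow hn1 (by positivity)
  have hxn : x ^ (2 * d + 1) = n := by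
    rw [hx, ← Real.rpow_natCast, ← Real.rpow_mul (by positivity)]
    have : (1 : ℝ) / (2 * d + 1) * ((2 * d + 1 : ℕ) : ℝ) = 1 := by
      push_cast; field_simp
    rw [this, Real.rpow_one]
  have hm1 : ((⌊x / 4⌋₊ : ℕ) : ℝ) ≤ x / 4 := Nat.floor_le (by positivity)
  have hm2 : x / 4 - 1 ≤ ((⌊x / 4⌋₊ : ℕ) : ℝ) := by linarith [Nat.lt_floor_add_one (x / 4)]
  generalize ⌊x / 4⌋₊ = m at hm1 hm2
  have hN : (m * (2 * m + 1)) ^ d < n := by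
    have hm0 : (0 : ℝ) ≤ m := Nat.cast_nonneg m
    have h1 : (m : ℝ) * (2 * m + 1) < x ^ 2 := by nlinarith
    have h2 : ((m : ℝ) * (2 * m + 1)) ^ d < (x ^ 2) ^ d :=
      pow_lt_pow_left₀ h1 (by positivity) (by omega)
    have h3 : (x ^ 2) ^ d ≤ (n : ℝ) := by
      rw [← hxn, ← pow_mul]
      exact pow_le_pow_right₀ hx1 (by omega)
    exact_mod_cast h2.trans_le h3
  refine (hb m n hN).trans ?_
  have hqm : q ^ m = Real.exp (m * Real.log q) := by
    rw [Real.exp_nat_mul, Real.exp_log hq]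
  have hq' : K / q = K * Real.exp (-Real.log q) := by
    rw [Real.exp_neg, Real.exp_log hq, div_eq_mul_inv]
  rw [hqm, hq', mul_assoc, ← Real.exp_add]
  gcongr
  nlinarith
end
end

section
/- Let d ≥ 1, let 0 < θ < 1, let φ_θ : 𝔻^d → 𝔻^d be the multi-lens map of parameter θ, and suppose T is a bounded linear operator on ℓ²(ℕ^d) which is the composition operator C_{φ_θ}. Then there exist constants a', b' > 0, depending only on θ and d, such that a_n(T) ≥ a' · exp(−b' · n^{1/(2d)}) for all n ≥ 1. -/
open scoped ENNReal

noncomputable section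

lemma summable_of_sq_bdd (a : ℕ → ℝ) (C : ℝ) (ha : ∀ N, ∑ n ∈ Finset.range N, a n ^ 2 ≤ C)
    (x : ℝ) (hx : |x| < 1) : Summable (fun n => a n * x ^ n) := by
  have h1 : ∀ n, a n ^ 2 ≤ C := fun n => by
    have := ha (n+1)
    rw [Finset.sum_range_succ] at this
    have h2 : 0 ≤ ∑ n ∈ Finset.range n, a n ^ 2 := Finset.sum_nonneg fun i _ => sq_nonneg _
    linarith
  have h2 : ∀ n, |a n| ≤ C + 1 := fun n => by
    have := h1 n
    rw [← sq_abs] at this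
    nlinarith [sq_nonneg (|a n| - 1), sq_nonneg (|a n|)]
  refine Summable.of_norm_bounded (g := fun n => (C+1) * |x| ^ n)
    ((summable_geometric_of_lt_one (abs_nonneg x) hx).mul_left _) fun n => ?_
  rw [norm_mul, norm_pow, Real.norm_eq_abs, Real.norm_eq_abs]
  gcongr
  exact h2 n

lemma bl_step (w : ℝ) (hw : |w| < 1) (a : ℕ → ℝ)
    (ha : ∀ N, ∑ n ∈ Finset.range N, a n ^ 2 ≤ 1) :
    ∃ h : ℕ → ℝ, (∀ N, ∑ n ∈ Finset.range N, h n ^ 2 ≤ 1) ∧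
      ∀ x : ℝ, |x| < 1 → ∑' n, h n * x ^ n = (w - x) / (1 - w * x) * ∑' n, a n * x ^ n := by
  let u : ℕ → ℝ := fun n => Nat.rec (a 0) (fun n v => a (n+1) + w * v) n
  have hu0 : u 0 = a 0 := rfl
  have hus : ∀ n, u (n+1) = a (n+1) + w * u n := fun n => rfl
  let h : ℕ → ℝ := fun n => Nat.casesOn n (w * u 0) (fun n => w * u (n+1) - u n)
  have hh0 : h 0 = w * u 0 := rfl
  have hhs : ∀ n, h (n+1) = w * u (n+1) - u n := fun n => rfl
  have hw2 : w ^ 2 < 1 := by rw [← sq_abs]; nlinarith [abs_nonneg w]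
  have key : ∀ N, ∑ n ∈ Finset.range (N+1), h n ^ 2 =
      ∑ n ∈ Finset.range (N+1), a n ^ 2 - (1 - w^2) * u N ^ 2 := by
    intro N
    induction N with
    | zero => simp [hh0, hu0]; ring
    | succ N ih =>
      rw [Finset.sum_range_succ, ih, Finset.sum_range_succ _ (N+1), hhs]
      have : a (N+1) = u (N+1) - w * u N := by rw [hus]; ring
      rw [this]; ring
  have hb : ∀ N, ∑ n ∈ Finset.range N, h n ^ 2 ≤ 1 := by
    intro N
    cases N with
    | zero => simp
    | succ N =>
      rw [key]
      have := ha (N+1)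
      nlinarith [mul_nonneg (sub_nonneg.2 hw2.le) (sq_nonneg (u N))]
  refine ⟨h, hb, fun x hx => ?_⟩
  have sa := summable_of_sq_bdd a 1 ha x hx
  have sh := summable_of_sq_bdd h 1 hb x hx
  have hrec : ∀ n, h (n+1) = w * h n + w * a (n+1) - a n := by
    intro n
    cases n with
    | zero => rw [hhs, hh0, hus, hu0]; ring
    | succ n => rw [hhs, hhs, hus, hus]; ring
  have hne : 1 - w * x ≠ 0 := by
    have : |w * x| < 1 := by
      rw [abs_mul]; nlinarith [abs_nonneg w, abs_nonneg x]
    have := (abs_lt.1 this).2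
    linarith
  have e1 := sh.tsum_eq_zero_add
  have e2 := sa.tsum_eq_zero_add
  have sa1 := (summable_nat_add_iff 1).2 sa
  have e3 : ∑' n, h (n+1) * x ^ (n+1) =
      w * x * ∑' n, h n * x ^ n + w * ∑' n, a (n+1) * x ^ (n+1) - x * ∑' n, a n * x ^ n := by
    rw [← tsum_mul_left, ← tsum_mul_left, ← tsum_mul_left,
      ← (sh.mul_left _).tsum_add (sa1.mul_left _),
      ← ((sh.mul_left _).add (sa1.mul_left _)).tsum_sub (sa.mul_left _)]
    congr 1; ext n; rw [hrec]; ring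
  rw [div_mul_eq_mul_div, eq_div_iff hne]
  simp only [pow_zero, mul_one] at e1 e2
  rw [hh0, hu0] at e1
  linear_combination e1 + e3 - w * e2

lemma bl_prod (w : ℕ → ℝ) (hw : ∀ i, |w i| < 1) (s : Finset ℕ) :
    ∃ h : ℕ → ℝ, (∀ N, ∑ n ∈ Finset.range N, h n ^ 2 ≤ 1) ∧
      ∀ x : ℝ, |x| < 1 → ∑' n, h n * x ^ n = ∏ i ∈ s, (w i - x) / (1 - w i * x) := by
  induction s using Finset.induction_on with
  | empty =>
    refine ⟨fun n => if n = 0 then 1 else 0, fun N => ?_, fun x hx => ?_⟩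
    · cases N <;> simp [Finset.sum_ite_eq']
    · simp
  | insert i s hi ih =>
    obtain ⟨a, ha, hx⟩ := ih
    obtain ⟨h, hb, hh⟩ := bl_step (w i) (hw i) a ha
    refine ⟨h, hb, fun x hx' => ?_⟩
    rw [hh x hx', hx x hx', Finset.prod_insert hi]

lemma sum_dist (L : ℕ → ℝ) (hL : ∀ j, 0 ≤ L j) (m k : ℕ) (hk : k < m) :
    ∑ i ∈ (Finset.range m).erase k, L (Nat.dist i k) ≤ 2 * ∑ j ∈ Finset.range m, L (j+1) := by
  have e : (Finset.range m).erase k = Finset.range k ∪ Finset.Ico (k+1) m := by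
    ext i; simp; omega
  rw [e, Finset.sum_union (by
    rw [Finset.disjoint_left]; intro i; simp; omega), two_mul]
  apply add_le_add
  · rw [← Finset.sum_range_reflect]
    calc _ = ∑ j ∈ Finset.range k, L (j+1) := by
          apply Finset.sum_congr rfl
          intro j hj
          have := Finset.mem_range.1 hj
          congr 1
          rw [Nat.dist]; omega
      _ ≤ _ := Finset.sum_le_sum_of_subset_of_nonneg
          (Finset.range_subset_range.2 hk.le) fun _ _ _ => hL _
  · rw [Finset.sum_Ico_eq_sum_range]
    calc _ = ∑ j ∈ Finset.range (m - (k+1)), L (j+1) := by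
          apply Finset.sum_congr rfl
          intro j hj
          congr 1
          rw [Nat.dist]; omega
      _ ≤ _ := Finset.sum_le_sum_of_subset_of_nonneg
          (Finset.range_subset_range.2 (by omega)) fun _ _ _ => hL _

/-- sum of `-log(1-e^{-jt})`. -/
lemma log_sum (t : ℝ) (ht : 0 < t) (m : ℕ) :
    ∑ j ∈ Finset.range m, (-Real.log (1 - Real.exp (-t * ((j+1 : ℕ) : ℝ)))) ≤
      (∑' k : ℕ, 1 / ((k:ℝ)+1)^2) / t := by
  have hlt : ∀ j : ℕ, |Real.exp (-t * ((j+1 : ℕ) : ℝ))| < 1 := fun j => by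
    rw [abs_of_pos (Real.exp_pos _), Real.exp_lt_one_iff]
    push_cast
    have : 0 < t * ((j:ℝ)+1) := by positivity
    linarith
  have H : ∀ j : ℕ, HasSum (fun k : ℕ => Real.exp (-t * ((j+1 : ℕ) : ℝ)) ^ (k+1) / ((k:ℝ)+1))
      (-Real.log (1 - Real.exp (-t * ((j+1 : ℕ) : ℝ)))) :=
    fun j => Real.hasSum_pow_div_log_of_abs_lt_one (hlt j)
  have H2 := hasSum_sum (s := Finset.range m) fun j _ => H j
  have S : Summable (fun k : ℕ => 1 / ((k:ℝ)+1)^2) := by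
    have := (summable_nat_add_iff 1).2 (Real.summable_one_div_nat_pow.2 (show 1 < 2 by norm_num))
    simpa using this
  rw [← tsum_div_const]
  refine hasSum_le (fun k => ?_) H2 (S.div_const t).hasSum
  set q := Real.exp (-t * ((k:ℝ)+1)) with hq
  have hkt : 0 < t * ((k:ℝ)+1) := by positivity
  have hq1 : q < 1 := by rw [hq, Real.exp_lt_one_iff]; linarith
  have hq0 : 0 < q := Real.exp_pos _
  have e : ∀ j : ℕ, Real.exp (-t * ((j+1 : ℕ) : ℝ)) ^ (k+1) = q * q ^ j := fun j => by
    rw [hq, ← Real.exp_nat_mul, ← Real.exp_nat_mul, ← Real.exp_add]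
    congr 1; push_cast; ring
  simp_rw [e]
  rw [← Finset.sum_div, ← Finset.mul_sum]
  have g : ∑ j ∈ Finset.range m, q ^ j ≤ (1 - q)⁻¹ := by
    rw [← tsum_geometric_of_lt_one hq0.le hq1]
    exact (summable_geometric_of_lt_one hq0.le hq1).sum_le_tsum _ fun _ _ => by positivity
  have g2 : q * (1-q)⁻¹ ≤ 1 / (t * ((k:ℝ)+1)) := by
    rw [← div_eq_mul_inv, div_le_div_iff₀ (by linarith) hkt]
    have h1 : t * ((k:ℝ)+1) + 1 ≤ q⁻¹ := by
      rw [hq, ← Real.exp_neg]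
      have := Real.add_one_le_exp (-(-t * ((k:ℝ)+1)))
      linarith
    have := mul_le_mul_of_nonneg_left h1 hq0.le
    rw [mul_inv_cancel₀ hq0.ne'] at this
    linarith
  have g3 : (q * ∑ j ∈ Finset.range m, q ^ j) / ((k:ℝ)+1) ≤
      (1 / (t * ((k:ℝ)+1))) / ((k:ℝ)+1) := by
    gcongr
    exact (mul_le_mul_of_nonneg_left g hq0.le).trans g2
  refine g3.trans (le_of_eq ?_)
  field_simp

def pt (t : ℝ) (i : ℕ) : ℝ := (Real.exp (t * i) - 1) / (Real.exp (t * i) + 1)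

lemma pt_abs (t : ℝ) (i : ℕ) : |pt t i| < 1 := by
  have h := Real.exp_pos (t * i)
  rw [pt, abs_lt]
  constructor
  · rw [lt_div_iff₀ (by linarith)]; linarith
  · rw [div_lt_one (by linarith)]; linarith

lemma pt_diff (t : ℝ) (i k : ℕ) : (pt t i - pt t k) / (1 - pt t i * pt t k) =
    (Real.exp (t * i) - Real.exp (t * k)) / (Real.exp (t * i) + Real.exp (t * k)) := by
  have h1 := Real.exp_pos (t * i)
  have h2 := Real.exp_pos (t * k)
  unfold pt
  set P := Real.exp (t * i)
  set Q := Real.exp (t * k)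
  have e : 1 - (P-1)/(P+1) * ((Q-1)/(Q+1)) = 2 * (P + Q) / ((P+1)*(Q+1)) := by
    field_simp; ring
  rw [e]
  field_simp
  ring

lemma pt_diff_lb (t : ℝ) (ht : 0 < t) (i k : ℕ) (hik : i ≠ k) :
    Real.exp (-(2 * (-Real.log (1 - Real.exp (-t * (Nat.dist i k : ℕ)))))) ≤
      |(pt t i - pt t k) / (1 - pt t i * pt t k)| := by
  rw [pt_diff]
  wlog h : k < i generalizing i k
  · have := this k i hik.symm (by omega)
    rw [Nat.dist_comm, add_comm (Real.exp (t * i)), ← neg_sub (Real.exp (t * k)), neg_div, abs_neg]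
    exact this
  have hd : ((Nat.dist i k : ℕ) : ℝ) = i - k := by
    rw [Nat.dist_eq_sub_of_le_right h.le, Nat.cast_sub h.le]
  rw [hd]
  have h1 := Real.exp_pos (t * i)
  set x := Real.exp (-t * (i - k)) with hx
  have hx0 : 0 < x := Real.exp_pos _
  have hx1 : x < 1 := by
    rw [hx, Real.exp_lt_one_iff]
    have : (k:ℝ) < i := by exact_mod_cast h
    nlinarith
  have e : Real.exp (t * k) = Real.exp (t * i) * x := by
    rw [hx, ← Real.exp_add]; congr 1; ring
  have e2 : (Real.exp (t * i) - Real.exp (t * k)) / (Real.exp (t * i) + Real.exp (t * k)) =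
      (1 - x) / (1 + x) := by
    rw [e]; field_simp
  have e3 : Real.exp (-(2 * (-Real.log (1 - x)))) = (1 - x)^2 := by
    rw [show -(2 * (-Real.log (1 - x))) = Real.log (1-x) + Real.log (1-x) by ring,
      Real.exp_add, Real.exp_log (by linarith)]; ring
  rw [e2, e3, abs_of_nonneg (div_nonneg (by linarith) (by linarith)), le_div_iff₀ (by linarith)]
  nlinarith [mul_nonneg (sub_nonneg.2 hx1.le) (sq_nonneg x)]

def SS : ℝ := ∑' k : ℕ, 1 / ((k:ℝ)+1)^2

lemma SS_nonneg : 0 ≤ SS := tsum_nonneg fun _ => by positivity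

lemma interp (t : ℝ) (ht : 0 < t) (m k : ℕ) (hk : k < m) :
    ∃ f : ℕ → ℝ, (∀ N, ∑ n ∈ Finset.range N, f n ^ 2 ≤ Real.exp (8 * SS / t)) ∧
      ∀ i < m, ∑' n, f n * pt t i ^ n = if i = k then 1 else 0 := by
  obtain ⟨h, hb, hh⟩ := bl_prod (pt t) (pt_abs t) ((Finset.range m).erase k)
  set B := ∏ i ∈ (Finset.range m).erase k, (pt t i - pt t k) / (1 - pt t i * pt t k) with hB
  have lb : Real.exp (-(4 * SS / t)) ≤ |B| := by
    rw [hB, Finset.abs_prod]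
    calc _ ≤ ∏ i ∈ (Finset.range m).erase k,
          Real.exp (-(2 * (-Real.log (1 - Real.exp (-t * (Nat.dist i k : ℕ)))))) := by
          rw [← Real.exp_sum, Real.exp_le_exp, Finset.sum_neg_distrib, ← Finset.mul_sum]
          have s1 := sum_dist (fun j => -Real.log (1 - Real.exp (-t * (j : ℕ)))) (fun j => by
            rw [neg_nonneg]
            apply Real.log_nonpos
            · rw [sub_nonneg, Real.exp_le_one_iff]
              have : 0 ≤ t * (j:ℝ) := by positivity
              linarith
            · linarith [Real.exp_pos (-t * (j : ℕ))]) m k hk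
          have s2 := log_sum t ht m
          rw [← SS] at s2
          have : 4 * SS / t = 2 * (2 * (SS / t)) := by ring
          rw [this]
          linarith
      _ ≤ _ := Finset.prod_le_prod (fun _ _ => (Real.exp_pos _).le) fun i hi =>
          pt_diff_lb t ht i k (Finset.ne_of_mem_erase hi)
  have hB0 : B ≠ 0 := abs_pos.1 ((Real.exp_pos _).trans_le lb)
  refine ⟨fun n => h n / B, fun N => ?_, fun i hi => ?_⟩
  · simp_rw [div_pow]
    rw [← Finset.sum_div, div_le_iff₀ (by positivity)]
    refine (hb N).trans ?_
    rw [← sq_abs B]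
    calc (1:ℝ) = Real.exp (8 * SS / t) * Real.exp (-(4 * SS / t))^2 := by
          rw [← Real.exp_nat_mul, ← Real.exp_add, eq_comm, Real.exp_eq_one_iff]
          push_cast; ring
      _ ≤ _ := by gcongr
  · simp_rw [div_mul_eq_mul_div]
    rw [tsum_div_const, hh _ (pt_abs t i)]
    split_ifs with hik
    · subst hik; exact div_self hB0
    · rw [Finset.prod_eq_zero (i := i) (by simp [hi, hik]) (by simp), zero_div]

lemma lens_pt (θ : ℝ) (t : ℝ) (i : ℕ) : lensMap θ (pt t i : ℝ) = (pt (θ * t) i : ℝ) := by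
  have h := Real.exp_pos (t * i)
  set q := Real.exp (t * i) with hq
  have h1 : (1 : ℂ) + (pt t i : ℝ) = ((q * (2 / (q+1)) : ℝ) : ℂ) := by
    rw [pt, ← hq, ← Complex.ofReal_one, ← Complex.ofReal_add]
    congr 1; field_simp; ring
  have h2 : (1 : ℂ) - (pt t i : ℝ) = (((2 / (q+1)) : ℝ) : ℂ) := by
    rw [pt, ← hq, ← Complex.ofReal_one, ← Complex.ofReal_sub]
    congr 1; field_simp; ring
  have hc : 0 < 2 / (q+1) := by positivity
  rw [lensMap, h1, h2, ← Complex.ofReal_cpow (by positivity), ← Complex.ofReal_cpow hc.le,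
    Real.mul_rpow h.le hc.le, ← Complex.ofReal_sub, ← Complex.ofReal_add, ← Complex.ofReal_div]
  congr 1
  have hc' : 0 < (2 / (q+1)) ^ θ := Real.rpow_pos_of_pos hc _
  have : q ^ θ = Real.exp (θ * t * i) := by
    rw [hq, ← Real.exp_mul]; congr 1; ring
  rw [this, pt]
  set c := (2 / (q+1)) ^ θ
  have := Real.exp_pos (θ * t * i)
  field_simp

lemma prod_sum_bound {d : ℕ} (a : Fin d → ℕ → ℝ) (C : ℝ)
    (ha : ∀ j N, ∑ n ∈ Finset.range N, a j n ^ 2 ≤ C) (s : Finset (Fin d → ℕ)) :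
    ∑ α ∈ s, (∏ j, a j (α j)) ^ 2 ≤ C ^ d := by
  obtain ⟨N, hN⟩ : ∃ N, s ⊆ Fintype.piFinset (fun _ : Fin d => Finset.range N) := by
    refine ⟨(s.sup fun α => Finset.univ.sup α) + 1, fun α hα => ?_⟩
    rw [Fintype.mem_piFinset]
    intro j
    rw [Finset.mem_range, Nat.lt_succ_iff]
    exact (Finset.le_sup (f := α) (Finset.mem_univ j)).trans
      (Finset.le_sup (f := fun α : Fin d → ℕ => Finset.univ.sup α) hα)
  calc _ ≤ ∑ α ∈ Fintype.piFinset (fun _ : Fin d => Finset.range N), (∏ j, a j (α j)) ^ 2 :=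
        Finset.sum_le_sum_of_subset_of_nonneg hN fun _ _ _ => sq_nonneg _
    _ = ∏ j, ∑ n ∈ Finset.range N, a j n ^ 2 := by
        rw [Finset.prod_univ_sum]
        simp_rw [Finset.prod_pow]
    _ ≤ ∏ _j : Fin d, C := Finset.prod_le_prod
        (fun _ _ => Finset.sum_nonneg fun _ _ => sq_nonneg _) fun j _ => ha j N
    _ = C ^ d := by simp

lemma exists_vec {d : ℕ} (a : Fin d → ℕ → ℝ) (C : ℝ) (hC : 0 ≤ C)
    (ha : ∀ j N, ∑ n ∈ Finset.range N, a j n ^ 2 ≤ C) :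
    ∃ v : H2 d, (∀ α, v α = ((∏ j, a j (α j) : ℝ) : ℂ)) ∧ ‖v‖ ≤ Real.sqrt (C ^ d) := by
  have hb : ∀ s : Finset (Fin d → ℕ),
      ∑ α ∈ s, ‖((∏ j, a j (α j) : ℝ) : ℂ)‖ ^ (2 : ℝ≥0∞).toReal ≤ C ^ d := by
    intro s
    refine le_trans (le_of_eq ?_) (prod_sum_bound a C ha s)
    apply Finset.sum_congr rfl
    intro α _
    rw [Complex.norm_real, Real.norm_eq_abs]
    simp
  have hm : Memℓp (fun α : Fin d → ℕ => ((∏ j, a j (α j) : ℝ) : ℂ)) 2 := memℓp_gen' hb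
  refine ⟨⟨_, hm⟩, fun α => rfl, ?_⟩
  refine lp.norm_le_of_forall_sum_le (by simp) (Real.sqrt_nonneg _) fun s => ?_
  refine (hb s).trans (le_of_eq ?_)
  simp [Real.sq_sqrt (pow_nonneg hC d)]

lemma tsum_prod_eval {d : ℕ} (a : Fin d → ℕ → ℝ) (x : Fin d → ℝ)
    (hs : ∀ j, Summable fun n => a j n * x j ^ n)
    (hsum : Summable (fun α : Fin d → ℕ =>
      ((∏ j, a j (α j) : ℝ) : ℂ) * ∏ j, ((x j : ℝ) : ℂ) ^ (α j))) :
    ∑' α : Fin d → ℕ, ((∏ j, a j (α j) : ℝ) : ℂ) * ∏ j, ((x j : ℝ) : ℂ) ^ (α j) =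
      ((∏ j, ∑' n, a j n * x j ^ n : ℝ) : ℂ) := by
  have t1 : Filter.Tendsto (fun N => Fintype.piFinset (fun _ : Fin d => Finset.range N))
      Filter.atTop Filter.atTop := by
    apply Filter.tendsto_atTop_finset_of_monotone
    · intro M N h
      exact Fintype.piFinset_subset _ _ fun _ => Finset.range_subset_range.2 h
    · intro α
      refine ⟨Finset.univ.sup α + 1, ?_⟩
      rw [Fintype.mem_piFinset]
      intro j
      rw [Finset.mem_range, Nat.lt_succ_iff]
      exact Finset.le_sup (f := α) (Finset.mem_univ j)
  have t2 := Filter.Tendsto.comp hsum.hasSum t1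
  refine tendsto_nhds_unique t2 ?_
  have t3 : Filter.Tendsto (fun N => ∏ j, ∑ n ∈ Finset.range N, a j n * x j ^ n) Filter.atTop
      (nhds (∏ j, ∑' n, a j n * x j ^ n)) :=
    tendsto_finsetProd _ fun j _ => (hs j).hasSum.tendsto_sum_nat
  refine ((Complex.continuous_ofReal.tendsto _).comp t3).congr fun N => ?_
  simp only [Function.comp]
  rw [Finset.prod_univ_sum]
  push_cast
  simp_rw [Finset.prod_mul_distrib]

lemma eval_bound {d : ℕ} (g : H2 d) (x : Fin d → ℝ) (C : ℝ) (hx : ∀ j, |x j| < 1)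
    (hC : ∀ j, 1 / (1 - x j ^ 2) ≤ C) (hC0 : 0 ≤ C) :
    ‖∑' α : Fin d → ℕ, g α * ∏ j, ((x j : ℝ) : ℂ) ^ (α j)‖ ≤ Real.sqrt (C ^ d) * ‖g‖ := by
  obtain ⟨v, hv, hn⟩ := exists_vec (fun j n => x j ^ n) C hC0 (fun j N => by
    refine le_trans ?_ (hC j)
    have h1 : x j ^ 2 < 1 := by rw [← sq_abs]; nlinarith [abs_nonneg (x j), hx j]
    have h0 := sq_nonneg (x j)
    simp_rw [← pow_mul, mul_comm _ 2, pow_mul]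
    rw [one_div, ← tsum_geometric_of_lt_one h0 h1]
    exact (summable_geometric_of_lt_one h0 h1).sum_le_tsum _ fun _ _ => by positivity)
  have e : ∑' α : Fin d → ℕ, g α * ∏ j, ((x j : ℝ) : ℂ) ^ (α j) = inner ℂ v g := by
    rw [lp.inner_eq_tsum]
    congr 1; ext α
    rw [hv, RCLike.inner_apply, Complex.conj_ofReal]
    push_cast
    rfl
  rw [e]
  exact (norm_inner_le_norm _ _).trans (by gcongr)

lemma core (d : ℕ) (θ : ℝ) (hθ0 : 0 < θ)
    (T : H2 d →L[ℂ] H2 d) (hT : IsCompositionOperator (multiLens d θ) T)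
    (p : ℕ) (hp : 1 ≤ p) (R : H2 d →L[ℂ] H2 d)
    (hR : LinearMap.rank (R : H2 d →ₗ[ℂ] H2 d) < ((p ^ (2 * d) : ℕ) : Cardinal)) :
    1 ≤ Real.sqrt (Real.exp (2 * p) ^ d) *
      (‖T - R‖ * ((p:ℝ) ^ (2 * d) * Real.sqrt (Real.exp (4 * SS * p / θ) ^ d))) := by
  have hp0 : (0:ℝ) < p := by exact_mod_cast hp
  set t : ℝ := 2 / p with ht
  have ht0 : 0 < t := by positivity
  have htt : 0 < θ * t := by positivity
  have hF : 8 * SS / (θ * t) = 4 * SS * p / θ := by rw [ht]; field_simp; ring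
  set F := Real.exp (4 * SS * p / θ) with hFd
  have hint := fun k : Fin (p^2) => interp (θ * t) htt (p^2) k k.2
  rw [hF] at hint
  choose f hf1 hf2 using hint
  have hv := fun β : Fin d → Fin (p^2) =>
    exists_vec (fun j n => f (β j) n) F (Real.exp_pos _).le (fun j N => hf1 (β j) N)
  choose v hv1 hv2 using hv
  let B : ((Fin d → Fin (p^2)) → ℂ) →ₗ[ℂ] H2 d := Fintype.linearCombination ℂ v
  have hB : ∀ c, B c = ∑ β, c β • v β := fun c => Fintype.linearCombination_apply ℂ v c
  have hker : ∃ c, c ≠ 0 ∧ R (B c) = 0 := by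
    by_contra! hcon
    have hinj : Function.Injective ((R : H2 d →ₗ[ℂ] H2 d) ∘ₗ B) := by
      rw [← LinearMap.ker_eq_bot, LinearMap.ker_eq_bot']
      intro c hc
      by_contra h
      exact hcon c h hc
    have h1 := LinearMap.rank_comp_le_left B (R : H2 d →ₗ[ℂ] H2 d)
    have h2 : LinearMap.rank ((R : H2 d →ₗ[ℂ] H2 d) ∘ₗ B) = ((p ^ (2 * d) : ℕ) : Cardinal) := by
      have := rank_range_of_injective _ hinj
      rw [LinearMap.rank, this]
      simp [pow_mul]
    rw [h2] at h1
    exact absurd hR (not_lt.2 h1)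
  obtain ⟨c, hc0, hRc⟩ := hker
  have : Nonempty (Fin d → Fin (p^2)) := by
    by_contra h
    rw [not_nonempty_iff] at h
    exact hc0 (Subsingleton.elim _ _)
  obtain ⟨β₀, hβ⟩ := Finite.exists_max (fun β => ‖c β‖)
  have hcpos : 0 < ‖c β₀‖ := by
    rw [norm_pos_iff]
    intro h
    apply hc0
    ext β
    have := hβ β
    simp only [h, norm_zero] at this
    simpa using this
  let x : Fin d → ℝ := fun j => pt t (β₀ j)
  let z : Fin d → ℂ := fun j => ((x j : ℝ) : ℂ)
  have hx : ∀ j, |x j| < 1 := fun j => pt_abs _ _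
  have hz : z ∈ polydisk d := fun j => by
    simp only [z, Complex.norm_real, Real.norm_eq_abs]; exact hx j
  let y : Fin d → ℝ := fun j => pt (θ * t) (β₀ j)
  have hφ : multiLens d θ z = fun j => ((y j : ℝ) : ℂ) := by
    ext j; exact lens_pt θ t _
  -- value of each basis vector
  have hval : ∀ β, HasSum (fun α : Fin d → ℕ => v β α * ∏ j, (multiLens d θ z j) ^ (α j))
      (if β = β₀ then 1 else 0) := by
    intro β
    have hs := (hT (v β) z hz).1.of_norm
    have e : ∑' α : Fin d → ℕ, v β α * ∏ j, (multiLens d θ z j) ^ (α j)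
        = if β = β₀ then 1 else 0 := by
      simp_rw [hv1, hφ] at hs ⊢
      rw [tsum_prod_eval (fun j n => f (β j) n) y
        (fun j => summable_of_sq_bdd _ _ (hf1 (β j)) _ (pt_abs _ _)) hs]
      have : ∀ j, ∑' n, f (β j) n * y j ^ n = if β₀ j = β j then 1 else 0 := fun j => by
        rw [hf2 (β j) (β₀ j) (β₀ j).2]
        simp only [Fin.ext_iff]
      simp_rw [this]
      split_ifs with h
      · subst h; simp
      · obtain ⟨j, hj⟩ := Function.ne_iff.1 h
        rw [Finset.prod_eq_zero (Finset.mem_univ j) (by rw [if_neg (Ne.symm hj)])]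
        simp
    rw [← e]
    exact hs.hasSum
  have hu : ∑' α : Fin d → ℕ, (B c) α * ∏ j, (multiLens d θ z j) ^ (α j) = c β₀ := by
    have := hasSum_sum (s := Finset.univ) fun β _ => (hval β).mul_left (c β)
    have e : ∀ α, (B c) α = ∑ β, c β * v β α := fun α => by
      rw [hB, lp.coeFn_sum, Finset.sum_apply]
      rfl
    simp_rw [e, Finset.sum_mul, mul_assoc]
    rw [this.tsum_eq]
    simp
  have hTu := (hT (B c) z hz).2.2
  rw [hu] at hTu
  have hTR : (T - R) (B c) = T (B c) := by
    rw [sub_apply, hRc, sub_zero]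
  have hE : ∀ j, 1 / (1 - x j ^ 2) ≤ Real.exp (2 * p) := by
    intro j
    have hle : t * ((β₀ j : ℕ) : ℝ) ≤ 2 * p := by
      have : ((β₀ j : ℕ) : ℝ) ≤ (p:ℝ)^2 := by exact_mod_cast (β₀ j).2.le
      calc t * ((β₀ j : ℕ) : ℝ) ≤ t * (p:ℝ)^2 := by gcongr
        _ = 2 * p := by rw [ht]; field_simp
    refine le_trans ?_ (Real.exp_le_exp.2 hle)
    simp only [x, pt]
    have hq : 1 ≤ Real.exp (t * ((β₀ j : ℕ) : ℝ)) := Real.one_le_exp (by positivity)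
    set q := Real.exp (t * ((β₀ j : ℕ) : ℝ))
    have e : 1 - ((q - 1)/(q+1))^2 = 4 * q / (q+1)^2 := by field_simp; ring
    rw [e, one_div_div, div_le_iff₀ (by positivity)]
    nlinarith
  have hev := eval_bound (T (B c)) x (Real.exp (2 * p)) hx hE (Real.exp_pos _).le
  rw [← hTu, ← hTR] at hev
  have hBn : ‖B c‖ ≤ (p:ℝ) ^ (2 * d) * (‖c β₀‖ * Real.sqrt (F ^ d)) := by
    rw [hB]
    refine (norm_sum_le _ _).trans ?_
    calc _ ≤ ∑ _β : Fin d → Fin (p^2), ‖c β₀‖ * Real.sqrt (F ^ d) := by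
          apply Finset.sum_le_sum
          intro β _
          rw [norm_smul]
          exact mul_le_mul (hβ β) (hv2 β) (norm_nonneg _) (norm_nonneg _)
      _ = _ := by simp [pow_mul]
  have h3 : ‖c β₀‖ * 1 ≤ ‖c β₀‖ * (Real.sqrt (Real.exp (2 * p) ^ d) *
      (‖T - R‖ * ((p:ℝ) ^ (2 * d) * Real.sqrt (F ^ d)))) := by
    rw [mul_one]
    calc ‖c β₀‖ ≤ _ := hev
      _ ≤ Real.sqrt (Real.exp (2 * p) ^ d) * (‖T - R‖ *
          ((p:ℝ) ^ (2 * d) * (‖c β₀‖ * Real.sqrt (F ^ d)))) := by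
          gcongr
          exact ((T - R).le_opNorm _).trans (by gcongr)
      _ = _ := by ring
  exact le_of_mul_le_mul_left h3 hcpos

/-- Lower bound for the approximation numbers of the composition operator of a multi-lens
map: `a_n(C_{φ_θ}) ≥ a' · exp(−b' n^{1/(2d)})`. -/
theorem lower_bound_approx_numbers_multilens
    (d : ℕ) (hd : 1 ≤ d) (θ : ℝ) (hθ0 : 0 < θ) (hθ1 : θ < 1)
    (T : H2 d →L[ℂ] H2 d) (hT : IsCompositionOperator (multiLens d θ) T) :
    ∃ a' b' : ℝ, 0 < a' ∧ 0 < b' ∧ ∀ n : ℕ, 1 ≤ n →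
      a' * Real.exp (-b' * (n : ℝ) ^ ((1 : ℝ) / (2 * d))) ≤ approxNumber T n := by
  set A : ℝ := 3 * d + 2 * SS * d / θ with hA
  have hd0 : (0:ℝ) < d := by exact_mod_cast hd
  have hS := SS_nonneg
  have hA0 : 0 < A := by positivity
  refine ⟨Real.exp (-A), A, Real.exp_pos _, hA0, fun n hn => ?_⟩
  set x : ℝ := (n:ℝ) ^ ((1 : ℝ) / (2 * d)) with hx
  have hn1 : (1:ℝ) ≤ n := by exact_mod_cast hn
  have hx1 : 1 ≤ x := Real.one_le_rpow hn1 (by positivity)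
  set p := ⌈x⌉₊ with hp
  have hp1 : 1 ≤ p := Nat.one_le_iff_ne_zero.2 (Nat.ceil_pos.2 (by linarith)).ne'
  have hxp : x ≤ p := Nat.le_ceil x
  have hpx : (p:ℝ) ≤ x + 1 := (Nat.ceil_lt_add_one (by linarith)).le
  have hnp : n ≤ p ^ (2 * d) := by
    have : (n:ℝ) ≤ (p:ℝ) ^ (2 * d) := by
      calc (n:ℝ) = x ^ (2 * d) := by
            rw [hx, ← Real.rpow_natCast, ← Real.rpow_mul (by linarith)]
            push_cast
            rw [one_div, inv_mul_cancel₀ (by positivity), Real.rpow_one]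
        _ ≤ _ := by gcongr
    exact_mod_cast this
  have hz : LinearMap.rank ((0 : H2 d →L[ℂ] H2 d) : H2 d →ₗ[ℂ] H2 d) < (n : Cardinal) := by
    rw [ContinuousLinearMap.toLinearMap_zero, LinearMap.rank_zero]
    exact_mod_cast hn
  refine le_csInf ⟨_, 0, hz, rfl⟩ ?_
  rintro _ ⟨R, hR, rfl⟩
  have hc := core d θ hθ0 T hT p hp1 R (hR.trans_le (by exact_mod_cast hnp))
  have s1 : Real.sqrt (Real.exp (2 * p) ^ d) = Real.exp (d * p) := by
    rw [Real.sqrt_eq_iff_mul_self_eq (by positivity) (by positivity), ← Real.exp_nat_mul,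
      ← Real.exp_add]
    congr 1; ring
  have s2 : Real.sqrt (Real.exp (4 * SS * p / θ) ^ d) = Real.exp (2 * SS * d / θ * p) := by
    rw [Real.sqrt_eq_iff_mul_self_eq (by positivity) (by positivity), ← Real.exp_nat_mul,
      ← Real.exp_add]
    congr 1; ring
  have s3 : (p:ℝ) ^ (2 * d) ≤ Real.exp (2 * d * p) := by
    have : (p:ℝ) ≤ Real.exp p := by linarith [Real.add_one_le_exp (p:ℝ)]
    calc (p:ℝ) ^ (2 * d) ≤ Real.exp p ^ (2 * d) := by gcongr
      _ = _ := by rw [← Real.exp_nat_mul]; push_cast; rfl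
  rw [s1, s2] at hc
  have h4 : 1 ≤ Real.exp (A * p) * ‖T - R‖ := by
    calc (1:ℝ) ≤ _ := hc
      _ ≤ Real.exp (d * p) * (‖T - R‖ * (Real.exp (2 * d * p) *
          Real.exp (2 * SS * d / θ * p))) := by gcongr
      _ = (Real.exp (d * p) * Real.exp (2 * d * p) * Real.exp (2 * SS * d / θ * p))
          * ‖T - R‖ := by ring
      _ = _ := by
        rw [← Real.exp_add, ← Real.exp_add, hA]
        congr 2; ring
  calc Real.exp (-A) * Real.exp (-A * x) = Real.exp (-(A * (x+1))) := by
        rw [← Real.exp_add]; congr 1; ring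
    _ ≤ Real.exp (-(A * p)) := by
        rw [Real.exp_le_exp]
        have := mul_le_mul_of_nonneg_left hpx hA0.le
        linarith
    _ = Real.exp (-(A * p)) * 1 := by ring
    _ ≤ Real.exp (-(A * p)) * (Real.exp (A * p) * ‖T - R‖) := by gcongr
    _ = ‖T - R‖ := by rw [← mul_assoc, ← Real.exp_add]; simp
end
end

section
/- Let (a_n)_{n≥1} be a non-increasing sequence of non-negative real numbers and let (λ_n)_{n≥1} be a sequence of complex numbers with (|λ_n|)_{n≥1} non-increasing, satisfying Weyl's inequality |λ_n| ≤ (a_1 a_2 ⋯ a_n)^{1/n} for every n ≥ 1. Then |λ_{2n}|² ≤ a_1 · a_n for every n ≥ 1. -/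
/-- Sequence form of the lemma: if `(a_n)` is non-increasing and non-negative, `(|λ_n|)` is
non-increasing, and Weyl's inequality `|λ_n| ≤ (a_1 ⋯ a_n)^{1/n}` holds, then
`|λ_{2n}|² ≤ a_1 · a_n`. -/
theorem weyl_consequence (a : ℕ → ℝ) (l : ℕ → ℂ)
    (ha_nonneg : ∀ n, 1 ≤ n → 0 ≤ a n)
    (ha_mono : ∀ n, 1 ≤ n → a (n + 1) ≤ a n)
    (hl_mono : ∀ n, 1 ≤ n → ‖l (n + 1)‖ ≤ ‖l n‖)
    (hweyl : ∀ n, 1 ≤ n →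
      ‖l n‖ ≤ (∏ k ∈ Finset.Icc 1 n, a k) ^ ((1 : ℝ) / n)) :
    ∀ n, 1 ≤ n → ‖l (2 * n)‖ ^ 2 ≤ a 1 * a n := by
  intro n hn
  have hanti : ∀ i, 1 ≤ i → ∀ j, a (i + j) ≤ a i := by
    intro i hi j
    induction j with
    | zero => simp
    | succ j ih => exact (ha_mono (i + j) (by omega)).trans ih
  have hP0 : ∀ m, 0 ≤ ∏ k ∈ Finset.Icc 1 m, a k := fun m =>
    Finset.prod_nonneg fun k hk => ha_nonneg k (Finset.mem_Icc.mp hk).1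
  have h1 : ∀ m, ∏ k ∈ Finset.Icc 1 m, a k ≤ a 1 ^ m := by
    intro m
    induction m with
    | zero => simp
    | succ m ih =>
      rw [Finset.prod_Icc_succ_top (by omega), pow_succ]
      have h := hanti 1 le_rfl m
      rw [add_comm] at h
      exact mul_le_mul ih h (ha_nonneg _ (by omega)) (pow_nonneg (ha_nonneg 1 le_rfl) _)
  have h2 : ∀ m, ∏ k ∈ Finset.Icc 1 (n + m), a k ≤ a 1 ^ n * a n ^ m := by
    intro m
    induction m with
    | zero => simpa using h1 n
    | succ m ih =>
      rw [← add_assoc, Finset.prod_Icc_succ_top (by omega), pow_succ, ← mul_assoc]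
      exact mul_le_mul ih (hanti n hn (m + 1)) (ha_nonneg _ (by omega))
        (mul_nonneg (pow_nonneg (ha_nonneg 1 le_rfl) _) (pow_nonneg (ha_nonneg n hn) _))
  have h3 : ‖l (2 * n)‖ ^ (2 * n) ≤ ∏ k ∈ Finset.Icc 1 (2 * n), a k := by
    have h := pow_le_pow_left₀ (norm_nonneg _) (hweyl (2 * n) (by omega)) (2 * n)
    rwa [one_div, Real.rpow_inv_natCast_pow (hP0 _) (by omega)] at h
  have h4 : (‖l (2 * n)‖ ^ 2) ^ n ≤ (a 1 * a n) ^ n := by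
    rw [← pow_mul, mul_pow]
    refine h3.trans ?_
    rw [two_mul]
    exact h2 n
  exact le_of_pow_le_pow_left₀ (by omega)
    (mul_nonneg (ha_nonneg 1 le_rfl) (ha_nonneg n hn)) h4
end

section
/- Let (a_j)_{j≥1} and (b_k)_{k≥1} be sequences of points of the unit disk 𝔻, and suppose there exist holomorphic functions f_j : 𝔻 → ℂ and g_k : 𝔻 → ℂ (j, k ≥ 1) and constants M_A, M_B > 0 such that f_j(a_m) = δ_{j,m} and g_k(b_m) = δ_{k,m} for all indices, and ∑_{j≥1} |f_j(z)| ≤ M_A and ∑_{k≥1} |g_k(z)| ≤ M_B for every z ∈ 𝔻. Then for every doubly indexed family (w_{j,k}) of complex numbers with sup_{j,k} |w_{j,k}| ≤ 1, the function F(z, w) = ∑_{j,k≥1} w_{j,k} f_j(z) g_k(w) is holomorphic on the bidisk 𝔻², satisfies |F(z,w)| ≤ M_A · M_B for all (z,w) ∈ 𝔻², and F(a_j, b_k) = w_{j,k} for all j, k. In particular, the cartesian product ((a_j, b_k))_{j,k} is an interpolation sequence for H^∞(𝔻²) with interpolation constant at most M_A · M_B. -/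
open Metric

/-- Local uniform summability on smaller disks, via the Cauchy integral formula. -/
lemma exists_summable_bound_aux (f : ℕ → ℂ → ℂ) (M : ℝ)
    (hf : ∀ j, DifferentiableOn ℂ (f j) (ball (0 : ℂ) 1))
    (hs : ∀ z ∈ ball (0 : ℂ) 1, ∀ s : Finset ℕ, ∑ j ∈ s, ‖f j z‖ ≤ M)
    (r : ℝ) (hr0 : 0 < r) (hr : r < 1) :
    ∃ u : ℕ → ℝ, Summable u ∧ ∀ j, ∀ z ∈ closedBall (0 : ℂ) r, ‖f j z‖ ≤ u j := by
  obtain ⟨R, hrR, hR1⟩ := exists_between hr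
  have hR0 : 0 < R := hr0.trans hrR
  have hsub : closedBall (0 : ℂ) R ⊆ ball 0 1 := closedBall_subset_ball hR1
  have hmem : ∀ θ, circleMap 0 R θ ∈ ball (0 : ℂ) 1 := fun θ =>
    hsub (circleMap_mem_closedBall 0 hR0.le θ)
  have hcont : ∀ j, Continuous fun θ : ℝ => ‖f j (circleMap 0 R θ)‖ := fun j =>
    ((hf j).continuousOn.comp_continuous (continuous_circleMap 0 R) hmem).norm
  have hπ : (0 : ℝ) ≤ 2 * Real.pi := by positivity
  have hRr : 0 < R - r := sub_pos.2 hrR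
  let v : ℕ → ℝ := fun j => ∫ θ in (0 : ℝ)..2 * Real.pi, ‖f j (circleMap 0 R θ)‖
  have hv0 : ∀ j, 0 ≤ v j := fun j =>
    intervalIntegral.integral_nonneg hπ fun θ _ => norm_nonneg _
  have hv : Summable v := by
    refine summable_of_sum_le hv0 (c := 2 * Real.pi * M) fun s => ?_
    have h1 : ∑ j ∈ s, v j
        = ∫ θ in (0 : ℝ)..2 * Real.pi, ∑ j ∈ s, ‖f j (circleMap 0 R θ)‖ :=
      (intervalIntegral.integral_finsetSum fun j _ => (hcont j).intervalIntegrable _ _).symm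
    have h2 : ∫ θ in (0 : ℝ)..2 * Real.pi, ∑ j ∈ s, ‖f j (circleMap 0 R θ)‖
        ≤ ∫ θ in (0 : ℝ)..2 * Real.pi, M := by
      refine intervalIntegral.integral_mono_on hπ
        ((continuous_finsetSum s fun j _ => hcont j).intervalIntegrable _ _)
        (continuous_const.intervalIntegrable _ _) fun θ _ => hs _ (hmem θ) s
    rw [h1]
    refine h2.trans (le_of_eq ?_)
    simp
  refine ⟨fun j => (2 * Real.pi)⁻¹ * (R * (R - r)⁻¹) * v j, hv.mul_left _, fun j z hz => ?_⟩
  have hzr : ‖z‖ ≤ r := by simpa using hz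
  have hzR : z ∈ ball (0 : ℂ) R := by simpa using hzr.trans_lt hrR
  have hd : DifferentiableOn ℂ (f j) (closedBall 0 R) := (hf j).mono hsub
  have hC := hd.circleIntegral_sub_inv_smul hzR
  have hn : ‖∮ w in C(0, R), (w - z)⁻¹ • f j w‖ ≤ R * (R - r)⁻¹ * v j := by
    unfold circleIntegral
    have : R * (R - r)⁻¹ * v j
        = ∫ θ in (0 : ℝ)..2 * Real.pi, R * (R - r)⁻¹ * ‖f j (circleMap 0 R θ)‖ :=
      (intervalIntegral.integral_const_mul _ _).symm
    rw [this]
    refine intervalIntegral.norm_integral_le_of_norm_le hπ ?_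
      ((continuous_const.mul (hcont j)).intervalIntegrable _ _)
    refine Filter.Eventually.of_forall fun θ _ => ?_
    have h3 : R - r ≤ ‖circleMap 0 R θ - z‖ := by
      have := norm_sub_norm_le (circleMap 0 R θ) z
      have h4 : ‖circleMap 0 R θ‖ = R := by simp [circleMap, abs_of_pos hR0]
      linarith
    have h5 : ‖circleMap 0 R θ - z‖⁻¹ ≤ (R - r)⁻¹ := inv_anti₀ hRr h3
    have h6 : ‖deriv (circleMap 0 R) θ‖ = R := by simp [circleMap, abs_of_pos hR0]
    rw [norm_smul, norm_smul, norm_inv, h6, mul_assoc]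
    gcongr
  rw [hC, norm_smul] at hn
  have h7 : ‖(2 * Real.pi * Complex.I : ℂ)‖ = 2 * Real.pi := by
    simp [abs_of_pos Real.pi_pos]
  rw [h7] at hn
  beta_reduce
  rw [mul_assoc, ← div_eq_inv_mul, le_div_iff₀ (by positivity)]
  linarith

lemma exists_summable_bound (f : ℕ → ℂ → ℂ) (M : ℝ)
    (hf : ∀ j, DifferentiableOn ℂ (f j) (ball (0 : ℂ) 1))
    (hs : ∀ z ∈ ball (0 : ℂ) 1, ∀ s : Finset ℕ, ∑ j ∈ s, ‖f j z‖ ≤ M)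
    (r : ℝ) (hr0 : 0 < r) (hr : r < 1) :
    ∃ u : ℕ → ℝ, Summable u ∧ (∀ j, 0 ≤ u j) ∧
      ∀ j, ∀ z ∈ ball (0 : ℂ) r, ‖f j z‖ ≤ u j ∧ ‖deriv (f j) z‖ ≤ u j := by
  obtain ⟨R, hrR, hR1⟩ := exists_between hr
  obtain ⟨u, hu, hb⟩ := exists_summable_bound_aux f M hf hs R (hr0.trans hrR) hR1
  have hRr : 0 < R - r := sub_pos.2 hrR
  have hu0 : ∀ j, 0 ≤ u j := fun j =>
    (norm_nonneg _).trans (hb j 0 (by simpa using (hr0.trans hrR).le))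
  have hi : 0 ≤ (R - r)⁻¹ := by positivity
  refine ⟨fun j => (1 + (R - r)⁻¹) * u j, hu.mul_left _,
    fun j => mul_nonneg (by positivity) (hu0 j), fun j z hz => ?_⟩
  have hz' : ‖z‖ < r := by simpa using hz
  have hsub : closedBall z (R - r) ⊆ closedBall 0 R := by
    apply closedBall_subset_closedBall'
    rw [dist_zero_right]; linarith
  have h0 := mul_nonneg hi (hu0 j)
  constructor
  · have := hb j z (by simpa using (hz'.trans hrR).le)
    nlinarith
  · have hd : DiffContOnCl ℂ (f j) (ball z (R - r)) := by
      apply DifferentiableOn.diffContOnCl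
      apply (hf j).mono
      exact closure_ball_subset_closedBall.trans (hsub.trans (closedBall_subset_ball hR1))
    have := Complex.norm_deriv_le_of_forall_mem_sphere_norm_le hRr hd
      (fun w hw => hb j w (hsub (sphere_subset_closedBall hw)))
    rw [div_eq_inv_mul] at this
    linarith [hu0 j]

/-- Beurling-type product interpolation: given Beurling systems `(f_j)` for `(a_j)` and
`(g_k)` for `(b_k)` in the unit disk, with `∑_j |f_j| ≤ M_A` and `∑_k |g_k| ≤ M_B`, and any
data `(w_{j,k})` with `|w_{j,k}| ≤ 1`, the function
`F(z,w) = ∑_{j,k} w_{j,k} f_j(z) g_k(w)` is holomorphic on the bidisk, bounded by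
`M_A · M_B`, and interpolates: `F(a_j, b_k) = w_{j,k}`. In particular the cartesian product
`((a_j, b_k))` is an `H^∞(𝔻²)`-interpolation sequence with constant at most `M_A · M_B`. -/
theorem beurling_product_interpolation
    (a b : ℕ → ℂ) (ha : ∀ j, a j ∈ ball (0 : ℂ) 1) (hb : ∀ k, b k ∈ ball (0 : ℂ) 1)
    (f g : ℕ → ℂ → ℂ) (MA MB : ℝ) (hMA : 0 < MA) (hMB : 0 < MB)
    (hfdiff : ∀ j, DifferentiableOn ℂ (f j) (ball (0 : ℂ) 1))
    (hgdiff : ∀ k, DifferentiableOn ℂ (g k) (ball (0 : ℂ) 1))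
    (hfval : ∀ j m, f j (a m) = if j = m then 1 else 0)
    (hgval : ∀ k m, g k (b m) = if k = m then 1 else 0)
    (hfsum : ∀ z ∈ ball (0 : ℂ) 1, ∀ s : Finset ℕ, ∑ j ∈ s, ‖f j z‖ ≤ MA)
    (hgsum : ∀ z ∈ ball (0 : ℂ) 1, ∀ s : Finset ℕ, ∑ k ∈ s, ‖g k z‖ ≤ MB)
    (w : ℕ → ℕ → ℂ) (hw : ∀ j k, ‖w j k‖ ≤ 1) :
    DifferentiableOn ℂ
        (fun p : ℂ × ℂ => ∑' jk : ℕ × ℕ, w jk.1 jk.2 * f jk.1 p.1 * g jk.2 p.2)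
        (ball (0 : ℂ) 1 ×ˢ ball (0 : ℂ) 1) ∧
    (∀ p ∈ ball (0 : ℂ) 1 ×ˢ ball (0 : ℂ) 1,
        ‖∑' jk : ℕ × ℕ, w jk.1 jk.2 * f jk.1 p.1 * g jk.2 p.2‖ ≤ MA * MB) ∧
    (∀ j k, (∑' jk : ℕ × ℕ, w jk.1 jk.2 * f jk.1 (a j) * g jk.2 (b k)) = w j k) := by
  have hfS : ∀ z ∈ ball (0 : ℂ) 1, Summable fun j => ‖f j z‖ := fun z hz =>
    summable_of_sum_le (fun _ => norm_nonneg _) (hfsum z hz)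
  have hgS : ∀ z ∈ ball (0 : ℂ) 1, Summable fun j => ‖g j z‖ := fun z hz =>
    summable_of_sum_le (fun _ => norm_nonneg _) (hgsum z hz)
  have hle : ∀ (p : ℂ × ℂ) (jk : ℕ × ℕ),
      ‖w jk.1 jk.2 * f jk.1 p.1 * g jk.2 p.2‖ ≤ ‖f jk.1 p.1‖ * ‖g jk.2 p.2‖ := by
    intro p jk
    rw [norm_mul, norm_mul]
    have := mul_le_mul_of_nonneg_right (hw jk.1 jk.2) (norm_nonneg (f jk.1 p.1))
    rw [one_mul] at this
    exact mul_le_mul_of_nonneg_right this (norm_nonneg _)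
  have hprod : ∀ p ∈ ball (0 : ℂ) 1 ×ˢ ball (0 : ℂ) 1,
      Summable fun jk : ℕ × ℕ => ‖f jk.1 p.1‖ * ‖g jk.2 p.2‖ := fun p hp =>
    (hfS _ hp.1).mul_of_nonneg (hgS _ hp.2) (fun _ => norm_nonneg _) (fun _ => norm_nonneg _)
  refine ⟨?_, ?_, ?_⟩
  · intro p hp
    have hp1 : ‖p.1‖ < 1 := by simpa using hp.1
    have hp2 : ‖p.2‖ < 1 := by simpa using hp.2
    obtain ⟨r, hr, hr1⟩ := exists_between (max_lt hp1 hp2)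
    have hr0 : 0 < r := ((norm_nonneg _).trans (le_max_left _ _)).trans_lt hr
    obtain ⟨u, hu, hu0, hub⟩ := exists_summable_bound f MA hfdiff hfsum r hr0 hr1
    obtain ⟨v, hv, hv0, hvb⟩ := exists_summable_bound g MB hgdiff hgsum r hr0 hr1
    have huv : Summable fun jk : ℕ × ℕ => 2 * (u jk.1 * v jk.2) :=
      (hu.mul_of_nonneg hv hu0 hv0).mul_left 2
    have hpU : p ∈ ball (0 : ℂ) r ×ˢ ball (0 : ℂ) r :=
      ⟨by simpa using (le_max_left _ _).trans_lt hr, by simpa using (le_max_right _ _).trans_lt hr⟩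
    have hsub : ball (0 : ℂ) r ⊆ ball 0 1 := ball_subset_ball hr1.le
    have key := hasFDerivAt_tsum_of_isPreconnected (𝕜 := ℂ) (x₀ := p) (x := p)
      (f := fun (jk : ℕ × ℕ) (p : ℂ × ℂ) => w jk.1 jk.2 * (f jk.1 p.1 * g jk.2 p.2))
      (f' := fun jk q => w jk.1 jk.2 •
        (f jk.1 q.1 • (deriv (g jk.2) q.2 • ContinuousLinearMap.snd ℂ ℂ ℂ)
          + g jk.2 q.2 • (deriv (f jk.1) q.1 • ContinuousLinearMap.fst ℂ ℂ ℂ)))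
      huv (isOpen_ball.prod isOpen_ball)
      ((convex_ball (0 : ℂ) r).isPreconnected.prod (convex_ball (0 : ℂ) r).isPreconnected)
      ?_ ?_ hpU ?_ hpU
    · simp only [← mul_assoc] at key
      exact key.differentiableAt.differentiableWithinAt
    · rintro ⟨j, k⟩ q hq
      have h1 : HasDerivAt (f j) (deriv (f j) q.1) q.1 :=
        ((hfdiff j).differentiableAt (isOpen_ball.mem_nhds (hsub hq.1))).hasDerivAt
      have h2 : HasDerivAt (g k) (deriv (g k) q.2) q.2 :=
        ((hgdiff k).differentiableAt (isOpen_ball.mem_nhds (hsub hq.2))).hasDerivAt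
      have h3 := h1.comp_hasFDerivAt q (hasFDerivAt_fst (𝕜 := ℂ) (p := q))
      have h4 := h2.comp_hasFDerivAt q (hasFDerivAt_snd (𝕜 := ℂ) (p := q))
      exact (h3.mul h4).const_mul (w j k)
    · rintro ⟨j, k⟩ q hq
      obtain ⟨b1, b2⟩ := hub j q.1 hq.1
      obtain ⟨b3, b4⟩ := hvb k q.2 hq.2
      have n1 : ‖f j q.1 • (deriv (g k) q.2 • ContinuousLinearMap.snd ℂ ℂ ℂ)‖ ≤ u j * v k := by
        rw [norm_smul, norm_smul]
        refine mul_le_mul b1 ?_ (by positivity) (hu0 j)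
        exact (mul_le_of_le_one_right (norm_nonneg _)
          (ContinuousLinearMap.norm_snd_le ..)).trans b4
      have n2 : ‖g k q.2 • (deriv (f j) q.1 • ContinuousLinearMap.fst ℂ ℂ ℂ)‖ ≤ v k * u j := by
        rw [norm_smul, norm_smul]
        refine mul_le_mul b3 ?_ (by positivity) (hv0 k)
        exact (mul_le_of_le_one_right (norm_nonneg _)
          (ContinuousLinearMap.norm_fst_le ..)).trans b2
      rw [norm_smul]
      refine (mul_le_of_le_one_left (norm_nonneg _) (hw j k)).trans ?_
      refine (norm_add_le _ _).trans ?_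
      dsimp only
      linarith
    · simp only [← mul_assoc]
      exact Summable.of_norm_bounded (hprod p hp) (hle p)
  · intro p hp
    refine (tsum_of_norm_bounded (hprod p hp).hasSum (hle p)).trans ?_
    have h := (hfS _ hp.1).tsum_mul_tsum (hgS _ hp.2) (hprod p hp)
    rw [← h]
    exact mul_le_mul ((hfS _ hp.1).tsum_le_of_sum_le (hfsum _ hp.1))
      ((hgS _ hp.2).tsum_le_of_sum_le (hgsum _ hp.2))
      (tsum_nonneg fun _ => norm_nonneg _) hMA.le
  · intro j k
    rw [tsum_eq_single (j, k)]
    · simp [hfval, hgval]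
    · rintro ⟨j', k'⟩ h
      simp only [hfval, hgval]
      by_cases h1 : j' = j
      · have h2 : k' ≠ k := fun h2 => h (by rw [h1, h2])
        simp [h2]
      · simp [h1]
end

section
/- Let φ : 𝔻² → 𝔻² be the map φ(z_1, z_2) = (z_1, z_1). Then there is no bounded linear operator T on ℓ²(ℕ²) which is the composition operator C_φ; equivalently, there is no bounded T on ℓ²(ℕ²) such that for every c ∈ ℓ²(ℕ²) and every z = (z_1, z_2) ∈ 𝔻², ∑_α (T c)_α z^α = ∑_α c_α z_1^{α_1 + α_2}. Indeed, for f_n(z) = (z_1 + z_2)^n one has ‖f_n‖²_{H²(𝔻²)} = ∑_{k=0}^n C(n,k)² = C(2n,n), while ‖f_n ∘ φ‖_{H²(𝔻²)} = ‖(2z_1)^n‖ = 2^n, and 2^n/√C(2n,n) → ∞. -/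
open scoped ENNReal

noncomputable section

theorem aux_cb (n : ℕ) : (Nat.centralBinom n) ^ 2 * (2 * n + 1) ≤ 16 ^ n := by
  induction n with
  | zero => simp
  | succ n ih =>
    have h := Nat.succ_mul_centralBinom_succ n
    have h2 : (n + 1) ^ 2 * ((Nat.centralBinom (n + 1)) ^ 2 * (2 * (n + 1) + 1))
        = 4 * (2 * n + 1) * (2 * n + 3) * ((Nat.centralBinom n) ^ 2 * (2 * n + 1)) := by
      calc _ = ((n + 1) * Nat.centralBinom (n + 1)) ^ 2 * (2 * n + 3) := by ring
        _ = _ := by rw [h]; ring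
    have h3 : (n + 1) ^ 2 * ((Nat.centralBinom (n + 1)) ^ 2 * (2 * (n + 1) + 1))
        ≤ (n + 1) ^ 2 * 16 ^ (n + 1) := by
      rw [h2]
      calc _ ≤ 4 * (2 * n + 1) * (2 * n + 3) * 16 ^ n := Nat.mul_le_mul_left _ ih
        _ ≤ (16 * (n + 1) ^ 2) * 16 ^ n := Nat.mul_le_mul_right _ (by nlinarith)
        _ = _ := by ring
    exact Nat.le_of_mul_le_mul_left h3 (by positivity)

theorem aux_tendsto :
    Filter.Tendsto (fun n : ℕ => (2 : ℝ) ^ n / Real.sqrt ((2 * n).choose n))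
      Filter.atTop Filter.atTop := by
  have h1 : Filter.Tendsto (fun n : ℕ => Real.sqrt (Real.sqrt (n : ℝ)))
      Filter.atTop Filter.atTop :=
    Real.tendsto_sqrt_atTop.comp (Real.tendsto_sqrt_atTop.comp tendsto_natCast_atTop_atTop)
  refine Filter.tendsto_atTop_mono (fun n => ?_) h1
  have hb : ((Nat.centralBinom n : ℝ)) ^ 2 * (2 * n + 1) ≤ 16 ^ n := by
    exact_mod_cast aux_cb n
  have hpos : (0 : ℝ) < Nat.centralBinom n := by exact_mod_cast Nat.centralBinom_pos n
  have he : ((2 * n).choose n : ℝ) = Nat.centralBinom n := by rw [Nat.centralBinom]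
  rw [he]
  rw [le_div_iff₀ (Real.sqrt_pos.2 hpos), ← Real.sqrt_mul (Real.sqrt_nonneg _)]
  apply Real.sqrt_le_iff.2
  refine ⟨by positivity, ?_⟩
  have : Real.sqrt (n : ℝ) ≤ 4 ^ n / Nat.centralBinom n := by
    apply Real.sqrt_le_iff.2
    refine ⟨by positivity, ?_⟩
    rw [div_pow, le_div_iff₀ (by positivity)]
    have h16 : ((4 : ℝ) ^ n) ^ 2 = 16 ^ n := by rw [← pow_mul, mul_comm, pow_mul]; norm_num
    rw [h16]
    have hn : (0 : ℝ) ≤ n := by positivity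
    nlinarith [sq_nonneg (Nat.centralBinom n : ℝ), mul_nonneg hn (sq_nonneg (Nat.centralBinom n : ℝ))]
  rw [le_div_iff₀ hpos] at this
  have h4 : ((2 : ℝ) ^ n) ^ 2 = 4 ^ n := by rw [← pow_mul, mul_comm, pow_mul]; norm_num
  rw [h4]; exact this

theorem aux_hasSum (a b : ℝ) (ha : 0 ≤ a) (ha1 : a < 1) (hb : 0 ≤ b) (hb1 : b < 1) :
    HasSum (fun α : Fin 2 → ℕ => a ^ (α 0) * b ^ (α 1)) ((1 - a)⁻¹ * (1 - b)⁻¹) := by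
  have h1 := hasSum_geometric_of_lt_one ha ha1
  have h2 := hasSum_geometric_of_lt_one hb hb1
  have h3 := h1.mul h2 (h1.summable.mul_of_nonneg h2.summable
    (fun n => pow_nonneg ha n) (fun n => pow_nonneg hb n))
  exact (Equiv.hasSum_iff (finTwoArrowEquiv ℕ)
    (f := fun p : ℕ × ℕ => a ^ p.1 * b ^ p.2)).2 h3

theorem aux_kernel (a b : ℝ) (ha : 0 ≤ a) (ha1 : a < 1) (hb : 0 ≤ b) (hb1 : b < 1) :
    ∃ k : H2 2, (∀ α, k α = ((a : ℂ)) ^ (α 0) * (b : ℂ) ^ (α 1)) ∧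
      ‖k‖ ^ 2 = (1 - a ^ 2)⁻¹ * (1 - b ^ 2)⁻¹ := by
  have hs := aux_hasSum (a ^ 2) (b ^ 2) (by positivity) (by nlinarith) (by positivity)
    (by nlinarith)
  have hn : ∀ α : Fin 2 → ℕ, ‖((a : ℂ)) ^ (α 0) * (b : ℂ) ^ (α 1)‖ ^ 2
      = (a ^ 2) ^ (α 0) * (b ^ 2) ^ (α 1) := by
    intro α
    rw [norm_mul, norm_pow, norm_pow, Complex.norm_real, Complex.norm_real,
      Real.norm_of_nonneg ha, Real.norm_of_nonneg hb]
    ring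
  have hm : Memℓp (fun α : Fin 2 → ℕ => ((a : ℂ)) ^ (α 0) * (b : ℂ) ^ (α 1)) 2 := by
    apply memℓp_gen
    simp only [ENNReal.toReal_ofNat, Real.rpow_ofNat, hn]
    exact hs.summable
  refine ⟨⟨_, hm⟩, fun α => rfl, ?_⟩
  have := lp.norm_rpow_eq_tsum (p := 2) (by norm_num)
    (⟨_, hm⟩ : H2 2)
  simp only [ENNReal.toReal_ofNat, Real.rpow_ofNat] at this
  rw [this, ← hs.tsum_eq]
  exact tsum_congr hn

theorem aux_no : ¬ ∃ T : H2 2 →L[ℂ] H2 2,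
    IsCompositionOperator (fun z (_ : Fin 2) => z 0) T := by
  rintro ⟨T, hT⟩
  have key : ∀ r : ℝ, 0 ≤ r → r < 1 → (1 - r ^ 2)⁻¹ ≤ ‖T‖ ^ 2 := by
    intro r hr hr1
    obtain ⟨c, hc, hcn⟩ := aux_kernel r r hr hr1 hr hr1
    obtain ⟨k, hk, hkn⟩ := aux_kernel r 0 hr hr1 le_rfl one_pos
    obtain ⟨-, -, h⟩ := hT c ![(r : ℂ), 0] (by
      intro j
      fin_cases j
      · simpa [abs_of_nonneg hr] using hr1
      · simp)
    have hq : (0 : ℝ) < 1 - r ^ 2 := by nlinarith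
    set S := (1 - r ^ 2)⁻¹ with hS
    have hSpos : 0 < S := inv_pos.2 hq
    have hL : (∑' α : Fin 2 → ℕ, c α * ∏ j : Fin 2, (![(r : ℂ), 0] 0) ^ (α j)) = ((S * S : ℝ) : ℂ) := by
      rw [← (aux_hasSum (r ^ 2) (r ^ 2) (by positivity) (by nlinarith) (by positivity)
        (by nlinarith)).tsum_eq, Complex.ofReal_tsum]
      refine tsum_congr fun α => ?_
      rw [hc, Fin.prod_univ_two]
      simp
      ring
    have hR : (∑' α : Fin 2 → ℕ, (T c) α * ∏ j : Fin 2, (![(r : ℂ), 0] j) ^ (α j))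
        = inner ℂ k (T c) := by
      rw [lp.inner_eq_tsum]
      refine tsum_congr fun α => ?_
      rw [hk, Fin.prod_univ_two]
      simp
    have h' : ((S * S : ℝ) : ℂ) = inner ℂ k (T c) := by rw [← hL, ← hR]; exact h
    have hle : S * S ≤ ‖k‖ * (‖T‖ * ‖c‖) := by
      calc S * S = ‖((S * S : ℝ) : ℂ)‖ := by
            rw [Complex.norm_real, Real.norm_of_nonneg (by positivity)]
        _ = ‖inner ℂ k (T c)‖ := by rw [h']
        _ ≤ ‖k‖ * ‖T c‖ := norm_inner_le_norm _ _
        _ ≤ _ := by gcongr; exact T.le_opNorm c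
    have hsq : (S * S) ^ 2 ≤ (‖k‖ * (‖T‖ * ‖c‖)) ^ 2 := by gcongr
    have hkn' : ‖k‖ ^ 2 = S := by rw [hkn]; simp
    have hfin : S ^ 3 * S ≤ S ^ 3 * ‖T‖ ^ 2 := by
      calc S ^ 3 * S = (S * S) ^ 2 := by ring
        _ ≤ _ := hsq
        _ = ‖k‖ ^ 2 * ‖c‖ ^ 2 * ‖T‖ ^ 2 := by ring
        _ = _ := by rw [hkn', hcn]; ring
    exact le_of_mul_le_mul_left hfin (by positivity)
  set M := ‖T‖ ^ 2 + 1 with hM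
  have hM1 : 1 ≤ M := by have := sq_nonneg ‖T‖; linarith
  have hMi : M⁻¹ ≤ 1 := inv_le_one_of_one_le₀ hM1
  have hMp : 0 < M⁻¹ := by positivity
  have := key (Real.sqrt (1 - M⁻¹)) (Real.sqrt_nonneg _)
    (by rw [Real.sqrt_lt' one_pos]; linarith)
  rw [Real.sq_sqrt (by linarith), sub_sub_cancel, inv_inv] at this
  linarith

/-- The map `φ(z₁, z₂) = (z₁, z₁)` induces no bounded composition operator on
`H²(𝔻²) ≃ ℓ²(ℕ²)`. Indeed for `f_n(z) = (z₁ + z₂)^n` one has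
`‖f_n‖² = ∑ C(n,k)² = C(2n,n)` while `‖f_n ∘ φ‖ = 2^n`, and `2^n/√C(2n,n) → ∞`. -/
theorem no_bounded_composition_operator_diagonal :
    (∀ n : ℕ, ∑ k ∈ Finset.range (n + 1), (n.choose k) ^ 2 = (2 * n).choose n) ∧
    Filter.Tendsto (fun n : ℕ => (2 : ℝ) ^ n / Real.sqrt ((2 * n).choose n))
      Filter.atTop Filter.atTop ∧
    ¬ ∃ T : H2 2 →L[ℂ] H2 2,
        IsCompositionOperator (fun z (_ : Fin 2) => z 0) T :=
  ⟨fun n => Nat.sum_range_choose_sq n, aux_tendsto, aux_no⟩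
end
end

section
/- Let l_1, l_2 ≥ 1 be integers, let 0 ≤ r < 1, let p, q ≥ 0 be integers, and set N = p + q. Let w ∈ ℂ^{l_1} with ∑_{j=1}^{l_1} |w_j|² ≤ r² and w' ∈ ℂ^{l_2} with ∑_{j=1}^{l_2} |w'_j|² ≤ r². Then ∑_{β ∈ ℕ^{l_1}, |β| = p} ∑_{γ ∈ ℕ^{l_2}, |γ| = q} [(l_1 − 1 + p)!/(β! (l_1 − 1)!)] · [(l_2 − 1 + q)!/(γ! (l_2 − 1)!)] · ∏_j |w_j|^{2β_j} · ∏_j |w'_j|^{2γ_j} ≤ (N + 1)^{l_1 + l_2 − 2} · r^{2N}. -/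
lemma single_ball_estimate (l : ℕ) (r : ℝ) (p : ℕ) (w : Fin l → ℂ)
    (hw : ∑ j, ‖w j‖ ^ 2 ≤ r ^ 2) :
    ∑ β ∈ Finset.Nat.antidiagonalTuple l p,
        (((l - 1 + p).factorial : ℝ) /
            ((∏ j, ((β j).factorial : ℝ)) * ((l - 1).factorial : ℝ))) *
          (∏ j, ‖w j‖ ^ (2 * β j))
      ≤ ((p : ℝ) + 1) ^ (l - 1) * r ^ (2 * p) := by
  generalize l - 1 = m
  have hs : Finset.Nat.antidiagonalTuple l p = Finset.univ.piAntidiag p := by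
    ext β
    simp [Finset.Nat.mem_antidiagonalTuple]
  have key : ∑ β ∈ Finset.Nat.antidiagonalTuple l p,
        (((m + p).factorial : ℝ) /
            ((∏ j, ((β j).factorial : ℝ)) * (m.factorial : ℝ))) *
          (∏ j, ‖w j‖ ^ (2 * β j))
      = ((m + p).choose m : ℝ) * (∑ j, ‖w j‖ ^ 2) ^ p := by
    rw [Finset.sum_pow_eq_sum_piAntidiag, ← hs, Finset.mul_sum]
    refine Finset.sum_congr rfl fun β hβ => ?_
    rw [Finset.Nat.mem_antidiagonalTuple] at hβ
    have h1 := Nat.multinomial_spec Finset.univ β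
    rw [hβ] at h1
    have h2 : (∏ j, ((β j).factorial : ℝ)) * (Nat.multinomial Finset.univ β : ℝ)
        = (p.factorial : ℝ) := by exact_mod_cast h1
    have h3 : ((m + p).choose m : ℝ) * (m.factorial : ℝ) * (p.factorial : ℝ)
        = ((m + p).factorial : ℝ) := by
      have h := Nat.add_choose_mul_factorial_mul_factorial m p
      rw [← Nat.choose_symm_add] at h
      exact_mod_cast h
    have h4 : (∏ j, ((β j).factorial : ℝ)) ≠ 0 :=
      Finset.prod_ne_zero_iff.2 fun j _ => by positivity
    have h5 : (m.factorial : ℝ) ≠ 0 := by positivity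
    simp only [pow_mul]
    rw [← mul_assoc]
    congr 1
    rw [div_eq_iff (mul_ne_zero h4 h5), ← h3, ← h2]
    ring
  rw [key]
  have hc : ((m + p).choose m : ℝ) ≤ ((p : ℝ) + 1) ^ m := by
    have := Nat.choose_le_sub_pow (m + p) m
    rw [show m + p + 1 - m = p + 1 by omega] at this
    exact_mod_cast this
  rw [pow_mul]
  have h0 : 0 ≤ ∑ j, ‖w j‖ ^ 2 := Finset.sum_nonneg fun j _ => by positivity
  gcongr


/-- Key pointwise estimate on `Ω = B_{l₁} × B_{l₂}`: if `∑_j |w_j|² ≤ r²` and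
`∑_j |w'_j|² ≤ r²`, then, with `N = p + q`,
`∑_{|β|=p} ∑_{|γ|=q} [(l₁−1+p)!/(β!(l₁−1)!)]·[(l₂−1+q)!/(γ!(l₂−1)!)]·|w^β|²·|w'^γ|²
  ≤ (N+1)^{l₁+l₂−2} r^{2N}`. -/
theorem pointwise_estimate_product_balls (l₁ l₂ : ℕ) (hl₁ : 1 ≤ l₁) (hl₂ : 1 ≤ l₂)
    (r : ℝ) (hr0 : 0 ≤ r) (hr1 : r < 1) (p q : ℕ)
    (w : Fin l₁ → ℂ) (w' : Fin l₂ → ℂ)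
    (hw : ∑ j, ‖w j‖ ^ 2 ≤ r ^ 2)
    (hw' : ∑ j, ‖w' j‖ ^ 2 ≤ r ^ 2) :
    ∑ β ∈ Finset.Nat.antidiagonalTuple l₁ p, ∑ γ ∈ Finset.Nat.antidiagonalTuple l₂ q,
        (((l₁ - 1 + p).factorial : ℝ) /
            ((∏ j, ((β j).factorial : ℝ)) * ((l₁ - 1).factorial : ℝ))) *
          (((l₂ - 1 + q).factorial : ℝ) /
            ((∏ j, ((γ j).factorial : ℝ)) * ((l₂ - 1).factorial : ℝ))) *
          (∏ j, ‖w j‖ ^ (2 * β j)) * (∏ j, ‖w' j‖ ^ (2 * γ j))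
      ≤ ((p + q : ℝ) + 1) ^ (l₁ + l₂ - 2) * r ^ (2 * (p + q)) := by
  have h1 := single_ball_estimate l₁ r p w hw
  have h2 := single_ball_estimate l₂ r q w' hw'
  have h3 := mul_le_mul h1 h2 (Finset.sum_nonneg fun γ _ => by positivity) (by positivity)
  rw [Finset.sum_mul_sum] at h3
  refine le_trans (le_of_eq ?_) (h3.trans ?_)
  · refine Finset.sum_congr rfl fun β _ => Finset.sum_congr rfl fun γ _ => ?_
    ring
  · rw [show l₁ + l₂ - 2 = (l₁ - 1) + (l₂ - 1) by omega, mul_add, pow_add, pow_add r,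
      mul_mul_mul_comm]
    have hp : (0 : ℝ) ≤ p := Nat.cast_nonneg p
    have hq : (0 : ℝ) ≤ q := Nat.cast_nonneg q
    gcongr <;> linarith
end
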